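/- arXiv:1607.02518 — 3 statements merged into one kernel-verified Lean document; each statement's English description precedes it below -/
import Mathlib

section
/- Genus-0 m-hypermap (Bousquet-Mélou–Schaeffer) formula: Let n ≥ 1, m ≥ 2, and let α = (α_1, …, α_ℓ) be a partition of n with ℓ parts (parts equal to 1 included). Fix a permutation σ of {1, …, n} of cycle type α. Then the number of transitive factorizations (π_1, …, π_m) of σ satisfying the genus-zero condition ∑_{i=1}^{m} (n − ℓ(π_i)) = n + ℓ − 2, where ℓ(π_i) is the total number of cycles of π_i including fixed points, equals, as a rational number, m · ((m−1)n − 1)! / ((m−1)n − ℓ + 2)! · ∏_{j=1}^{ℓ} α_j · binom(m·α_j − 1, α_j). -/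
theorem MvPowerSeries.exists_fixedPoint {σ R : Type*} [CommRing R]
    (f : MvPowerSeries σ R → MvPowerSeries σ R)
    (hf : ∀ (n : ℕ) (a b : MvPowerSeries σ R), (n : ℕ∞) ≤ (a - b).order →
      ((n + 1 : ℕ) : ℕ∞) ≤ (f a - f b).order) : ∃ y, f y = y := by
  have h1 : ∀ n : ℕ, (n : ℕ∞) ≤ (f^[n] 0 - f^[n + 1] 0).order := by
    intro n
    induction n with
    | zero => simp
    | succ n ih =>
      rw [Function.iterate_succ_apply', Function.iterate_succ_apply' f (n + 1)]
      exact hf n _ _ ih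
  have h2 : ∀ k n : ℕ, (n : ℕ∞) ≤ (f^[n] 0 - f^[n + k] 0).order := by
    intro k n
    induction k with
    | zero => simp
    | succ k ih =>
      have e : f^[n] 0 - f^[n + (k + 1)] 0
          = (f^[n] 0 - f^[n + k] 0) + (f^[n + k] 0 - f^[n + k + 1] 0) := by
        rw [← add_assoc]; ring
      rw [e]
      refine le_trans (le_min ih ?_) min_order_le_add
      exact le_trans (by exact_mod_cast Nat.le_add_right n k) (h1 (n + k))
  let y : MvPowerSeries σ R := fun d => coeff d (f^[d.degree + 1] 0)
  have hy : ∀ n : ℕ, (n : ℕ∞) ≤ (y - f^[n] 0).order := by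
    intro n
    refine nat_le_order fun d hd => ?_
    obtain ⟨k, rfl⟩ : ∃ k, n = d.degree + 1 + k := ⟨n - (d.degree + 1), by omega⟩
    have := coeff_of_lt_order (f := f^[d.degree + 1] 0 - f^[d.degree + 1 + k] 0) (d := d)
      (lt_of_lt_of_le (by exact_mod_cast Nat.lt_succ_self _) (h2 k (d.degree + 1)))
    rw [map_sub] at this ⊢
    exact this
  refine ⟨y, ?_⟩
  ext d
  have h3 := hf _ _ _ (hy d.degree)
  rw [← Function.iterate_succ_apply' f] at h3
  have := coeff_of_lt_order (d := d) (lt_of_lt_of_le (by exact_mod_cast Nat.lt_succ_self _) h3)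
  rw [map_sub, sub_eq_zero] at this
  exact this

theorem MvPowerSeries.exists_eq_one_add_sum {σ R : Type*} [CommRing R]
    (J : Finset σ) (B : σ → R) (e : σ → ℕ) :
    ∃ a : MvPowerSeries σ R, a = 1 + ∑ j ∈ J, C (B j) * X j * a ^ e j := by
  suffices h : ∃ y : MvPowerSeries σ R, 1 + ∑ j ∈ J, C (B j) * X j * y ^ e j = y by
    obtain ⟨y, hy⟩ := h
    exact ⟨y, hy.symm⟩
  refine exists_fixedPoint (fun a => 1 + ∑ j ∈ J, C (B j) * X j * a ^ e j) fun n a b hab => ?_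
  rw [add_sub_add_left_eq_sub, ← Finset.sum_sub_distrib]
  refine nat_le_order fun d hd => ?_
  rw [map_sum]
  refine Finset.sum_eq_zero fun j _ => ?_
  obtain ⟨q, hq⟩ := sub_dvd_pow_sub_pow a b (e j)
  have e1 : C (B j) * X j * a ^ e j - C (B j) * X j * b ^ e j = X j * (a - b) * (C (B j) * q) := by
    rw [← mul_sub, hq]; ring
  rw [e1]
  refine coeff_of_lt_order (lt_of_lt_of_le (Nat.cast_lt.mpr hd) (le_trans ?_ le_order_mul))
  have hX : (1 : ℕ∞) ≤ (X j : MvPowerSeries σ R).order := by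
    rw [one_le_order_iff_constCoeff_eq_zero]
    simp
  refine le_trans ?_ (le_trans (add_le_add hX hab) (le_trans le_order_mul le_self_add))
  rw [add_comm n 1]
  push_cast
  exact le_rfl

/-- The weight `c * binom (m c - 1) c` attached to a cycle of length `c`. -/
def cycleWeight (m c : ℕ) : ℕ := c * (m * c - 1).choose c

theorem mul_cycleWeight (m c : ℕ) (hm : 1 ≤ m) :
    m * cycleWeight m c = (m - 1) * c * (m * c).choose c := by
  unfold cycleWeight
  rcases Nat.eq_zero_or_pos c with rfl | hc
  · simp
  obtain ⟨N, hN⟩ : ∃ N, m * c = N + 1 := ⟨m * c - 1, by have := Nat.mul_pos hm hc; omega⟩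
  have h := Nat.choose_mul_succ_eq N c
  have h2 : N + 1 - c = (m - 1) * c := by rw [← hN, Nat.sub_mul, one_mul]
  rw [h2] at h
  rw [hN, Nat.add_sub_cancel, ← mul_assoc, hN, mul_comm, h, mul_comm]

theorem PowerSeries.coeff_sub_one_pow_eq_zero {R : Type*} [CommRing R] {y : PowerSeries R}
    (hy : constantCoeff y = 1) (d j : ℕ) (hj : d < j) :
    coeff d ((y - 1) ^ j) = 0 := by
  have : X ∣ y - 1 := by rw [X_dvd_iff]; simp [hy]
  have := pow_dvd_pow_of_dvd this j
  rw [X_pow_dvd_iff] at this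
  exact this d hj

section
variable {k : Type*} [Field k] [CharZero k]

theorem sum_mul_choose_mul_choose (m c d : ℕ) :
    (m : k) * (c + d) * ∑ j ∈ Finset.range (d + 1),
      (j : k) * ((m * c).choose (c + j) * (m * d).choose (d - j))
    = (m * c - c) * d * ((m * c).choose c * (m * d).choose d) := by
  suffices h : ∀ N ≤ d, (m : k) * (c + d) * ∑ j ∈ Finset.range (N + 1),
      (j : k) * ((m * c).choose (c + j) * (m * d).choose (d - j))
      + (m * c - c - N) * (d - N) * ((m * c).choose (c + N) * (m * d).choose (d - N))
    = (m * c - c) * d * ((m * c).choose c * (m * d).choose d) by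
    have := h d le_rfl
    simpa using this
  intro N hN
  induction N with
  | zero => simp
  | succ N ih =>
    rw [Finset.sum_range_succ, mul_add, ← ih (by omega)]
    obtain ⟨e, rfl⟩ : ∃ e, d = N + 1 + e := ⟨d - (N + 1), by omega⟩
    have h1 : ((m * c).choose (c + N + 1) : k) * (c + N + 1)
        = (m * c).choose (c + N) * (m * c - (c + N)) := by
      by_cases h : c + N ≤ m * c
      · have := Nat.choose_succ_right_eq (m * c) (c + N)
        have := congrArg (Nat.cast (R := k)) this
        push_cast [Nat.cast_sub h] at this
        exact this
      · rw [Nat.choose_eq_zero_of_lt (by omega), Nat.choose_eq_zero_of_lt (by omega)]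
        simp
    have h2 : ((m * (N + 1 + e)).choose (e + 1) : k) * (e + 1)
        = (m * (N + 1 + e)).choose e * (m * (N + 1 + e) - e) := by
      by_cases h : e ≤ m * (N + 1 + e)
      · have := Nat.choose_succ_right_eq (m * (N + 1 + e)) e
        have := congrArg (Nat.cast (R := k)) this
        push_cast [Nat.cast_sub h] at this
        exact this
      · rw [Nat.choose_eq_zero_of_lt (by omega), Nat.choose_eq_zero_of_lt (by omega)]
        simp
    have e1 : N + 1 + e - (N + 1) = e := by omega
    have e2 : N + 1 + e - N = e + 1 := by omega
    rw [e1, e2, ← add_assoc c N 1]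
    push_cast
    set P := ((m * c).choose (c + N + 1) : k)
    set Q := ((m * c).choose (c + N) : k)
    set R := ((m * (N + 1 + e)).choose (e + 1) : k)
    set S := ((m * (N + 1 + e)).choose e : k)
    have h3 : Q * (m * c - (c + N)) * (R * (e + 1)) =
      P * (c + N + 1) * (S * (m * (N + 1 + e) - e)) := by rw [h1, h2]
    linear_combination -h3

theorem sum_mul_choose_mul_choose_eq_cycleWeight (m c d : ℕ) (hm : 2 ≤ m) (hc : 1 ≤ c) :
    (m - 1 : k) * (c + d) * ∑ j ∈ Finset.range (d + 1),
      (j : k) * ((m * c).choose (c + j) * (m * d).choose (d - j))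
    = m * (cycleWeight m c * cycleWeight m d) := by
  have h0 := sum_mul_choose_mul_choose (k := k) m c d
  have h1 : ∀ c : ℕ, (m : k) * cycleWeight m c = (m - 1) * c * (m * c).choose c := by
    intro c
    have := congrArg (Nat.cast (R := k)) (mul_cycleWeight m c (by omega))
    push_cast [Nat.cast_sub (show 1 ≤ m by omega)] at this
    exact this
  have hm0 : (m : k) ≠ 0 := by exact_mod_cast (by omega : m ≠ 0)
  have hc0 : (c : k) ≠ 0 := by exact_mod_cast (by omega : c ≠ 0)
  apply mul_left_cancel₀ hm0
  have h2 := h1 c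
  have h3 := h1 d
  calc _ = (m - 1 : k) * ((m : k) * (c + d) * ∑ j ∈ Finset.range (d + 1),
      (j : k) * ((m * c).choose (c + j) * (m * d).choose (d - j))) := by ring
    _ = ((m - 1) * c * (m * c).choose c) * ((m - 1) * d * (m * d).choose d) := by rw [h0]; ring
    _ = _ := by rw [← h2, ← h3]; ring

namespace PowerSeries

theorem coeff_pow_of_eq_one_add_X_mul_pow {m : ℕ} (hm : 1 ≤ m) {y : PowerSeries k}
    (hy : y = 1 + X * y ^ m) (n e : ℕ) :
    (e + m * n : k) * coeff n (y ^ e) = e * (e + m * n).choose n := by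
  have hy0 : constantCoeff y = 1 := by rw [hy]; simp
  induction n generalizing e with
  | zero => simp [hy0]
  | succ n ih =>
    induction e with
    | zero => simp [coeff_one]
    | succ e ihe =>
      have h1 : y ^ (e + 1) = y ^ e + X * y ^ (e + m) := by
        rw [pow_succ]
        nth_rewrite 2 [hy]
        ring
      rw [h1, map_add, coeff_succ_X_mul]
      have h2 := ih (e + m)
      have e1 : e + m + m * n = e + m * (n + 1) := by ring
      rw [e1] at h2
      have e2 : e + 1 + m * (n + 1) = (e + m * (n + 1)) + 1 := by ring
      rw [e2, Nat.choose_succ_succ]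
      have hM : ((e + m * (n + 1) : ℕ) : k) ≠ 0 := by
        have : 0 < m * (n + 1) := by positivity
        exact_mod_cast (by omega : e + m * (n + 1) ≠ 0)
      have h3 : n ≤ e + m * (n + 1) := by nlinarith
      have h4 := congrArg (Nat.cast (R := k)) (Nat.choose_succ_right_eq (e + m * (n + 1)) n)
      push_cast [Nat.cast_sub h3] at h2 h4 ihe hM ⊢
      apply mul_left_cancel₀ hM
      linear_combination (e + m * (n + 1) + 1 : k) * ihe + (e + m * (n + 1) + 1 : k) * h2 - m * h4

theorem coeff_sub_one_pow_of_eq_one_add_X_mul_pow {m : ℕ} (hm : 1 ≤ m) {y : PowerSeries k}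
    (hy : y = 1 + X * y ^ m) (d j : ℕ) (hj : j ≤ d) :
    (d : k) * coeff d ((y - 1) ^ j) = j * (m * d).choose (d - j) := by
  obtain ⟨n, rfl⟩ : ∃ n, d = n + j := ⟨d - j, by omega⟩
  have hz : y - 1 = X * y ^ m := by rw [sub_eq_iff_eq_add]; rw [add_comm]; exact hy
  rw [hz, mul_pow, ← pow_mul, coeff_X_pow_mul]
  have h := coeff_pow_of_eq_one_add_X_mul_pow hm hy n (m * j)
  have hm0 : (m : k) ≠ 0 := by exact_mod_cast (by omega : m ≠ 0)
  apply mul_left_cancel₀ hm0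
  rw [Nat.add_sub_cancel, show m * (n + j) = m * j + m * n by ring]
  push_cast at h ⊢
  linear_combination h

end PowerSeries
end

section Newton
variable {κ R : Type*} [CommRing R]

/-- The elementary symmetric function of degree `j` of the values of `f` on `t`, with the sign
it has as a coefficient of `∏ i ∈ t, (X - f i)`. -/
def signedEsymm (t : Finset κ) (f : κ → R) (j : ℕ) : R := (-1) ^ j * (t.val.map f).esymm j

theorem signedEsymm_zero (t : Finset κ) (f : κ → R) : signedEsymm t f 0 = 1 := by
  simp [signedEsymm, Multiset.esymm]

theorem signedEsymm_eq_zero (t : Finset κ) (f : κ → R) {j : ℕ} (h : t.card < j) :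
    signedEsymm t f j = 0 := by
  rw [signedEsymm, Multiset.esymm, Multiset.powersetCard_eq_empty _ (by simpa using h)]
  simp

theorem coeff_prod_X_sub_C_eq_signedEsymm (t : Finset κ) (f : κ → R) {j : ℕ} (h : j ≤ t.card) :
    (∏ i ∈ t, (Polynomial.X - Polynomial.C (f i))).coeff (t.card - j) = signedEsymm t f j := by
  have h1 := Multiset.prod_X_sub_C_coeff (t.val.map f) (k := t.card - j) (by simp)
  rw [Multiset.map_map] at h1
  simp only [Multiset.card_map, Finset.card_val] at h1
  rw [Nat.sub_sub_self h] at h1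
  exact h1

theorem signedEsymm_insert [DecidableEq κ] {t : Finset κ} {a : κ} (ha : a ∉ t) (f : κ → R) (j : ℕ) :
    signedEsymm (insert a t) f (j + 1) = signedEsymm t f (j + 1) - f a * signedEsymm t f j := by
  unfold signedEsymm
  rw [Finset.insert_val_of_notMem ha, Multiset.map_cons, Multiset.esymm, Multiset.powersetCard_cons,
    Multiset.map_add, Multiset.sum_add, Multiset.map_map, Multiset.esymm, Multiset.esymm]
  simp only [Function.comp_def, Multiset.prod_cons, Multiset.sum_map_mul_left]
  ring

theorem mul_signedEsymm_eq_neg_sum (t : Finset κ) (f : κ → R) (j : ℕ) :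
    j * signedEsymm t f j = - ∑ a ∈ Finset.HasAntidiagonal.antidiagonal j with a.1 < j,
      signedEsymm t f a.1 * ∑ i ∈ t, f i ^ a.2 := by
  have h := congrArg (MvPolynomial.aeval (fun i : t => f i)) (MvPolynomial.mul_esymm_eq_sum t R j)
  have e : ∀ j, MvPolynomial.aeval (fun i : t => f i) (MvPolynomial.esymm t R j)
      = (t.val.map f).esymm j := by
    intro j
    rw [MvPolynomial.aeval_esymm_eq_multiset_esymm]
    congr 1
    exact t.val.attach_map_val' f
  simp only [map_mul, map_natCast, map_sum, map_pow, map_neg, map_one, e, MvPolynomial.psum,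
    MvPolynomial.aeval_X] at h
  simp only [signedEsymm]
  rw [mul_left_comm, h, pow_succ, ← mul_assoc, ← mul_assoc, ← pow_add, Even.neg_one_pow ⟨j, rfl⟩,
    one_mul, neg_one_mul]
  congr 1
  refine Finset.sum_congr rfl fun a _ => ?_
  rw [Finset.sum_coe_sort t (fun i => f i ^ a.2)]

theorem sum_pow_eq_neg (t : Finset κ) (f : κ → R) {j : ℕ} (hj : 1 ≤ j) :
    ∑ i ∈ t, f i ^ j = - (j * signedEsymm t f j) -
      ∑ a ∈ Finset.HasAntidiagonal.antidiagonal j with 1 ≤ a.1 ∧ a.1 < j,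
        signedEsymm t f a.1 * ∑ i ∈ t, f i ^ a.2 := by
  classical
  have e : (Finset.HasAntidiagonal.antidiagonal j).filter (fun a => a.1 < j) =
      insert (0, j) ((Finset.HasAntidiagonal.antidiagonal j).filter
        (fun a => 1 ≤ a.1 ∧ a.1 < j)) := by
    ext ⟨a, b⟩
    simp only [Finset.mem_filter, Finset.HasAntidiagonal.mem_antidiagonal, Finset.mem_insert,
      Prod.mk.injEq]
    omega
  rw [mul_signedEsymm_eq_neg_sum, e, Finset.sum_insert (by simp), signedEsymm_zero]
  ring

variable {k : Type*} [Field k] [Algebra k R]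

theorem sum_pow_mem (N : Submodule k R) (hN : ∀ a ∈ N, ∀ b ∈ N, a * b ∈ N)
    (t : Finset κ) (f : κ → R) (i : ℕ) (h : ∀ j, 1 ≤ j → j ≤ i → signedEsymm t f j ∈ N) :
    ∀ j, 1 ≤ j → j ≤ i → ∑ x ∈ t, f x ^ j ∈ N := by
  intro j
  induction j using Nat.strong_induction_on with
  | _ j ih =>
    intro h1 h2
    rw [sum_pow_eq_neg t f h1]
    refine N.sub_mem (N.neg_mem ?_) (N.sum_mem fun a ha => ?_)
    · rw [← nsmul_eq_mul]
      exact N.nsmul_mem (h j h1 h2) j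
    · simp only [Finset.mem_filter, Finset.HasAntidiagonal.mem_antidiagonal] at ha
      exact hN _ (h _ (by omega) (by omega)) _ (ih _ (by omega) (by omega) (by omega))

theorem signedEsymm_mem [CharZero k] (N : Submodule k R) (hN : ∀ a ∈ N, ∀ b ∈ N, a * b ∈ N)
    (t : Finset κ) (f : κ → R) (i : ℕ) (h : ∀ j, 1 ≤ j → j ≤ i → ∑ x ∈ t, f x ^ j ∈ N) :
    ∀ j, 1 ≤ j → j ≤ i → signedEsymm t f j ∈ N := by
  intro j
  induction j using Nat.strong_induction_on with
  | _ j ih =>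
    intro h1 h2
    have h3 : (j : R) * signedEsymm t f j ∈ N := by
      rw [mul_signedEsymm_eq_neg_sum]
      refine N.neg_mem (N.sum_mem fun a ha => ?_)
      simp only [Finset.mem_filter, Finset.HasAntidiagonal.mem_antidiagonal] at ha
      have hp := h a.2 (by omega) (by omega)
      rcases Nat.eq_zero_or_pos a.1 with h0 | h0
      · rw [h0, signedEsymm_zero, one_mul]
        exact hp
      · exact hN _ (ih _ (by omega) (by omega) (by omega)) _ hp
    have hj : (j : k) ≠ 0 := by exact_mod_cast (by omega : j ≠ 0)
    have h4 := N.smul_mem (j : k)⁻¹ h3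
    rwa [← nsmul_eq_mul, ← Nat.cast_smul_eq_nsmul k, smul_smul, inv_mul_cancel₀ hj, one_smul] at h4

end Newton

section Monomials
variable {k A : Type*} [CommRing k] [CommRing A] [Algebra k A]

theorem pow_mul_pow_mem_of_mul_eq_add (N : Submodule k A) {y u : A} (h : y * u = y + u) (i : ℕ)
    (hy : ∀ j, 1 ≤ j → j ≤ i → y ^ j ∈ N) (hu : ∀ j, 1 ≤ j → u ^ j ∈ N) :
    ∀ a b, a ≤ i → 1 ≤ a + b → y ^ a * u ^ b ∈ N := by
  suffices H : ∀ n a b, a + b = n → a ≤ i → 1 ≤ a + b → y ^ a * u ^ b ∈ N from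
    fun a b => H _ a b rfl
  intro n
  induction n using Nat.strong_induction_on with
  | _ n ih =>
    intro a b hab hai h1
    rcases a with _ | a
    · simpa using hu b (by omega)
    rcases b with _ | b
    · simpa using hy (a + 1) (by omega) hai
    have e : y ^ (a + 1) * u ^ (b + 1) = y ^ (a + 1) * u ^ b + y ^ a * u ^ (b + 1) := by
      calc _ = y ^ a * u ^ b * (y * u) := by ring
        _ = _ := by rw [h]; ring
    rw [e]
    exact N.add_mem (ih _ (by omega) _ _ rfl hai (by omega))
      (ih _ (by omega) _ _ rfl (by omega) (by omega))

theorem add_aeval_pow_sub_pow_mem (N : Submodule k A) {y u : A} (h : y * u = y + u) (i : ℕ)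
    (hy : ∀ j, 1 ≤ j → j < i → y ^ j ∈ N) (hu : ∀ j, 1 ≤ j → u ^ j ∈ N)
    (D : Polynomial k) (hD : D.coeff 0 = 0) :
    (y + Polynomial.aeval u D) ^ i - y ^ i ∈ N := by
  rw [add_pow, Finset.sum_range_succ]
  simp only [Nat.sub_self, pow_zero, mul_one, Nat.choose_self, Nat.cast_one, add_sub_cancel_right]
  refine N.sum_mem fun a ha => ?_
  rw [Finset.mem_range] at ha
  have hy' := fun a b => pow_mul_pow_mem_of_mul_eq_add N h (i - 1)
    (fun j h1 h2 => hy j h1 (by omega)) hu a b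
  rw [mul_comm, ← nsmul_eq_mul]
  refine N.nsmul_mem ?_ _
  rw [← map_pow, Polynomial.aeval_eq_sum_range, Finset.mul_sum]
  refine N.sum_mem fun b _ => ?_
  rw [mul_smul_comm]
  rcases Nat.eq_zero_or_pos b with rfl | hb
  · rw [Polynomial.coeff_zero_eq_eval_zero, Polynomial.eval_pow,
      ← Polynomial.coeff_zero_eq_eval_zero, hD, zero_pow (by omega), zero_smul]
    exact N.zero_mem
  · exact N.smul_mem _ (hy' a b (by omega) (by omega))

end Monomials

open Polynomial in
theorem exists_prod_X_sub_C_eq {K : Type*} [Field K] [IsAlgClosed K] (p : K[X]) (hp : p.Monic) :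
    ∃ (κ : Type) (_ : Fintype κ) (y : κ → K), Fintype.card κ = p.natDegree ∧
      ∏ i, (X - C (y i)) = p := by
  classical
  refine ⟨Fin p.roots.toList.length, inferInstance, fun i => p.roots.toList.get i, ?_, ?_⟩
  · rw [Fintype.card_fin, Multiset.length_toList, (IsAlgClosed.splits p).natDegree_eq_card_roots]
  · have h1 := (IsAlgClosed.splits p).eq_prod_roots_of_monic hp
    conv_rhs => rw [h1]
    rw [← Multiset.coe_toList (p.roots.map _), Multiset.prod_coe]
    refine (Fin.prod_univ_fun_getElem p.roots.toList (fun a => X - C a)).trans ?_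
    rw [← Multiset.prod_coe, ← Multiset.prod_coe, ← Multiset.map_coe, Multiset.coe_toList,
      Multiset.coe_toList]

open Polynomial in
theorem prod_X_sub_C_div_sub_one {K κ : Type*} [Field K] [Infinite K] [Fintype κ] {m : ℕ}
    (hm : 2 ≤ m) (x : K)
    (y u : κ → K) (hcard : Fintype.card κ = m) (hy : ∏ i, (X - C (y i)) = X ^ m - C x * X + C x)
    (h : ∀ i, y i * u i = y i + u i) :
    ∏ i, (X - C (u i)) = X ^ m - C x * (X - 1) ^ (m - 1) := by
  have h1 : ∏ i, (1 - y i) = 1 := by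
    have := congrArg (eval 1) hy
    simpa [eval_prod] using this
  refine Polynomial.funext fun U => ?_
  have h2 : eval U (∏ i, (X - C (u i))) = ∏ i, (U - y i * (U - 1)) := by
    have e := one_mul (∏ i, eval U (X - C (u i)))
    rw [← h1, ← Finset.prod_mul_distrib] at e
    rw [eval_prod, ← e]
    refine Finset.prod_congr rfl fun i _ => ?_
    simp only [eval_sub, eval_X, eval_C]
    linear_combination h i
  rw [h2]
  simp only [eval_sub, eval_mul, eval_pow, eval_X, eval_C, eval_one]
  obtain ⟨m, rfl⟩ : ∃ m', m = m' + 2 := ⟨m - 2, by omega⟩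
  rw [show m + 2 - 1 = m + 1 from rfl]
  by_cases hU : U - 1 = 0
  · rw [hU]
    simp [hcard]
  have h3 := congrArg (eval (U / (U - 1))) hy
  simp only [eval_prod, eval_sub, eval_mul, eval_pow, eval_X, eval_C, eval_add] at h3
  calc ∏ i, (U - y i * (U - 1)) = ∏ i, ((U - 1) * (U / (U - 1) - y i)) := by
        refine Finset.prod_congr rfl fun i _ => ?_
        field_simp
    _ = (U - 1) ^ (m + 2) * ((U / (U - 1)) ^ (m + 2) - x * (U / (U - 1)) + x) := by
        rw [Finset.prod_mul_distrib, h3, Finset.prod_const, Finset.card_univ, hcard]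
    _ = _ := by
        have h4 : (U - 1) * (U / (U - 1)) = U := mul_div_cancel₀ U hU
        have h5 : (U - 1) ^ (m + 2) * (U / (U - 1)) ^ (m + 2) = U ^ (m + 2) := by
          rw [← mul_pow, h4]
        linear_combination h5 - x * (U - 1) ^ (m + 1) * h4

open Polynomial in
theorem exists_recurrence_of_trinomial {k K : Type*} [Field k] [CharZero k] [Field K] [Algebra k K]
    {m : ℕ} (hm : 2 ≤ m) (x : K) (O N : Submodule k K) (hO1 : 1 ∈ O)
    (hO : ∀ a ∈ O, ∀ b ∈ O, a * b ∈ O) (hN : ∀ a ∈ N, ∀ b ∈ N, a * b ∈ N) (hx : x ∈ N)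
    {y u : K} (hyO : y ∈ O) (hy : y ^ m - x * y + x = 0) (hyu : y * u = y + u)
    (hu0 : u ≠ 0) (hu : u⁻¹ ∈ O) (hxu : x * u⁻¹ ∈ O) (D : k[X]) (hD : D.coeff 0 = 0) :
    ∃ e G : ℕ → K, (∀ i, 1 ≤ i → e i ∈ N) ∧ G 0 = 1 ∧
      (∀ i, G (i + 1) = (y + aeval u D) * G i + e (i + 1)) ∧ (∀ i ≤ m - 2, G i ∈ O) ∧
      G (m - 1) + x ∈ O ∧ G m = 0 := by
  classical
  let L := AlgebraicClosure K
  have : CharZero K := charZero_of_injective_algebraMap (algebraMap k K).injective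
  have : CharZero L := charZero_of_injective_algebraMap (algebraMap K L).injective
  let φ : K →ₐ[k] L := IsScalarTower.toAlgHom k K L
  have hφ : Function.Injective φ := (φ : K →+* L).injective
  let O' : Submodule k L := O.map φ.toLinearMap
  let N' : Submodule k L := N.map φ.toLinearMap
  have memO : ∀ a, φ a ∈ O' ↔ a ∈ O := fun a =>
    ⟨fun ⟨b, hb, e⟩ => hφ e ▸ hb, fun h => ⟨a, h, rfl⟩⟩
  have memN : ∀ a, φ a ∈ N' ↔ a ∈ N := fun a =>
    ⟨fun ⟨b, hb, e⟩ => hφ e ▸ hb, fun h => ⟨a, h, rfl⟩⟩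
  have hO' : ∀ a ∈ O', ∀ b ∈ O', a * b ∈ O' := by
    rintro _ ⟨a, ha, rfl⟩ _ ⟨b, hb, rfl⟩
    exact ⟨a * b, hO a ha b hb, map_mul φ a b⟩
  have hN' : ∀ a ∈ N', ∀ b ∈ N', a * b ∈ N' := by
    rintro _ ⟨a, ha, rfl⟩ _ ⟨b, hb, rfl⟩
    exact ⟨a * b, hN a ha b hb, map_mul φ a b⟩
  have hOone : (1 : L) ∈ O' := by rw [← map_one φ, memO]; exact hO1
  -- the roots
  let g : L[X] := X ^ m - C (φ x) * X + C (φ x)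
  have hgd : (X ^ m + (- C (φ x) * X + C (φ x)) : L[X]).Monic ∧
      (X ^ m + (- C (φ x) * X + C (φ x)) : L[X]).natDegree = m := by
    have hlt : (- C (φ x) * X + C (φ x) : L[X]).degree < m := by
      rw [← C_neg]
      exact lt_of_le_of_lt degree_linear_le (by exact_mod_cast (by omega : 1 < m))
    exact ⟨monic_X_pow_add hlt,
      (natDegree_add_eq_left_of_degree_lt (by rwa [degree_X_pow])).trans (natDegree_X_pow m)⟩
  have hge : g = X ^ m + (- C (φ x) * X + C (φ x)) := by simp only [g]; ring
  obtain ⟨κ, _, Y, hcard, hY⟩ := exists_prod_X_sub_C_eq g (hge ▸ hgd.1)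
  rw [hge, hgd.2] at hcard
  have hY1 : ∀ i, Y i - 1 ≠ 0 := by
    intro i hi
    have := congrArg (eval 1) hY
    rw [eval_prod, Finset.prod_eq_zero (Finset.mem_univ i)] at this
    · simp [g] at this
    · simp only [eval_sub, eval_X, eval_C]
      linear_combination -hi
  obtain ⟨i₀, hi₀⟩ : ∃ i, φ y = Y i := by
    have h1 := congrArg (eval (φ y)) hY
    have h2 : eval (φ y) g = 0 := by
      simp only [g, eval_sub, eval_mul, eval_pow, eval_X, eval_C, eval_add]
      rw [← map_pow, ← map_mul, ← map_sub, ← map_add, hy, map_zero]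
    rw [h2, eval_prod, Finset.prod_eq_zero_iff] at h1
    obtain ⟨i, -, hi⟩ := h1
    refine ⟨i, ?_⟩
    simpa [sub_eq_zero] using hi
  let U : κ → L := fun i => Y i / (Y i - 1)
  have hYU : ∀ i, Y i * U i = Y i + U i := by
    intro i
    change Y i * (Y i / (Y i - 1)) = Y i + Y i / (Y i - 1)
    linear_combination div_mul_cancel₀ (Y i) (hY1 i)
  have hU0 : φ u = U i₀ := by
    have h1 := congrArg φ hyu
    rw [map_mul, map_add, hi₀] at h1
    change φ u = Y i₀ / (Y i₀ - 1)
    rw [eq_div_iff (hY1 i₀)]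
    linear_combination h1
  have hU := prod_X_sub_C_div_sub_one hm (φ x) Y U hcard hY hYU
  let V : κ → L := Y + aeval U D
  have hV : V i₀ = φ (y + aeval u D) := by
    simp only [V, Pi.add_apply, map_add, hi₀]
    congr 1
    rw [← aeval_algHom_apply, hU0]
    exact (aeval_algHom_apply (Pi.evalAlgHom k (fun _ : κ => L) i₀) U D).symm
  have hVN : ∀ (N₁ : Submodule k L) (t : Finset κ) (i : ℕ),
      (∀ j, 1 ≤ j → j < i → ∑ κ ∈ t, Y κ ^ j ∈ N₁) → (∀ j, 1 ≤ j → ∑ κ ∈ t, U κ ^ j ∈ N₁) →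
      ∑ κ ∈ t, V κ ^ i - ∑ κ ∈ t, Y κ ^ i ∈ N₁ := by
    intro N₁ t i h1 h2
    let T : (κ → L) →ₗ[k] L := ∑ κ ∈ t, LinearMap.proj κ
    have hT : ∀ f, T f = ∑ κ ∈ t, f κ := fun f => by simp [T]
    have h3 := add_aeval_pow_sub_pow_mem (N₁.comap T) (y := Y) (u := U) (funext hYU) i
      (fun j hj1 hj2 => by simpa [hT] using h1 j hj1 hj2)
      (fun j hj1 => by simpa [hT] using h2 j hj1) D hD
    rw [Submodule.mem_comap, map_sub, hT, hT] at h3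
    exact h3
  -- elementary symmetric functions of the roots
  have hYe : ∀ j ≤ m, signedEsymm Finset.univ Y j = g.coeff (m - j) := by
    intro j hj
    rw [← hY, ← coeff_prod_X_sub_C_eq_signedEsymm _ _ (by rwa [Finset.card_univ, hcard]),
      Finset.card_univ, hcard]
  have hgc : ∀ i, g.coeff i = (if i = m then 1 else 0) - (if i = 1 then φ x else 0)
      + (if i = 0 then φ x else 0) := by
    intro i
    simp [g, coeff_X_pow, coeff_X, coeff_C, eq_comm]
  have hxN : φ x ∈ N' := (memN x).2 hx
  have hYeN : ∀ j, 1 ≤ j → signedEsymm Finset.univ Y j ∈ N' := by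
    intro j hj
    rcases le_or_gt j m with h | h
    · rw [hYe j h, hgc, if_neg (by omega), zero_sub]
      refine N'.add_mem (N'.neg_mem ?_) ?_ <;> split_ifs <;> simp [hxN]
    · rw [signedEsymm_eq_zero _ _ (by rwa [Finset.card_univ, hcard])]
      exact N'.zero_mem
  have hYe0 : ∀ j, 1 ≤ j → j ≤ m - 2 → signedEsymm Finset.univ Y j = 0 := by
    intro j h1 h2
    rw [hYe j (by omega), hgc, if_neg (by omega), if_neg (by omega), if_neg (by omega)]
    simp
  have hYp0 : ∀ j, 1 ≤ j → j ≤ m - 2 → ∑ κ, Y κ ^ j = 0 := by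
    intro j h1 h2
    have := sum_pow_mem (⊥ : Submodule k L) (by simp) Finset.univ Y (m - 2)
      (fun j h1 h2 => by rw [Submodule.mem_bot]; exact hYe0 j h1 h2) j h1 h2
    simpa using this
  have hYp1 : ∑ κ, Y κ ^ (m - 1) = (m - 1 : ℕ) * φ x := by
    rw [sum_pow_eq_neg _ _ (by omega), Finset.sum_eq_zero, hYe _ (by omega), hgc,
      if_neg (by omega), if_pos (by omega), if_neg (by omega)]
    · ring
    · intro a ha
      simp only [Finset.mem_filter, Finset.HasAntidiagonal.mem_antidiagonal] at ha
      rw [hYe0 _ (by omega) (by omega), zero_mul]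
  have hUe : ∀ j, 1 ≤ j → ∃ z : ℤ, signedEsymm Finset.univ U j = z • φ x := by
    intro j hj
    rcases le_or_gt j m with h | h
    · refine ⟨-((X - 1 : ℤ[X]) ^ (m - 1)).coeff (m - j), ?_⟩
      have e : ((X - 1 : L[X]) ^ (m - 1)) = map (Int.castRingHom L) ((X - 1 : ℤ[X]) ^ (m - 1)) := by
        simp
      rw [← coeff_prod_X_sub_C_eq_signedEsymm _ _ (by rwa [Finset.card_univ, hcard]),
        Finset.card_univ, hcard, hU, coeff_sub, coeff_X_pow, if_neg (by omega), coeff_C_mul, e,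
        coeff_map]
      simp [mul_comm]
    · exact ⟨0, by rw [signedEsymm_eq_zero _ _ (by rwa [Finset.card_univ, hcard]), zero_smul]⟩
  have hUeN : ∀ j, 1 ≤ j → signedEsymm Finset.univ U j ∈ N' := by
    intro j hj
    obtain ⟨z, hz⟩ := hUe j hj
    rw [hz]
    exact zsmul_mem hxN z
  have hVpN : ∀ j, 1 ≤ j → ∑ κ, V κ ^ j ∈ N' := by
    intro j hj
    have h1 := hVN N' Finset.univ j
      (fun i h1 _ => sum_pow_mem N' hN' _ _ i (fun l hl _ => hYeN l hl) i h1 le_rfl)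
      (fun i h1 => sum_pow_mem N' hN' _ _ i (fun l hl _ => hUeN l hl) i h1 le_rfl)
    have h2 := sum_pow_mem N' hN' _ _ j (fun l hl _ => hYeN l hl) j hj le_rfl
    simpa using N'.add_mem h1 h2
  have hVeN : ∀ j, 1 ≤ j → signedEsymm Finset.univ V j ∈ N' := fun j hj =>
    signedEsymm_mem N' hN' _ _ j (fun l hl _ => hVpN l hl) j hj le_rfl
  -- the other roots
  let s : Finset κ := Finset.univ.erase i₀
  have hs : i₀ ∉ s := Finset.notMem_erase _ _
  have hins : insert i₀ s = Finset.univ := Finset.insert_erase (Finset.mem_univ _)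
  have hscard : s.card = m - 1 := by
    rw [Finset.card_erase_of_mem (Finset.mem_univ _), Finset.card_univ, hcard]
  have hUs : ∀ j, signedEsymm s U j ∈ O' := by
    have H : ∀ d j, m ≤ j + d → signedEsymm s U j ∈ O' := by
      intro d
      induction d with
      | zero =>
        intro j hj
        rw [signedEsymm_eq_zero _ _ (by omega)]
        exact O'.zero_mem
      | succ d ih =>
        intro j hj
        have h1 := signedEsymm_insert hs U j
        rw [hins] at h1
        obtain ⟨z, hz⟩ := hUe (j + 1) (by omega)
        rw [hz, ← hU0] at h1
        have hu0' : φ u ≠ 0 := by rwa [Ne, map_eq_zero_iff φ hφ]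
        have h2 : signedEsymm s U j = φ u⁻¹ * signedEsymm s U (j + 1) - z • φ (x * u⁻¹) := by
          apply mul_left_cancel₀ hu0'
          rw [map_mul, map_inv₀, zsmul_eq_mul] at *
          linear_combination h1 - (signedEsymm s U (j + 1) - z * φ x) * (mul_inv_cancel₀ hu0')
        rw [h2]
        exact O'.sub_mem (hO' _ ((memO _).2 hu) _ (ih _ (by omega)))
          (zsmul_mem ((memO _).2 hxu) z)
    exact fun j => H m j (by omega)
  have hsum : ∀ (f : κ → L) (j : ℕ), ∑ κ ∈ s, f κ ^ j = ∑ κ, f κ ^ j - f i₀ ^ j := by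
    intro f j
    rw [← hins, Finset.sum_insert hs, add_sub_cancel_left]
  have hyOpow : ∀ j, φ y ^ j ∈ O' := by
    intro j
    induction j with
    | zero => simpa using hOone
    | succ j ih => rw [pow_succ]; exact hO' _ ih _ ((memO y).2 hyO)
  have hYs : ∀ j, 1 ≤ j → j ≤ m - 2 → ∑ κ ∈ s, Y κ ^ j ∈ O' := by
    intro j h1 h2
    rw [hsum, hYp0 j h1 h2, zero_sub, ← hi₀]
    exact O'.neg_mem (hyOpow j)
  have hVs0 : ∀ j, 1 ≤ j → j ≤ m - 1 → ∑ κ ∈ s, V κ ^ j - ∑ κ ∈ s, Y κ ^ j ∈ O' := fun j _ h2 =>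
    hVN O' s j (fun i h3 h4 => hYs i h3 (by omega))
      (fun i h3 => sum_pow_mem O' hO' _ _ i (fun l _ _ => hUs l) i h3 le_rfl)
  have hVs : ∀ j, 1 ≤ j → j ≤ m - 2 → ∑ κ ∈ s, V κ ^ j ∈ O' := by
    intro j h1 h2
    simpa using O'.add_mem (hVs0 j h1 (by omega)) (hYs j h1 h2)
  have hVse : ∀ j, 1 ≤ j → j ≤ m - 2 → signedEsymm s V j ∈ O' :=
    signedEsymm_mem O' hO' s V (m - 2) hVs
  have hVlast : signedEsymm s V (m - 1) + φ x ∈ O' := by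
    have h1 : ∑ κ ∈ s, V κ ^ (m - 1) - (m - 1 : ℕ) * φ x ∈ O' := by
      have h2 := hVs0 (m - 1) (by omega) le_rfl
      rw [hsum Y, hYp1, ← hi₀] at h2
      have h3 := O'.sub_mem h2 (hyOpow (m - 1))
      convert h3 using 1
      ring
    have h2 : ((m - 1 : ℕ) : L) * (signedEsymm s V (m - 1) + φ x) ∈ O' := by
      have h3 := sum_pow_eq_neg s V (j := m - 1) (by omega)
      have h4 : ∑ a ∈ Finset.HasAntidiagonal.antidiagonal (m - 1) with 1 ≤ a.1 ∧ a.1 < m - 1,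
          signedEsymm s V a.1 * ∑ i ∈ s, V i ^ a.2 ∈ O' := by
        refine O'.sum_mem fun a ha => ?_
        simp only [Finset.mem_filter, Finset.HasAntidiagonal.mem_antidiagonal] at ha
        exact hO' _ (hVse _ (by omega) (by omega)) _ (hVs _ (by omega) (by omega))
      rw [h3] at h1
      have h5 := O'.neg_mem (O'.add_mem h1 h4)
      convert h5 using 1
      ring
    have hm0 : ((m - 1 : ℕ) : k) ≠ 0 := by exact_mod_cast (by omega : m - 1 ≠ 0)
    have h6 := O'.smul_mem ((m - 1 : ℕ) : k)⁻¹ h2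
    rwa [← nsmul_eq_mul, ← Nat.cast_smul_eq_nsmul k, smul_smul, inv_mul_cancel₀ hm0,
      one_smul] at h6
  choose! e heN he using hVeN
  let G : ℕ → K := fun i => Nat.rec 1 (fun i a => (y + aeval u D) * a + e (i + 1)) i
  have hG : ∀ i, φ (G i) = signedEsymm s V i := by
    intro i
    induction i with
    | zero => simp [G, signedEsymm_zero]
    | succ i ih =>
      have h1 := signedEsymm_insert hs V i
      rw [hins] at h1
      change φ ((y + aeval u D) * G i + e (i + 1)) = _
      have h2 : φ (e (i + 1)) = _ := he (i + 1) (by omega)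
      rw [map_add, map_mul, ih, h2, h1, ← hV]
      ring
  refine ⟨e, G, heN, rfl, fun i => rfl, fun i hi => ?_, ?_, ?_⟩
  · rcases Nat.eq_zero_or_pos i with rfl | h
    · exact hO1
    · rw [← memO, hG]
      exact hVse i h hi
  · rw [← memO, map_add, hG]
    exact hVlast
  · rw [← map_eq_zero_iff φ hφ, hG]
    exact signedEsymm_eq_zero _ _ (by omega)

open Polynomial in
/-- Up to terms regular at the origin, this polynomial in `1 + 1 / z` is `c / x ^ c`
when `z = x * (1 + z) ^ m`; it has no constant term. -/
noncomputable def polarPolynomial (k : Type*) [CommRing k] (m c : ℕ) : k[X] :=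
  c * ∑ i ∈ Finset.range (c + 1), ((m * c).choose (c - i) : k[X]) * (X - 1) ^ i - cycleWeight m c

open Polynomial in
theorem coeff_zero_polarPolynomial (k : Type*) [CommRing k] {m c : ℕ} (hm : 1 ≤ m) :
    (polarPolynomial k m c).coeff 0 = 0 := by
  rcases Nat.eq_zero_or_pos c with rfl | hc
  · simp [polarPolynomial, cycleWeight]
  obtain ⟨N, hN⟩ : ∃ N, m * c = N + 1 := ⟨m * c - 1, by have := Nat.mul_pos hm hc; omega⟩
  have h := congrArg (Int.cast (R := k)) (Int.alternating_sum_range_choose_eq_choose (n := N) (m := c))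
  push_cast at h
  rw [coeff_zero_eq_eval_zero, polarPolynomial, cycleWeight, hN, Nat.add_sub_cancel]
  simp only [eval_sub, eval_mul, eval_natCast, eval_finsetSum, eval_pow, eval_X, eval_one, zero_sub]
  rw [← Finset.sum_range_reflect]
  have h2 : ∀ i ∈ Finset.range (c + 1), ((N + 1).choose (c - (c + 1 - 1 - i)) : k) *
      (-1) ^ (c + 1 - 1 - i) = (-1) ^ c * ((-1) ^ i * (N + 1).choose i) := by
    intro i hi
    rw [Finset.mem_range] at hi
    obtain ⟨j, rfl⟩ : ∃ j, c = i + j := ⟨c - i, by omega⟩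
    rw [show i + j + 1 - 1 - i = j by omega, show i + j - j = i by omega, pow_add, mul_comm,
      mul_mul_mul_comm,
      ← mul_pow]
    ring_nf
  rw [Finset.sum_congr rfl h2, ← Finset.mul_sum, h, ← mul_assoc ((-1) ^ c), ← pow_add,
    Even.neg_one_pow ⟨c, rfl⟩]
  push_cast
  ring

theorem sum_choose_mul_inv_pow {K : Type*} [Field K] {m : ℕ} (hm : 1 ≤ m) (c : ℕ) {x y z : K}
    (hz : z ≠ 0) (hy : y = z + 1) (hx : x * z = y ^ m) :
    ∑ i ∈ Finset.range (c + 1), ((m * c).choose (c - i) : K) * z⁻¹ ^ i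
      = x ^ c - ∑ j ∈ Finset.range ((m - 1) * c), ((m * c).choose (c + (j + 1)) : K) * z ^ (j + 1) := by
  have e : m * c + 1 = (c + 1) + (m - 1) * c := by
    obtain ⟨m, rfl⟩ : ∃ m', m = m' + 1 := ⟨m - 1, by omega⟩
    rw [Nat.add_sub_cancel]; ring
  have h1 : x ^ c * z ^ c = ∑ i ∈ Finset.range (m * c + 1), z ^ i * (m * c).choose i := by
    rw [← mul_pow, hx, ← pow_mul, hy, add_pow]
    simp
  rw [e, Finset.sum_range_add, ← Finset.sum_range_reflect] at h1
  rw [eq_sub_iff_add_eq]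
  apply mul_right_cancel₀ (pow_ne_zero c hz)
  rw [h1, add_mul, Finset.sum_mul, Finset.sum_mul]
  congr 1
  · refine Finset.sum_congr rfl fun i hi => ?_
    rw [Finset.mem_range] at hi
    obtain ⟨j, rfl⟩ : ∃ j, c = i + j := ⟨c - i, by omega⟩
    rw [show i + j + 1 - 1 - i = j by omega, show i + j - i = j by omega, pow_add]
    have : z⁻¹ ^ i * z ^ i = 1 := by rw [← mul_pow, inv_mul_cancel₀ hz, one_pow]
    linear_combination (((m * (i + j)).choose j : K) * z ^ j) * this
  · refine Finset.sum_congr rfl fun i _ => ?_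
    rw [add_assoc, add_comm 1 i]
    ring

section
variable {k : Type*} [Field k] [CharZero k]

/-- The coefficient of `x ^ n` in `y` when `y = 1 + x * y ^ m`. -/
def fussCatalan (k : Type*) [Field k] (m n : ℕ) : k := (m * n).choose (n - 1) / n

/-- The generating-function coefficient for two cycles of lengths `n` and `c`. -/
def polarCoeff (k : Type*) [Field k] (m n c : ℕ) : k :=
  - (m * c * (cycleWeight m c * cycleWeight m n)) / ((m - 1) * (n * (n + c)))

namespace PowerSeries

theorem coeff_eq_fussCatalan {m : ℕ} (hm : 1 ≤ m) {y : PowerSeries k} (hy : y = 1 + X * y ^ m)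
    {n : ℕ} (hn : 1 ≤ n) : coeff n y = fussCatalan k m n := by
  have h := coeff_sub_one_pow_of_eq_one_add_X_mul_pow hm hy n 1 hn
  rw [pow_one, map_sub, coeff_one, if_neg (by omega), sub_zero] at h
  have hn0 : (n : k) ≠ 0 := by exact_mod_cast (by omega : n ≠ 0)
  rw [fussCatalan, eq_div_iff hn0, mul_comm, h]
  simp

theorem neg_coeff_sum_eq_polarCoeff {m : ℕ} (hm : 2 ≤ m) {y : PowerSeries k}
    (hy : y = 1 + X * y ^ m) {n c : ℕ} (hn : 1 ≤ n) (hc : 1 ≤ c) :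
    - ((c : k) * coeff n (∑ j ∈ Finset.range ((m - 1) * c),
      ((m * c).choose (c + (j + 1)) : PowerSeries k) * (y - 1) ^ (j + 1))) = polarCoeff k m n c := by
  have hy0 : constantCoeff y = 1 := by rw [hy]; simp
  let f : ℕ → k := fun j => ((m * c).choose (c + j) : k) * coeff n ((y - 1) ^ j)
  have h1 : coeff n (∑ j ∈ Finset.range ((m - 1) * c),
      ((m * c).choose (c + (j + 1)) : PowerSeries k) * (y - 1) ^ (j + 1))
      = ∑ j ∈ Finset.range ((m - 1) * c), f (j + 1) := by
    rw [map_sum]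
    refine Finset.sum_congr rfl fun j _ => ?_
    rw [← nsmul_eq_mul, map_nsmul, nsmul_eq_mul]
  have h0 : f 0 = 0 := by simp [f, coeff_one, show ¬ n = 0 by omega]
  have h2 : ∑ j ∈ Finset.range ((m - 1) * c), f (j + 1)
      = ∑ j ∈ Finset.range (n + 1), f j := by
    have h3 : ∑ j ∈ Finset.range ((m - 1) * c), f (j + 1)
        = ∑ j ∈ Finset.range ((m - 1) * c + 1), f j := by
      rw [Finset.sum_range_succ', h0, add_zero]
    have hmc : (m - 1) * c + c = m * c := by
      obtain ⟨m, rfl⟩ : ∃ m', m = m' + 1 := ⟨m - 1, by omega⟩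
      rw [Nat.add_sub_cancel]; ring
    rw [h3]
    trans ∑ j ∈ Finset.range ((m - 1) * c + 1 + (n + 1)), f j
    · refine Finset.sum_subset (by intro a; simp; omega) fun j _ hj => ?_
      rw [Finset.mem_range, not_lt] at hj
      simp [f, Nat.choose_eq_zero_of_lt (show m * c < c + j by omega)]
    · refine (Finset.sum_subset (by intro a; simp; omega) fun j _ hj => ?_).symm
      rw [Finset.mem_range, not_lt] at hj
      simp [f, coeff_sub_one_pow_eq_zero hy0 n j hj]
  have h3 : (n : k) * ∑ j ∈ Finset.range (n + 1), f j = ∑ j ∈ Finset.range (n + 1),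
      (j : k) * ((m * c).choose (c + j) * (m * n).choose (n - j)) := by
    rw [Finset.mul_sum]
    refine Finset.sum_congr rfl fun j hj => ?_
    rw [Finset.mem_range] at hj
    have := coeff_sub_one_pow_of_eq_one_add_X_mul_pow (by omega) hy n j (by omega)
    simp only [f]
    linear_combination ((m * c).choose (c + j) : k) * this
  have h4 := sum_mul_choose_mul_choose_eq_cycleWeight (k := k) m c n hm hc
  rw [← h3] at h4
  have hn0 : (n : k) ≠ 0 := by exact_mod_cast (by omega : n ≠ 0)
  have hnc0 : (n + c : k) ≠ 0 := by exact_mod_cast (by omega : n + c ≠ 0)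
  have hm0 : (m - 1 : k) ≠ 0 := by
    have : ((m - 1 : ℕ) : k) ≠ 0 := by exact_mod_cast (by omega : m - 1 ≠ 0)
    rwa [Nat.cast_sub (by omega), Nat.cast_one] at this
  rw [h1, h2, polarCoeff, eq_div_iff (by positivity)]
  linear_combination (-(c : k)) * h4

end PowerSeries
end

section
variable {k : Type*} [Field k]

open LaurentSeries

/-- Laurent series supported on a set of exponents closed under addition. -/
def laurentSupportedOn (S : Set ℤ) : Submodule k k⸨X⸩ where
  carrier := {f | ∀ d ∉ S, f.coeff d = 0}
  add_mem' ha hb d hd := by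
    rw [HahnSeries.coeff_add, ha d hd, hb d hd, add_zero]
  zero_mem' d _ := rfl
  smul_mem' c f hf d hd := by
    rw [HahnSeries.coeff_smul, hf d hd, smul_zero]

theorem mul_mem_laurentSupportedOn {S : Set ℤ} (hS : ∀ a ∈ S, ∀ b ∈ S, a + b ∈ S) :
    ∀ f ∈ laurentSupportedOn (k := k) S, ∀ g ∈ laurentSupportedOn (k := k) S,
      f * g ∈ laurentSupportedOn S := by
  intro f hf g hg d hd
  rw [HahnSeries.coeff_mul]
  refine Finset.sum_eq_zero fun ij hij => ?_
  by_cases h1 : ij.1 ∈ S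
  · by_cases h2 : ij.2 ∈ S
    · refine absurd ?_ hd
      have := (Finset.mem_antidiagonal.1 hij).2.2
      rw [← this]
      exact hS _ h1 _ h2
    · rw [hg _ h2, mul_zero]
  · rw [hf _ h1, zero_mul]

theorem ofPowerSeries_mem_laurentSupportedOn (f : PowerSeries k) :
    (f : k⸨X⸩) ∈ laurentSupportedOn (k := k) {d | 0 ≤ d} := by
  intro d hd
  rw [PowerSeries.coeff_coe, if_pos (by simpa using hd)]

variable [CharZero k]

theorem PowerSeries.exists_eq_one_add_X_mul_pow (R : Type*) [CommRing R] (m : ℕ) :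
    ∃ y : PowerSeries R, y = 1 + PowerSeries.X * y ^ m := by
  obtain ⟨y, hy⟩ := MvPowerSeries.exists_eq_one_add_sum (R := R) (Finset.univ : Finset Unit)
    (fun _ => 1) (fun _ => m)
  refine ⟨y, ?_⟩
  rw [Finset.univ_unique, Finset.sum_singleton, map_one, one_mul] at hy
  exact hy

theorem cutJoin_fixedPoint {ι : Type*} {m : ℕ} (hm : 2 ≤ m) (J : Finset ι) (c : ι → ℕ)
    (hc : ∀ j ∈ J, 1 ≤ c j) (p : ι → k) (v : ℕ → k) (hv0 : v 0 = 0)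
    (hv : ∀ n, 1 ≤ n → v n = fussCatalan k m n + ∑ j ∈ J, polarCoeff k m n (c j) * p j)
    (F : ℕ → ℕ → k) (hF0 : ∀ n, F 0 n = if n = 1 then 1 else 0) (hFz : ∀ i, F (i + 1) 0 = 0)
    (hF : ∀ i n, 1 ≤ n → F (i + 1) n =
      (1 - ∑ j ∈ J, (cycleWeight m (c j) : k) * p j) * F i n
      + ∑ j ∈ J, (c j : k) * p j * F i (n + c j)
      + ∑ q ∈ Finset.HasAntidiagonal.antidiagonal n, F i q.1 * v q.2) :
    ∀ n, 1 ≤ n → F m n = v n := by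
  classical
  obtain ⟨y, hy⟩ := PowerSeries.exists_eq_one_add_X_mul_pow k m
  have hy0 : PowerSeries.constantCoeff y = 1 := by rw [hy]; simp
  set s : k := 1 - ∑ j ∈ J, (cycleWeight m (c j) : k) * p j with hs
  let ψ : PowerSeries k →+* k⸨X⸩ := HahnSeries.ofPowerSeries ℤ k
  let x : k⸨X⸩ := HahnSeries.single (-1) 1
  let t : k⸨X⸩ := HahnSeries.single 1 1
  have hxt : x * t = 1 := by simp [x, t]
  have htψ : t = ψ PowerSeries.X := (PowerSeries.coe_X).symm
  have hψinj : Function.Injective ψ := HahnSeries.ofPowerSeries_injective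
  let Y : k⸨X⸩ := ψ y
  let Z : k⸨X⸩ := ψ (y - 1)
  have hYZ : Y = Z + 1 := by simp [Y, Z]
  have hZt : Z = t * Y ^ m := by
    rw [htψ, ← map_pow, ← map_mul]
    exact congrArg ψ (sub_eq_iff_eq_add'.2 hy)
  have ht0 : t ≠ 0 := right_ne_zero_of_mul (hxt ▸ one_ne_zero)
  have hY0 : Y ≠ 0 := by
    rw [Ne, map_eq_zero_iff ψ hψinj]
    rintro rfl
    simp at hy0
  have hZ0 : Z ≠ 0 := by rw [hZt]; exact mul_ne_zero ht0 (pow_ne_zero _ hY0)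
  have hxZ : x * Z = Y ^ m := by rw [hZt, ← mul_assoc, hxt, one_mul]
  let u : k⸨X⸩ := Y / Z
  have huinv : u⁻¹ = ψ (PowerSeries.X * y ^ (m - 1)) := by
    rw [map_mul, map_pow, ← htψ, inv_div, hZt, div_eq_iff hY0, mul_assoc, ← pow_succ,
      Nat.sub_add_cancel (by omega)]
  let D : Polynomial k := ∑ j ∈ J, p j • polarPolynomial k m (c j)
  let : Algebra k k⸨X⸩ := HahnSeries.instAlgebra
  let O : Submodule k k⸨X⸩ := laurentSupportedOn {d | 0 ≤ d}
  let N : Submodule k k⸨X⸩ := laurentSupportedOn {d | d < 0}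
  obtain ⟨e, G, heN, hG0, hGs, hGO, hGl, hGm⟩ := exists_recurrence_of_trinomial (k := k) hm x O N
    (by rw [← map_one ψ]; exact ofPowerSeries_mem_laurentSupportedOn _)
    (mul_mem_laurentSupportedOn fun a ha b hb => Int.add_nonneg ha hb)
    (mul_mem_laurentSupportedOn fun a ha b hb => Int.add_neg ha hb)
    (by
      intro d hd
      exact HahnSeries.coeff_single_of_ne (by rintro rfl; simp at hd))
    (y := Y) (u := u) (ofPowerSeries_mem_laurentSupportedOn _)
    (by rw [← hxZ, hYZ]; ring)
    (by
      simp only [u]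
      field_simp
      rw [hYZ])
    (div_ne_zero hY0 hZ0)
    (by rw [huinv]; exact ofPowerSeries_mem_laurentSupportedOn _)
    (by
      rw [huinv, map_mul, ← htψ, ← mul_assoc, hxt, one_mul]
      exact ofPowerSeries_mem_laurentSupportedOn _)
    D
    (by
      simp only [D, Polynomial.finsetSum_coeff, Polynomial.coeff_smul]
      refine Finset.sum_eq_zero fun j _ => ?_
      rw [coeff_zero_polarPolynomial k (by omega), smul_zero])
  have hVps : y - ∑ j ∈ J, p j • ((c j : PowerSeries k) * (∑ i ∈ Finset.range ((m - 1) * c j),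
      ((m * c j).choose (c j + (i + 1)) : PowerSeries k) * (y - 1) ^ (i + 1))
      + (cycleWeight m (c j) : PowerSeries k)) = PowerSeries.C s + PowerSeries.mk v := by
    ext n
    rw [map_sub, map_sum, map_add, PowerSeries.coeff_mk]
    rcases Nat.eq_zero_or_pos n with rfl | hn
    · simp [hy0, hv0, hs, mul_comm]
    · rw [hv n hn, PowerSeries.coeff_eq_fussCatalan (by omega) hy hn, PowerSeries.coeff_C,
        if_neg (by omega), zero_add, sub_eq_add_neg, ← Finset.sum_neg_distrib]
      congr 1
      refine Finset.sum_congr rfl fun j hj => ?_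
      have h1 : PowerSeries.coeff n (cycleWeight m (c j) : PowerSeries k) = 0 := by
        rw [← map_natCast (PowerSeries.C (R := k)), PowerSeries.coeff_C, if_neg (by omega)]
      rw [← PowerSeries.neg_coeff_sum_eq_polarCoeff hm hy hn (hc j hj), map_smul, map_add, h1,
        add_zero, ← nsmul_eq_mul, map_nsmul, nsmul_eq_mul, smul_eq_mul]
      ring
  have hV : Y + Polynomial.aeval u D = ψ (PowerSeries.C s + PowerSeries.mk v)
      + ∑ j ∈ J, ((c j : k) * p j) • HahnSeries.single (-(c j : ℤ)) (1 : k) := by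
    have hu1 : u - 1 = Z⁻¹ := by
      simp only [u]
      rw [hYZ]
      field_simp
      ring
    have hψs : ∀ (a : k) (f : PowerSeries k), ψ (a • f) = a • ψ f := by
      intro a f
      rw [PowerSeries.smul_eq_C_mul, map_mul, HahnSeries.ofPowerSeries_C, HahnSeries.C_mul_eq_smul]
    rw [← hVps, map_sub, map_sum, map_sum, sub_add, ← Finset.sum_sub_distrib, sub_eq_add_neg,
      ← Finset.sum_neg_distrib]
    congr 1
    refine Finset.sum_congr rfl fun j hj => ?_
    have hxc : (HahnSeries.single (-(c j : ℤ)) (1 : k)) = x ^ c j := by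
      simp [x, HahnSeries.single_pow]
    rw [hψs, mul_comm (c j : k), mul_smul, ← smul_sub, ← smul_neg, map_smul, neg_sub]
    congr 1
    have h1 := sum_choose_mul_inv_pow (show 1 ≤ m by omega) (c j) hZ0 hYZ hxZ
    rw [polarPolynomial, hxc, Nat.cast_smul_eq_nsmul k, nsmul_eq_mul]
    simp only [map_sub, map_mul, map_sum, map_natCast, map_pow, Polynomial.aeval_X, map_one, hu1,
      map_add]
    rw [h1]
    simp only [Z, map_sub, map_one]
    ring
  have hcoeff : ∀ (f : PowerSeries k) (n : ℕ), ((Y + Polynomial.aeval u D) * ψ f).coeff (n : ℤ)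
      = s * PowerSeries.coeff n f + ∑ j ∈ J, (c j : k) * p j * PowerSeries.coeff (n + c j) f
        + ∑ q ∈ Finset.HasAntidiagonal.antidiagonal n, PowerSeries.coeff q.1 f * v q.2 := by
    intro f n
    rw [hV, add_mul, ← map_mul, HahnSeries.coeff_add, LaurentSeries.coeff_coe_powerSeries, add_mul,
      map_add, PowerSeries.coeff_C_mul, Finset.sum_mul, HahnSeries.coeff_sum,
        mul_comm (PowerSeries.mk v),
      PowerSeries.coeff_mul, add_right_comm]
    simp only [PowerSeries.coeff_mk]
    congr 2
    refine Finset.sum_congr rfl fun j _ => ?_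
    rw [smul_mul_assoc, HahnSeries.coeff_smul, HahnSeries.coeff_single_mul, one_mul, sub_neg_eq_add,
      smul_eq_mul, ← Nat.cast_add, LaurentSeries.coeff_coe_powerSeries]
  have htN : ∀ f ∈ N, ∀ n : ℕ, 1 ≤ n → (t * f).coeff (n : ℤ) = 0 := by
    intro f hf n hn
    rw [HahnSeries.coeff_single_mul, one_mul]
    exact hf _ (by simp; omega)
  have hstep : ∀ i, ∀ W ∈ O, (∀ n : ℕ, 1 ≤ n → (t * W).coeff (n : ℤ)
      = ((Y + Polynomial.aeval u D) * ψ (PowerSeries.mk (F i))).coeff (n : ℤ)) →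
      ψ (PowerSeries.mk (F (i + 1))) = t * W := by
    intro i W hW h
    ext d
    rcases le_or_gt d 0 with hd | hd
    · rw [HahnSeries.coeff_single_mul, one_mul, hW _ (by simp; omega)]
      rcases hd.lt_or_eq with hd | rfl
      · exact ofPowerSeries_mem_laurentSupportedOn _ d (by simpa using hd)
      · rw [← Nat.cast_zero, LaurentSeries.coeff_coe_powerSeries, PowerSeries.coeff_mk, hFz]
    · obtain ⟨n, rfl⟩ := Int.eq_ofNat_of_zero_le hd.le
      have hn : 1 ≤ n := by exact_mod_cast hd
      rw [h n hn, hcoeff, LaurentSeries.coeff_coe_powerSeries]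
      simp only [PowerSeries.coeff_mk]
      exact hF i n hn
  have hlow : ∀ i, i ≤ m - 2 → ψ (PowerSeries.mk (F i)) = t * G i := by
    intro i
    induction i with
    | zero =>
      intro _
      rw [hG0, mul_one, htψ]
      congr 1
      ext n
      rw [PowerSeries.coeff_mk, hF0, PowerSeries.coeff_X]
    | succ i ih =>
      intro hi
      refine hstep i _ (hGO _ hi) fun n hn => ?_
      rw [ih (by omega), hGs, mul_add, HahnSeries.coeff_add, htN _ (heN _ (by omega)) n hn,
        add_zero,
        mul_left_comm]
  obtain ⟨m, rfl⟩ : ∃ m', m = m' + 2 := ⟨m - 2, by omega⟩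
  have hlast : ψ (PowerSeries.mk (F (m + 1))) = t * (G (m + 1) + x) := by
    refine hstep m _ hGl fun n hn => ?_
    rw [hlow m le_rfl, mul_add, mul_comm t x, hxt, hGs, mul_add, HahnSeries.coeff_add,
      HahnSeries.coeff_add, htN _ (heN _ (by omega)) n hn, mul_left_comm,
      HahnSeries.coeff_one, if_neg (by omega), add_zero, add_zero]
  intro n hn
  rw [hF (m + 1) n hn]
  have h1 := hcoeff (PowerSeries.mk (F (m + 1))) n
  simp only [PowerSeries.coeff_mk] at h1
  have h2 : (Y + Polynomial.aeval u D) * (t * G (m + 1)) = - (t * e (m + 2)) := by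
    have := hGs (m + 1)
    rw [hGm] at this
    linear_combination (-t) * this
  rw [← h1, hlast, mul_add, mul_comm t x, hxt, mul_add, mul_one, HahnSeries.coeff_add, h2,
    HahnSeries.coeff_neg, htN _ (heN _ (by omega)) n hn, neg_zero, zero_add, hV,
    HahnSeries.coeff_add, LaurentSeries.coeff_coe_powerSeries, map_add, PowerSeries.coeff_mk,
    PowerSeries.coeff_C, if_neg (by omega), zero_add, HahnSeries.coeff_sum]
  rw [Finset.sum_eq_zero, add_zero]
  intro j hj
  rw [HahnSeries.coeff_smul, HahnSeries.coeff_single_of_ne (by omega), smul_zero]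

end

section
variable {ι : Type*} [DecidableEq ι]

/-- The coefficient of the squarefree monomial `∏ j ∈ J, X j`. -/
noncomputable def squarefreeCoeff (J : Finset ι) : MvPowerSeries ι ℚ →ₗ[ℚ] ℚ :=
  MvPowerSeries.coeff (Finsupp.indicator J fun _ _ => 1)

theorem squarefreeCoeff_one (J : Finset ι) : squarefreeCoeff J 1 = if J = ∅ then 1 else 0 := by
  rw [squarefreeCoeff, MvPowerSeries.coeff_one]
  congr 1
  simp [Finsupp.ext_iff, Finsupp.indicator_apply, Finset.eq_empty_iff_forall_notMem]

theorem squarefreeCoeff_mul (J : Finset ι) (f g : MvPowerSeries ι ℚ) :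
    squarefreeCoeff J (f * g)
      = ∑ T ∈ J.powerset, squarefreeCoeff T f * squarefreeCoeff (J \ T) g := by
  rw [squarefreeCoeff, MvPowerSeries.coeff_mul]
  symm
  refine Finset.sum_nbij' (fun T => (Finsupp.indicator T fun _ _ => 1,
    Finsupp.indicator (J \ T) fun _ _ => 1)) (fun q => q.1.support) ?_ ?_ ?_ ?_ ?_
  · intro T hT
    rw [Finset.mem_powerset] at hT
    rw [Finset.HasAntidiagonal.mem_antidiagonal]
    ext j
    have := @hT j
    simp only [Finsupp.add_apply, Finsupp.indicator_apply, Finset.mem_sdiff, dite_eq_ite]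
    by_cases h1 : j ∈ T <;> by_cases h2 : j ∈ J <;> simp_all
  · intro q hq
    rw [Finset.HasAntidiagonal.mem_antidiagonal] at hq
    rw [Finset.mem_powerset]
    intro j hj
    by_contra h
    have := DFunLike.congr_fun hq j
    simp only [Finsupp.add_apply, Finsupp.indicator_apply, h, dite_eq_ite, if_false] at this
    simp at hj
    omega
  · intro T hT
    ext j
    simp [Finsupp.indicator_apply]
  · intro q hq
    rw [Finset.HasAntidiagonal.mem_antidiagonal] at hq
    have h : ∀ j, q.1 j + q.2 j = if j ∈ J then 1 else 0 := by
      intro j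
      rw [← Finsupp.add_apply, hq, Finsupp.indicator_apply]
      simp
    ext j
    · have := h j
      simp only [Finsupp.indicator_apply, dite_eq_ite, Finsupp.mem_support_iff]
      split_ifs at this ⊢ <;> omega
    · have := h j
      simp only [Finsupp.indicator_apply, dite_eq_ite, Finsupp.mem_support_iff, Finset.mem_sdiff]
      by_cases h1 : j ∈ J <;> by_cases h2 : q.1 j = 0 <;> simp [h1, h2] at this ⊢ <;> omega
  · intro T hT
    rfl

theorem squarefreeCoeff_X_mul (J : Finset ι) (j : ι) (f : MvPowerSeries ι ℚ) :
    squarefreeCoeff J (MvPowerSeries.X j * f)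
      = if j ∈ J then squarefreeCoeff (J.erase j) f else 0 := by
  rw [squarefreeCoeff, MvPowerSeries.X, MvPowerSeries.coeff_monomial_mul, one_mul]
  have h : Finsupp.single j 1 ≤ (Finsupp.indicator J fun _ _ => 1 : ι →₀ ℕ) ↔ j ∈ J := by
    rw [Finsupp.single_le_iff, Finsupp.indicator_apply]
    split_ifs <;> simp [*]
  simp only [h]
  split_ifs with hj
  · rw [squarefreeCoeff]
    congr 2
    ext i
    simp only [Finsupp.coe_tsub, Pi.sub_apply, Finsupp.indicator_apply, dite_eq_ite,
      Finset.mem_erase, Finsupp.single_apply]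
    by_cases h : j = i
    · subst h
      simp [hj]
    · simp [h, Ne.symm h]
  · rfl

/-- `e * (e + N - 1) * ⋯ * (e + N - q + 1)`, with `q` factors, to be read as `1` when `q = 0`. -/
def abelFactor (q e N : ℕ) : ℕ :=
  if q = 0 then 1 else e * (e + N - 1).descFactorial (q - 1)

theorem cast_descFactorial_succ (n q : ℕ) :
    ((n.descFactorial (q + 1) : ℕ) : ℚ) = (n - q) * n.descFactorial q := by
  rw [Nat.descFactorial_succ, Nat.cast_mul]
  rcases le_or_gt q n with h | h
  · rw [Nat.cast_sub h]
  · rw [Nat.descFactorial_eq_zero_iff_lt.2 h]; simp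

theorem squarefreeCoeff_pow (J₀ : Finset ι) (B n : ι → ℕ) (a : MvPowerSeries ι ℚ)
    (hn : ∀ j ∈ J₀, 1 ≤ n j)
    (ha : a = 1 + ∑ j ∈ J₀, MvPowerSeries.C (B j : ℚ) * MvPowerSeries.X j * a ^ n j)
    (J : Finset ι) (hJ : J ⊆ J₀) (e : ℕ) :
    squarefreeCoeff J (a ^ e) = abelFactor J.card e (∑ j ∈ J, n j) * ∏ j ∈ J, (B j : ℚ) := by
  induction hq : J.card generalizing J e with
  | zero =>
    obtain rfl := Finset.card_eq_zero.1 hq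
    clear hq
    have h0 : ∀ a b : ℕ, abelFactor 0 a b = 1 := fun _ _ => rfl
    induction e with
    | zero => simp [squarefreeCoeff_one, abelFactor]
    | succ e ih =>
      rw [pow_succ, ha, mul_add, mul_one, map_add, ← ha, ih, h0, h0, add_eq_left, Finset.mul_sum,
        map_sum]
      refine Finset.sum_eq_zero fun j _ => ?_
      rw [mul_assoc, mul_left_comm, mul_left_comm _ (MvPowerSeries.X j),
        ← MvPowerSeries.smul_eq_C_mul,
        map_smul, squarefreeCoeff_X_mul, if_neg (by simp), smul_zero]
  | succ q IH =>
    induction e with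
    | zero =>
      rw [pow_zero, squarefreeCoeff_one, if_neg (by rintro rfl; simp at hq)]
      simp [abelFactor]
    | succ e ih =>
      have h1 : ∀ j ∈ J₀, squarefreeCoeff J
          (a ^ e * (MvPowerSeries.C (B j : ℚ) * MvPowerSeries.X j * a ^ n j))
          = if j ∈ J then abelFactor q (e + n j) (∑ i ∈ J.erase j, n i) * ∏ i ∈ J, (B i : ℚ) else 0 := by
        intro j _
        rw [mul_assoc, mul_left_comm, mul_left_comm _ (MvPowerSeries.X j), ← pow_add,
          ← MvPowerSeries.smul_eq_C_mul, map_smul, squarefreeCoeff_X_mul]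
        split_ifs with hj
        · rw [IH _ ((Finset.erase_subset _ _).trans hJ) _
            (by rw [Finset.card_erase_of_mem hj, hq]; rfl),
            ← Finset.mul_prod_erase J _ hj, smul_eq_mul]
          ring
        · rw [smul_zero]
      rw [pow_succ, ha, mul_add, mul_one, map_add, ← ha, ih, Finset.mul_sum, map_sum,
        Finset.sum_congr rfl h1, ← Finset.sum_filter, Finset.filter_mem_eq_inter,
        Finset.inter_eq_right.2 hJ, ← Finset.sum_mul, ← add_mul]
      congr 1
      set N := ∑ j ∈ J, n j with hN
      rcases q with _ | q
      · simp [abelFactor, hq]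
      · have h2 : ∀ j ∈ J, (abelFactor (q + 1) (e + n j) (∑ i ∈ J.erase j, n i) : ℚ)
            = (e + n j) * (e + N - 1).descFactorial q := by
          intro j hj
          rw [hN, ← Finset.add_sum_erase J _ hj, abelFactor, if_neg (by simp)]
          push_cast
          simp [add_assoc]
        rw [Finset.sum_congr rfl h2, ← Finset.sum_mul, Finset.sum_add_distrib, Finset.sum_const, hq,
          nsmul_eq_mul, ← Nat.cast_sum, ← hN]
        have hN1 : 1 ≤ N := by
          obtain ⟨j, hj⟩ := Finset.card_pos.1 (by omega : 0 < J.card)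
          rw [hN, ← Finset.add_sum_erase J _ hj]
          have := hn j (hJ hj)
          omega
        obtain ⟨M, hM⟩ : ∃ M, N = M + 1 := ⟨N - 1, by omega⟩
        simp only [abelFactor, Nat.add_eq_zero_iff, one_ne_zero, and_false, if_false,
          Nat.add_sub_cancel]
        rw [hM, show e + 1 + (M + 1) - 1 = e + M + 1 by omega,
          show e + (M + 1) - 1 = e + M by omega,
          Nat.succ_descFactorial_succ]
        have := cast_descFactorial_succ (e + M) q
        push_cast at this ⊢
        rw [this]
        ring
end

section
variable {ι : Type*} [DecidableEq ι]

/-- The Bousquet-Mélou–Schaeffer number for a distinguished cycle of length `n` and further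
cycles `j ∈ J` of lengths `c j`. -/
def hypermapNumber (m : ℕ) (c : ι → ℕ) (n : ℕ) (J : Finset ι) : ℚ :=
  if n = 0 then 0 else
    m * ((m - 1) * (n + ∑ j ∈ J, c j) - 1).factorial
      / ((m - 1) * (n + ∑ j ∈ J, c j) - J.card + 1).factorial
      * (cycleWeight m n * ∏ j ∈ J, (cycleWeight m (c j) : ℚ))

/-- The numbers generated by the cut-and-join recursion on the factors moving the root. -/
def cutJoinNumber (m : ℕ) (c : ι → ℕ) : ℕ → ℕ → Finset ι → ℚ
  | 0, n, J => if n = 1 ∧ J = ∅ then 1 else 0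
  | _ + 1, 0, _ => 0
  | i + 1, n + 1, J => cutJoinNumber m c i (n + 1) J
      + ∑ j ∈ J, (c j : ℚ) * cutJoinNumber m c i (n + 1 + c j) (J.erase j)
      + ∑ q ∈ Finset.HasAntidiagonal.antidiagonal (n + 1), ∑ T ∈ J.powerset,
        cutJoinNumber m c i q.1 T * hypermapNumber m c q.2 (J \ T)

theorem mul_fussCatalan {m n : ℕ} (hm : 2 ≤ m) (hn : 1 ≤ n) :
    (m - 1 : ℚ) * n * ((m - 1) * n + 1) * fussCatalan ℚ m n = m * cycleWeight m n := by
  obtain ⟨m, rfl⟩ : ∃ m', m = m' + 1 := ⟨m - 1, by omega⟩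
  obtain ⟨n, rfl⟩ : ∃ n', n = n' + 1 := ⟨n - 1, by omega⟩
  have h1 := Nat.choose_succ_right_eq ((m + 1) * (n + 1)) n
  have h2 := Nat.choose_mul_succ_eq (m * (n + 1) + n) (n + 1)
  rw [show (m + 1) * (n + 1) - n = m * (n + 1) + 1 by
    rw [Nat.sub_eq_iff_eq_add (by nlinarith)]; ring] at h1
  rw [show m * (n + 1) + n + 1 = (m + 1) * (n + 1) by ring,
    show (m + 1) * (n + 1) - (n + 1) = m * (n + 1) by rw [Nat.add_mul]; simp] at h2
  rw [fussCatalan, cycleWeight, show (m + 1) * (n + 1) - 1 = m * (n + 1) + n by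
    rw [Nat.add_mul]; omega, Nat.add_sub_cancel]
  have h1' := congrArg (Nat.cast (R := ℚ)) h1
  have h2' := congrArg (Nat.cast (R := ℚ)) h2
  push_cast at h1' h2' ⊢
  have hn0 : (n + 1 : ℚ) ≠ 0 := by positivity
  field_simp
  apply mul_left_cancel₀ hn0
  linear_combination (-(m : ℚ)) * (n + 1) * h1' - (n + 1) * h2'

theorem hypermapNumber_eq {m : ℕ} (hm : 2 ≤ m) (c : ι → ℕ) {n : ℕ} (hn : 1 ≤ n) (J : Finset ι)
    (hc : ∀ j ∈ J, 1 ≤ c j) :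
    hypermapNumber m c n J
      = fussCatalan ℚ m n * (abelFactor J.card ((m - 1) * n + 1) (∑ j ∈ J, (m - 1) * c j)
          * ∏ j ∈ J, (cycleWeight m (c j) : ℚ))
        + ∑ j ∈ J, polarCoeff ℚ m n (c j) *
          (abelFactor (J.erase j).card ((m - 1) * (n + c j)) (∑ i ∈ J.erase j, (m - 1) * c i)
          * ∏ i ∈ J.erase j, (cycleWeight m (c i) : ℚ)) := by
  set P : ℚ := ∏ j ∈ J, (cycleWeight m (c j) : ℚ) with hP
  set N := ∑ j ∈ J, (m - 1) * c j with hN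
  set E := (m - 1) * n with hE
  have hE1 : 1 ≤ E := Nat.mul_pos (by omega) hn
  have hm1 : ((m - 1 : ℕ) : ℚ) = m - 1 := by rw [Nat.cast_sub (by omega), Nat.cast_one]
  have hm0 : (m - 1 : ℚ) ≠ 0 := by rw [← hm1]; exact_mod_cast (by omega : m - 1 ≠ 0)
  have hEq : (E : ℚ) = (m - 1) * n := by rw [hE]; push_cast [hm1]; rfl
  have hE0 : (E : ℚ) ≠ 0 := by exact_mod_cast (by omega : E ≠ 0)
  have hn0 : (n : ℚ) ≠ 0 := by exact_mod_cast (by omega : n ≠ 0)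
  have hα : fussCatalan ℚ m n = m * cycleWeight m n / (E * (E + 1)) := by
    rw [eq_div_iff (by positivity), ← mul_fussCatalan hm hn, hEq]
    ring
  have hβ : ∀ j ∈ J, polarCoeff ℚ m n (c j) * ∏ i ∈ J.erase j, (cycleWeight m (c i) : ℚ)
      = - (m * ((m - 1 : ℕ) * c j : ℕ) * cycleWeight m n * P)
        / (E * (E + ((m - 1) * c j : ℕ))) := by
    intro j hj
    have hnc : (n + c j : ℚ) ≠ 0 := by positivity
    rw [hP, ← Finset.mul_prod_erase J _ hj, polarCoeff, hEq]
    push_cast [hm1]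
    rw [← mul_add]
    field_simp
  have hcard : J.card ≤ N := by
    rw [Finset.card_eq_sum_ones]
    exact Finset.sum_le_sum fun j hj => Nat.mul_pos (by omega) (hc j hj)
  have hEN : (m - 1) * (n + ∑ j ∈ J, c j) = E + N := by
    rw [mul_add, Finset.mul_sum]
  rw [hypermapNumber, if_neg (by omega), hEN, ← hP]
  rcases hq : J.card with _ | q
  · obtain rfl := Finset.card_eq_zero.1 hq
    simp only [Finset.sum_empty, Finset.prod_empty] at hN hP ⊢
    rw [hN, hP, hα]
    obtain ⟨e, he⟩ : ∃ e, E = e + 1 := ⟨E - 1, by omega⟩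
    simp only [he, abelFactor, Nat.factorial_succ, add_zero, Nat.add_sub_cancel, Nat.sub_zero]
    have := Nat.factorial_ne_zero e
    push_cast
    field_simp
  have hsum : ∑ j ∈ J, polarCoeff ℚ m n (c j) *
      (abelFactor (J.erase j).card ((m - 1) * (n + c j)) (∑ i ∈ J.erase j, (m - 1) * c i)
        * ∏ i ∈ J.erase j, (cycleWeight m (c i) : ℚ))
      = ∑ j ∈ J, - (m * ((m - 1 : ℕ) * c j : ℕ) * cycleWeight m n * P)
        / (E * (E + ((m - 1) * c j : ℕ))) *
          abelFactor q (E + (m - 1) * c j) (∑ i ∈ J.erase j, (m - 1) * c i) := by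
    refine Finset.sum_congr rfl fun j hj => ?_
    rw [← hβ j hj, Finset.card_erase_of_mem hj, hq, Nat.add_sub_cancel, mul_add]
    ring
  rw [hsum]
  rcases q with _ | q
  · obtain ⟨j, rfl⟩ := Finset.card_eq_one.1 hq
    simp only [Finset.sum_singleton] at hN ⊢
    rw [← hN, hα]
    obtain ⟨e, he⟩ : ∃ e, E + N = e + 1 := ⟨E + N - 1, by omega⟩
    have heq : (E + N : ℚ) = e + 1 := by exact_mod_cast he
    simp only [he, abelFactor, Nat.factorial_succ, Nat.add_sub_cancel, if_true, heq]
    have := Nat.factorial_ne_zero e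
    push_cast
    simp
    field_simp
    linear_combination (cycleWeight m n * P) * heq
  · have h1 : ∀ j ∈ J, - (m * ((m - 1 : ℕ) * c j : ℕ) * cycleWeight m n * P)
        / (E * (E + ((m - 1) * c j : ℕ))) *
          abelFactor (q + 1) (E + (m - 1) * c j) (∑ i ∈ J.erase j, (m - 1) * c i)
        = - (m * cycleWeight m n * P / E) * (E + N - 1).descFactorial q * ((m - 1) * c j : ℕ) := by
      intro j hj
      rw [abelFactor, if_neg (by omega), hN, ← Finset.add_sum_erase J _ hj, Nat.add_sub_cancel,
        add_assoc]
      have : (E : ℚ) + ((m - 1) * c j : ℕ) ≠ 0 := by positivity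
      push_cast at this ⊢
      field_simp
    rw [Finset.sum_congr rfl h1, ← Finset.mul_sum, ← Nat.cast_sum, ← hN, hα]
    obtain ⟨e, he⟩ : ∃ e, E + N = e + 1 := ⟨E + N - 1, by omega⟩
    have heq : (E + N : ℚ) = e + 1 := by exact_mod_cast he
    have hf : ((e + 1 - (q + 1 + 1) + 1).factorial : ℚ) * e.descFactorial q = e.factorial := by
      rw [← Nat.factorial_mul_descFactorial (show q ≤ e by omega)]
      push_cast
      congr 3
      omega
    rw [abelFactor, if_neg (by omega), show E + 1 + N - 1 = e + 1 by omega, he, Nat.add_sub_cancel,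
      Nat.add_sub_cancel, Nat.succ_descFactorial_succ, ← hf]
    have := Nat.factorial_ne_zero (e + 1 - (q + 1 + 1) + 1)
    push_cast
    field_simp
    linear_combination (e.descFactorial q * cycleWeight m n * P) * heq

theorem cutJoin_fixedPoint_rescaled {ι K : Type*} [Field K] [CharZero K] {m : ℕ} (hm : 2 ≤ m)
    (J : Finset ι) (c : ι → ℕ) (hc : ∀ j ∈ J, 1 ≤ c j) (p : ι → K) {a : K} (ha0 : a ≠ 0)
    (ha : a = 1 + ∑ j ∈ J, (cycleWeight m (c j) : K) * p j * a ^ ((m - 1) * c j))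
    (w : ℕ → K) (hw0 : w 0 = 0)
    (hw : ∀ n, 1 ≤ n → w n = fussCatalan K m n * a ^ ((m - 1) * n + 1)
      + ∑ j ∈ J, polarCoeff K m n (c j) * p j * a ^ ((m - 1) * (n + c j)))
    (H : ℕ → ℕ → K) (hH0 : ∀ n, H 0 n = if n = 1 then 1 else 0) (hHz : ∀ i, H (i + 1) 0 = 0)
    (hH : ∀ i n, 1 ≤ n → H (i + 1) n = H i n + ∑ j ∈ J, (c j : K) * p j * H i (n + c j)
      + ∑ q ∈ Finset.HasAntidiagonal.antidiagonal n, H i q.1 * w q.2) :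
    ∀ n, 1 ≤ n → H m n = w n := by
  intro n hn
  have key := cutJoin_fixedPoint (k := K) hm J c hc (fun j => p j * a ^ ((m - 1) * c j) / a)
    (fun n => w n / (a ^ ((m - 1) * n) * a)) (by simp [hw0]) ?_
    (fun i n => H i n * a ^ (m - 1) / (a ^ ((m - 1) * n) * a ^ i)) ?_ ?_ ?_ n hn
  · obtain ⟨m, rfl⟩ : ∃ m', m = m' + 1 := ⟨m - 1, by omega⟩
    rw [Nat.add_sub_cancel, pow_succ] at key
    field_simp at key
    exact key
  · intro n hn
    rw [hw n hn, add_div, Finset.sum_div]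
    congr 1
    · rw [pow_succ]
      field_simp
    · refine Finset.sum_congr rfl fun j _ => ?_
      rw [mul_add, pow_add]
      field_simp
  · intro n
    rw [hH0]
    split_ifs with h
    · subst h
      simp [ha0]
    · simp
  · intro i
    simp [hHz]
  · intro i n hn
    have hs : 1 - ∑ j ∈ J, (cycleWeight m (c j) : K) * (p j * a ^ ((m - 1) * c j) / a) = 1 / a := by
      rw [eq_div_iff ha0, sub_mul, one_mul, Finset.sum_mul, sub_eq_iff_eq_add]
      conv_lhs => rw [ha]
      congr 1
      refine Finset.sum_congr rfl fun j _ => ?_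
      field_simp
    rw [hs, hH i n hn, add_mul, add_mul, add_div, add_div,
      Finset.sum_mul, Finset.sum_mul, Finset.sum_div, Finset.sum_div]
    congr 1
    · congr 1
      · rw [pow_succ]
        field_simp
      · refine Finset.sum_congr rfl fun j _ => ?_
        simp only [pow_succ, mul_add, pow_add]
        field_simp
    · refine Finset.sum_congr rfl fun q hq => ?_
      rw [← Finset.HasAntidiagonal.mem_antidiagonal.1 hq]
      simp only [pow_succ, mul_add, pow_add]
      field_simp

theorem cutJoinNumber_eq_hypermapNumber {m : ℕ} (hm : 2 ≤ m) (c : ι → ℕ) {n : ℕ} (hn : 1 ≤ n)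
    (J : Finset ι) (hc : ∀ j ∈ J, 1 ≤ c j) :
    cutJoinNumber m c m n J = hypermapNumber m c n J := by
  let R := MvPowerSeries ι ℚ
  let K := FractionRing R
  let ρ : R →+* K := algebraMap R K
  have hρ : Function.Injective ρ := IsFractionRing.injective R K
  have : CharZero K := charZero_of_injective_algebraMap (algebraMap ℚ K).injective
  obtain ⟨a, ha⟩ := MvPowerSeries.exists_eq_one_add_sum J (fun j => (cycleWeight m (c j) : ℚ))
    (fun j => (m - 1) * c j)
  have hA0 : ρ a ≠ 0 := by
    rw [Ne, map_eq_zero_iff ρ hρ]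
    rintro rfl
    have := congrArg MvPowerSeries.constantCoeff ha
    simp only [map_zero, map_add, map_one, map_sum, map_mul, MvPowerSeries.constantCoeff_X] at this
    simp at this
  let w : ℕ → R := fun n => if n = 0 then 0 else
    MvPowerSeries.C (fussCatalan ℚ m n) * a ^ ((m - 1) * n + 1)
      + ∑ j ∈ J, MvPowerSeries.C (polarCoeff ℚ m n (c j)) * MvPowerSeries.X j * a ^ ((m - 1) * (n + c j))
  let H : ℕ → ℕ → R := fun i => Nat.rec (fun n => if n = 1 then 1 else 0) (fun _ h n =>
    if n = 0 then 0 else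
    h n + ∑ j ∈ J, (c j : R) * MvPowerSeries.X j * h (n + c j)
      + ∑ q ∈ Finset.HasAntidiagonal.antidiagonal n, h q.1 * w q.2) i
  have hH0 : ∀ n, H 0 n = if n = 1 then 1 else 0 := fun n => rfl
  have hHz : ∀ i, H (i + 1) 0 = 0 := fun i => rfl
  have hHs : ∀ i n, 1 ≤ n → H (i + 1) n = H i n
      + ∑ j ∈ J, (c j : R) * MvPowerSeries.X j * H i (n + c j)
      + ∑ q ∈ Finset.HasAntidiagonal.antidiagonal n, H i q.1 * w q.2 := by
    intro i n hn
    exact if_neg (by omega)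
  have hHw : ∀ n, 1 ≤ n → H m n = w n := by
    intro n hn
    apply hρ
    refine cutJoin_fixedPoint_rescaled hm J c hc (fun j => ρ (MvPowerSeries.X j)) hA0 ?_
      (fun n => ρ (w n)) (by simp [w]) ?_ (fun i n => ρ (H i n)) ?_ ?_ ?_ n hn
    · conv_lhs => rw [ha]
      simp [map_sum]
    · intro n hn
      have hC : ∀ r : ℚ, ρ (MvPowerSeries.C r) = (r : K) := fun r =>
        eq_ratCast (ρ.comp MvPowerSeries.C) r
      simp only [w]
      rw [if_neg (by omega)]
      simp only [map_add, map_mul, map_sum, map_pow, hC]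
      simp [fussCatalan, polarCoeff]
    · intro n
      rw [hH0]
      split_ifs <;> simp
    · intro i
      rw [hHz, map_zero]
    · intro i n hn
      simp only [hHs i n hn, map_add, map_sum, map_mul,
        show ∀ r : ℕ, ρ (r : R) = r from map_natCast ρ]
  have hw : ∀ n, ∀ T ⊆ J, squarefreeCoeff T (w n) = hypermapNumber m c n T := by
    intro n T hT
    rcases Nat.eq_zero_or_pos n with rfl | hn
    · simp [w, hypermapNumber]
    have hψ := squarefreeCoeff_pow J (fun j => cycleWeight m (c j)) (fun j => (m - 1) * c j) a
      (fun j hj => Nat.mul_pos (by omega) (hc j hj)) ha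
    have h1 : ∀ j ∈ J, squarefreeCoeff T (MvPowerSeries.C (polarCoeff ℚ m n (c j))
          * MvPowerSeries.X j * a ^ ((m - 1) * (n + c j)))
        = if j ∈ T then polarCoeff ℚ m n (c j) * (abelFactor (T.erase j).card
          ((m - 1) * (n + c j)) (∑ i ∈ T.erase j, (m - 1) * c i)
          * ∏ i ∈ T.erase j, (cycleWeight m (c i) : ℚ)) else 0 := by
      intro j _
      rw [mul_assoc, ← MvPowerSeries.smul_eq_C_mul, map_smul, squarefreeCoeff_X_mul,
        hψ _ ((Finset.erase_subset _ _).trans hT), smul_eq_mul, mul_ite, mul_zero]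
    simp only [w]
    rw [if_neg (by omega), map_add, ← MvPowerSeries.smul_eq_C_mul, map_smul, hψ T hT, map_sum,
      Finset.sum_congr rfl h1, ← Finset.sum_filter, Finset.filter_mem_eq_inter,
      Finset.inter_eq_right.2 hT, hypermapNumber_eq hm c hn T fun j hj => hc j (hT hj), smul_eq_mul]
  have hH : ∀ i n, ∀ T ⊆ J, squarefreeCoeff T (H i n) = cutJoinNumber m c i n T := by
    intro i
    induction i with
    | zero =>
      intro n T hT
      rw [hH0, cutJoinNumber]
      by_cases h : n = 1 <;> simp [h, squarefreeCoeff_one]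
    | succ i ih =>
      intro n T hT
      rcases n with _ | n
      · rw [hHz, map_zero, cutJoinNumber]
      rw [hHs i _ (by omega), cutJoinNumber, map_add, map_add, ih _ _ hT, map_sum, map_sum]
      congr 1
      · congr 1
        have h1 : ∀ j ∈ J, squarefreeCoeff T ((c j : R) * MvPowerSeries.X j * H i (n + 1 + c j))
            = if j ∈ T then (c j : ℚ) * cutJoinNumber m c i (n + 1 + c j) (T.erase j) else 0 := by
          intro j _
          rw [mul_assoc, ← nsmul_eq_mul, map_nsmul, squarefreeCoeff_X_mul, nsmul_eq_mul,
            ih _ _ ((Finset.erase_subset _ _).trans hT), mul_ite, mul_zero]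
        rw [Finset.sum_congr rfl h1, ← Finset.sum_filter, Finset.filter_mem_eq_inter,
          Finset.inter_eq_right.2 hT]
      · refine Finset.sum_congr rfl fun q _ => ?_
        rw [squarefreeCoeff_mul]
        refine Finset.sum_congr rfl fun U hU => ?_
        rw [Finset.mem_powerset] at hU
        rw [ih _ _ (hU.trans hT), hw _ _ (Finset.sdiff_subset.trans hT)]
  rw [← hH m n J subset_rfl, hHw n hn, hw n J subset_rfl]
end

section

open Equiv Equiv.Perm

section
variable {X : Type*}

/-- The finite set `B` is a union of orbits of `g`. -/
def IsStable (B : Finset X) (g : Perm X) : Prop := ∀ x, g x ∈ B ↔ x ∈ B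

namespace IsStable

variable {B C : Finset X} {g h : Perm X}

theorem one (B : Finset X) : IsStable B 1 := fun _ => Iff.rfl

theorem mul (hg : IsStable B g) (hh : IsStable B h) : IsStable B (g * h) := fun x => by
  rw [Perm.mul_apply, hg, hh]

theorem list_prod {F : List (Perm X)} (hF : ∀ g ∈ F, IsStable B g) : IsStable B F.prod := by
  induction F with
  | nil => exact one B
  | cons g F ih =>
    rw [List.forall_mem_cons] at hF
    rw [List.prod_cons]
    exact hF.1.mul (ih hF.2)

theorem swap [DecidableEq X] {a b : X} (ha : a ∈ B) (hb : b ∈ B) :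
    IsStable B (swap a b) := fun x => by
  rw [swap_apply_def]
  split_ifs with h1 h2 <;> simp_all

theorem union [DecidableEq X] (hB : IsStable B g) (hC : IsStable C g) :
    IsStable (B ∪ C) g := fun x => by
  rw [Finset.mem_union, Finset.mem_union, hB, hC]

theorem sdiff [DecidableEq X] (hB : IsStable B g) (hC : IsStable C g) :
    IsStable (B \ C) g := fun x => by
  rw [Finset.mem_sdiff, Finset.mem_sdiff, hB, hC]

theorem of_forall_mem (hg : ∀ x ∈ B, g x ∈ B) : IsStable B g := by
  intro x
  refine ⟨fun hx => ?_, hg x⟩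
  have := Equiv.Perm.perm_symm_on_of_perm_on_finset hg hx
  rwa [Equiv.symm_apply_apply] at this

theorem of_fix (hg : ∀ x ∉ B, g x = x) : IsStable B g := by
  intro x
  by_cases hx : x ∈ B
  · refine iff_of_true ?_ hx
    by_contra h
    have := g.injective (hg _ h)
    rw [this] at h
    exact h hx
  · rw [hg x hx]

end IsStable

/-- The permutation that agrees with `g` on `B`, when `B` is stable, and fixes all other points. -/
noncomputable def restrictTo (B : Finset X) (g : Perm X) : Perm X :=
  open Classical in
  if h : IsStable B g then ofSubtype (g.subtypePerm h) else 1

section restrictTo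
variable {B C : Finset X} {g h : Perm X} {x : X}

theorem restrictTo_apply_of_mem (hg : IsStable B g) (hx : x ∈ B) : restrictTo B g x = g x := by
  classical
  rw [restrictTo, dif_pos hg, ofSubtype_apply_of_mem _ hx]
  rfl

theorem restrictTo_apply_of_notMem (hx : x ∉ B) : restrictTo B g x = x := by
  classical
  rw [restrictTo]
  split_ifs
  · exact ofSubtype_apply_of_not_mem _ hx
  · rfl

theorem restrictTo_eq_iff (hg : IsStable B g) :
    restrictTo B g = h ↔ (∀ x ∈ B, h x = g x) ∧ ∀ x ∉ B, h x = x := by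
  constructor
  · rintro rfl
    exact ⟨fun x hx => restrictTo_apply_of_mem hg hx, fun x hx => restrictTo_apply_of_notMem hx⟩
  · rintro ⟨h1, h2⟩
    ext x
    by_cases hx : x ∈ B
    · rw [restrictTo_apply_of_mem hg hx, h1 x hx]
    · rw [restrictTo_apply_of_notMem hx, h2 x hx]

theorem restrictTo_mul (hg : IsStable B g) (hh : IsStable B h) :
    restrictTo B (g * h) = restrictTo B g * restrictTo B h := by
  rw [restrictTo_eq_iff (hg.mul hh)]
  refine ⟨fun x hx => ?_, fun x hx => ?_⟩
  · rw [Perm.mul_apply, restrictTo_apply_of_mem hh hx, restrictTo_apply_of_mem hg ((hh x).2 hx),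
      Perm.mul_apply]
  · rw [Perm.mul_apply, restrictTo_apply_of_notMem hx, restrictTo_apply_of_notMem hx]

theorem restrictTo_one : restrictTo B (1 : Perm X) = 1 := by
  rw [restrictTo_eq_iff (IsStable.one B)]
  simp

theorem restrictTo_list_prod {F : List (Perm X)} (hF : ∀ g ∈ F, IsStable B g) :
    restrictTo B F.prod = (F.map (restrictTo B)).prod := by
  induction F with
  | nil => exact restrictTo_one
  | cons g F ih =>
    rw [List.forall_mem_cons] at hF
    rw [List.prod_cons, restrictTo_mul hF.1 (IsStable.list_prod hF.2), ih hF.2, List.map_cons,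
      List.prod_cons]

theorem restrictTo_eq_self (hg : ∀ x ∉ B, g x = x) : restrictTo B g = g := by
  rw [restrictTo_eq_iff (IsStable.of_fix hg)]
  exact ⟨fun _ _ => rfl, hg⟩

theorem restrictTo_eq_one (hg : ∀ x ∈ B, g x = x) : restrictTo B g = 1 := by
  rw [restrictTo_eq_iff (IsStable.of_forall_mem fun x hx => by rwa [hg x hx])]
  exact ⟨fun x hx => (hg x hx).symm, fun _ _ => rfl⟩

theorem disjoint_restrictTo (hBC : Disjoint B C) :
    Perm.Disjoint (restrictTo B g) (restrictTo C h) := by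
  intro x
  by_cases hx : x ∈ B
  · exact Or.inr (restrictTo_apply_of_notMem (Finset.disjoint_left.1 hBC hx))
  · exact Or.inl (restrictTo_apply_of_notMem hx)

theorem restrictTo_mul_restrictTo (hB : IsStable B g) (hC : IsStable C g) (hBC : Disjoint B C)
    (hg : ∀ x, x ∉ B → x ∉ C → g x = x) : restrictTo B g * restrictTo C g = g := by
  ext x
  rw [Perm.mul_apply]
  by_cases hx : x ∈ C
  · rw [restrictTo_apply_of_mem hC hx, restrictTo_apply_of_notMem]
    exact Finset.disjoint_right.1 hBC ((hC x).2 hx)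
  · rw [restrictTo_apply_of_notMem hx]
    by_cases hx' : x ∈ B
    · rw [restrictTo_apply_of_mem hB hx']
    · rw [restrictTo_apply_of_notMem hx', hg x hx' hx]

theorem isStable_restrictTo (hB : IsStable B g) (hC : IsStable C g) :
    IsStable C (restrictTo B g) := by
  intro x
  by_cases hx : x ∈ B
  · rw [restrictTo_apply_of_mem hB hx, hC]
  · rw [restrictTo_apply_of_notMem hx]

theorem restrictTo_mul_eq_left (hBC : Disjoint B C) (hg : ∀ x ∉ B, g x = x)
    (hh : ∀ x ∉ C, h x = x) : restrictTo B (g * h) = g := by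
  have hhB : ∀ x ∈ B, h x = x := fun x hx => hh x (Finset.disjoint_left.1 hBC hx)
  rw [restrictTo_mul (IsStable.of_fix hg) (IsStable.of_forall_mem fun x hx => by rwa [hhB x hx]),
    restrictTo_eq_self hg, restrictTo_eq_one hhB, mul_one]

theorem fix_list_prod {F : List (Perm X)} (hF : ∀ g ∈ F, ∀ x ∉ B, g x = x) :
    ∀ x ∉ B, F.prod x = x := by
  induction F with
  | nil => exact fun _ _ => rfl
  | cons g F ih =>
    rw [List.forall_mem_cons] at hF
    intro x hx
    rw [List.prod_cons, Perm.mul_apply, ih hF.2 x hx, hF.1 x hx]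

end restrictTo

/-- `σ` sends `x` through the successive entries of the list and finally to `y`. -/
def IsPath (σ : Perm X) : X → List X → X → Prop
  | x, [], y => σ x = y
  | x, a :: l, y => σ x = a ∧ IsPath σ a l y

theorem isPath_append_cons {σ : Perm X} {w v : List X} {x b y : X} :
    IsPath σ x (w ++ b :: v) y ↔ IsPath σ x w b ∧ IsPath σ b v y := by
  induction w generalizing x with
  | nil => rfl
  | cons a w ih => simp only [List.cons_append, IsPath, ih, and_assoc]

theorem IsPath.congr {σ τ : Perm X} {x y y' : X} {l : List X} (hσ : IsPath σ x l y)
    (h : ∀ z ∈ x :: l, σ z ∈ l → τ z = σ z) (hy : ∀ z ∈ x :: l, σ z = y → τ z = y') :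
    IsPath τ x l y' := by
  induction l generalizing x with
  | nil => exact hy x (by simp) hσ
  | cons a l ih =>
    refine ⟨(h x (by simp) (by simp [hσ.1])).trans hσ.1,
      ih hσ.2 (fun z hz hl => ?_) fun z hz hl => ?_⟩
    · exact h z (List.mem_cons_of_mem _ hz) (List.mem_cons_of_mem _ hl)
    · exact hy z (List.mem_cons_of_mem _ hz) hl

theorem IsPath.swap_mul [DecidableEq X] {σ : Perm X} {x y b r : X} {l : List X}
    (hσ : IsPath σ x l y)
    (hb : b ∉ l) (hr : r ∉ l) : IsPath (swap b r * σ) x l (swap b r y) := by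
  refine hσ.congr (fun z _ hz => ?_) fun z _ hz => by rw [Perm.mul_apply, hz]
  rw [Perm.mul_apply, swap_apply_of_ne_of_ne] <;> rintro h <;> simp_all

theorem IsPath.mem_of_mem {σ : Perm X} {x y : X} {l : List X} (hσ : IsPath σ x l y) :
    ∀ z ∈ x :: l, σ z ∈ l ∨ σ z = y := by
  induction l generalizing x with
  | nil => intro z hz; simp at hz; subst hz; exact Or.inr hσ
  | cons a l ih =>
    intro z hz
    rcases List.mem_cons.1 hz with rfl | hz
    · exact Or.inl (by simp [hσ.1])
    · exact (ih hσ.2 z hz).imp_left (List.mem_cons_of_mem _)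

theorem IsPath.subset_of_isStable {σ : Perm X} {x y : X} {l : List X} (hσ : IsPath σ x l y)
    {B : Finset X} (hB : IsStable B σ) (hx : x ∈ B) : ∀ z ∈ x :: l, z ∈ B := by
  induction l generalizing x with
  | nil => simpa using hx
  | cons a l ih =>
    rw [List.forall_mem_cons]
    exact ⟨hx, ih hσ.2 (by rw [← hσ.1]; exact (hB x).2 hx)⟩

variable [DecidableEq X]

/-- `s` is the set of points of a single cycle of `σ`. -/
def IsCycleSet (σ : Perm X) (s : Finset X) : Prop :=
  ∃ a l, (a :: l).Nodup ∧ IsPath σ a l a ∧ s = (a :: l).toFinset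

namespace IsCycleSet
variable {σ τ : Perm X} {s : Finset X}

theorem exists_of_mem (h : IsCycleSet σ s) {b : X} (hb : b ∈ s) :
    ∃ l, (b :: l).Nodup ∧ IsPath σ b l b ∧ s = (b :: l).toFinset := by
  obtain ⟨a, l, hn, hp, rfl⟩ := h
  rcases List.mem_cons.1 (List.mem_toFinset.1 hb) with rfl | hb
  · exact ⟨l, hn, hp, rfl⟩
  · obtain ⟨l1, l2, rfl⟩ := List.append_of_mem hb
    have hperm : (b :: (l2 ++ a :: l1)).Perm (a :: (l1 ++ b :: l2)) :=
      (List.perm_append_comm (l₁ := a :: l1) (l₂ := b :: l2)).symm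
    refine ⟨l2 ++ a :: l1, hperm.nodup_iff.2 hn, ?_, ?_⟩
    · rw [isPath_append_cons] at hp ⊢
      exact hp.symm
    · exact List.toFinset_eq_of_perm _ _ hperm.symm

theorem isStable (h : IsCycleSet σ s) : IsStable s σ := by
  refine IsStable.of_forall_mem fun x hx => ?_
  obtain ⟨a, l, hn, hp, rfl⟩ := h
  rw [List.mem_toFinset] at hx ⊢
  rcases hp.mem_of_mem x hx with h | h <;> simp [h]

theorem nonempty (h : IsCycleSet σ s) : s.Nonempty := by
  obtain ⟨a, l, _, _, rfl⟩ := h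
  exact ⟨a, by simp⟩

theorem subset_of_mem (h : IsCycleSet σ s) {B : Finset X} (hB : IsStable B σ) {x : X}
    (hx : x ∈ s) (hxB : x ∈ B) : s ⊆ B := by
  obtain ⟨l, _, hp, rfl⟩ := h.exists_of_mem hx
  intro z hz
  exact hp.subset_of_isStable hB hxB z (List.mem_toFinset.1 hz)

theorem congr (h : IsCycleSet σ s) (hτ : ∀ x ∈ s, τ x = σ x) : IsCycleSet τ s := by
  obtain ⟨a, l, hn, hp, rfl⟩ := h
  refine ⟨a, l, hn, hp.congr (fun z hz _ => hτ z (List.mem_toFinset.2 hz)) fun z hz h => ?_, rfl⟩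
  rw [hτ z (List.mem_toFinset.2 hz), h]

end IsCycleSet

/-- `K` is a set of cycles of `σ`, and `σ` fixes all points outside these cycles. -/
structure IsCycleDecomp (σ : Perm X) (K : Finset (Finset X)) : Prop where
  isCycleSet : ∀ s ∈ K, IsCycleSet σ s
  disjoint : ∀ s ∈ K, ∀ t ∈ K, s ≠ t → Disjoint s t
  fix : ∀ x ∉ K.biUnion id, σ x = x

namespace IsCycleDecomp
variable {σ τ : Perm X} {K T : Finset (Finset X)} {s t : Finset X} {r b : X}

theorem eq_of_mem (h : IsCycleDecomp σ K) (hs : s ∈ K) (ht : t ∈ K) (h1 : b ∈ s) (h2 : b ∈ t) :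
    s = t := by
  by_contra hst
  exact Finset.disjoint_left.1 (h.disjoint s hs t ht hst) h1 h2

theorem isStable_biUnion (h : IsCycleDecomp σ K) (hT : T ⊆ K) : IsStable (T.biUnion id) σ := by
  intro x
  simp only [Finset.mem_biUnion, id]
  refine exists_congr fun s => and_congr_right fun hs => (h.isCycleSet s (hT hs)).isStable x

theorem restrict (h : IsCycleDecomp σ K) (hT : T ⊆ K) :
    IsCycleDecomp (restrictTo (T.biUnion id) σ) T where
  isCycleSet s hs := (h.isCycleSet s (hT hs)).congr fun _ hx =>
    restrictTo_apply_of_mem (h.isStable_biUnion hT) (Finset.mem_biUnion.2 ⟨s, hs, hx⟩)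
  disjoint s hs t ht := h.disjoint s (hT hs) t (hT ht)
  fix _ hx := restrictTo_apply_of_notMem hx

theorem biUnion_filter_subset (h : IsCycleDecomp σ K) {B : Finset X} (hB : IsStable B σ)
    (hBK : B ⊆ K.biUnion id) : (K.filter (· ⊆ B)).biUnion id = B := by
  ext x
  simp only [Finset.mem_biUnion, Finset.mem_filter, id]
  constructor
  · rintro ⟨s, hs, hx⟩
    exact hs.2 hx
  · intro hx
    obtain ⟨s, hs, hxs⟩ := Finset.mem_biUnion.1 (hBK hx)
    exact ⟨s, ⟨hs, (h.isCycleSet s hs).subset_of_mem hB hxs hx⟩, hxs⟩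

theorem card_biUnion (h : IsCycleDecomp σ K) : (K.biUnion id).card = ∑ s ∈ K, s.card :=
  Finset.card_biUnion fun s hs t ht hst => h.disjoint s hs t ht hst

theorem card_pos (h : IsCycleDecomp σ K) {a : ℕ} (ha : a ∈ K.val.map Finset.card) : 1 ≤ a := by
  obtain ⟨s, hs, rfl⟩ := Multiset.mem_map.1 ha
  exact (h.isCycleSet s hs).nonempty.card_pos

theorem notMem_insert_of_mem (hs : IsCycleDecomp σ K) (hsK : s ∈ K) (ht : t ⊆ s)
    (htn : t.Nonempty) :
    t ∉ K.erase s := by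
  intro h
  rw [Finset.mem_erase] at h
  obtain ⟨x, hx⟩ := htn
  exact h.1 (hs.eq_of_mem h.2 hsK hx (ht hx))

theorem join (h : IsCycleDecomp σ K) (hs : s ∈ K) (ht : t ∈ K) (hst : s ≠ t) (hr : r ∈ s)
    (hb : b ∈ t) :
    IsCycleDecomp (swap b r * σ) (insert (s ∪ t) ((K.erase s).erase t)) where
  isCycleSet u hu := by
    obtain ⟨l, hl, hpl, hls⟩ := (h.isCycleSet s hs).exists_of_mem hr
    obtain ⟨w, hw, hpw, hwt⟩ := (h.isCycleSet t ht).exists_of_mem hb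
    have hd := h.disjoint s hs t ht hst
    rcases Finset.mem_insert.1 hu with rfl | hu
    · refine ⟨r, l ++ b :: w, ?_, ?_, ?_⟩
      · rw [← List.cons_append, List.nodup_append']
        refine ⟨hl, hw, fun x h1 h2 => ?_⟩
        rw [hls, hwt] at hd
        exact Finset.disjoint_left.1 hd (List.mem_toFinset.2 h1) (List.mem_toFinset.2 h2)
      · rw [isPath_append_cons]
        have hbl : b ∉ l := fun hbl => Finset.disjoint_left.1 hd
          (by rw [hls]; exact List.mem_toFinset.2 (List.mem_cons_of_mem _ hbl)) hb
        have hrw : r ∉ w := fun hrw => Finset.disjoint_left.1 hd hr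
          (by rw [hwt]; exact List.mem_toFinset.2 (List.mem_cons_of_mem _ hrw))
        have h1 := hpl.swap_mul hbl (List.nodup_cons.1 hl).1
        have h2 := hpw.swap_mul (List.nodup_cons.1 hw).1 hrw
        rw [swap_apply_right] at h1
        rw [swap_apply_left] at h2
        exact ⟨h1, h2⟩
      · rw [hls, hwt, ← List.toFinset_append, List.cons_append]
    · rw [Finset.mem_erase, Finset.mem_erase] at hu
      refine (h.isCycleSet u hu.2.2).congr fun x hx => ?_
      have hσx := ((h.isCycleSet u hu.2.2).isStable x).2 hx
      rw [Perm.mul_apply, swap_apply_of_ne_of_ne]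
      · rintro rfl
        exact hu.1 (h.eq_of_mem hu.2.2 ht hσx hb)
      · rintro rfl
        exact hu.2.1 (h.eq_of_mem hu.2.2 hs hσx hr)
  disjoint u hu v hv huv := by
    have aux : ∀ u ∈ (K.erase s).erase t, Disjoint u (s ∪ t) := by
      intro u hu
      rw [Finset.mem_erase, Finset.mem_erase] at hu
      exact Finset.disjoint_union_right.2 ⟨h.disjoint _ hu.2.2 _ hs hu.2.1,
        h.disjoint _ hu.2.2 _ ht hu.1⟩
    rcases Finset.mem_insert.1 hu with rfl | hu <;> rcases Finset.mem_insert.1 hv with rfl | hv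
    · exact absurd rfl huv
    · exact (aux v hv).symm
    · exact aux u hu
    · exact h.disjoint _ (Finset.mem_of_mem_erase (Finset.mem_of_mem_erase hu)) _
        (Finset.mem_of_mem_erase (Finset.mem_of_mem_erase hv)) huv
  fix x hx := by
    have hx' : x ∉ K.biUnion id := by
      intro hxK
      obtain ⟨u, hu, hxu⟩ := Finset.mem_biUnion.1 hxK
      refine hx (Finset.mem_biUnion.2 ?_)
      by_cases h1 : u = s ∨ u = t
      · refine ⟨s ∪ t, Finset.mem_insert_self _ _, ?_⟩
        rcases h1 with rfl | rfl
        · exact Finset.mem_union_left _ hxu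
        · exact Finset.mem_union_right _ hxu
      · push Not at h1
        exact ⟨u, by simp [h1, hu], hxu⟩
    rw [Perm.mul_apply, h.fix x hx', swap_apply_of_ne_of_ne]
    · rintro rfl
      exact hx' (Finset.mem_biUnion.2 ⟨t, ht, hb⟩)
    · rintro rfl
      exact hx' (Finset.mem_biUnion.2 ⟨s, hs, hr⟩)

theorem cut (h : IsCycleDecomp σ K) {w v : List X} (hn : (r :: (w ++ b :: v)).Nodup)
    (hp : IsPath σ r (w ++ b :: v) r) (hs : (r :: (w ++ b :: v)).toFinset ∈ K) :
    IsCycleDecomp (swap b r * σ) (insert (r :: w).toFinset (insert (b :: v).toFinset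
      (K.erase (r :: (w ++ b :: v)).toFinset))) := by
  set s := (r :: (w ++ b :: v)).toFinset with hsdef
  have hr : r ∈ s := by simp [hsdef]
  have hb : b ∈ s := by simp [hsdef]
  have hs1 : (r :: w).toFinset ⊆ s := by intro x; simp [hsdef]; tauto
  have hs2 : (b :: v).toFinset ⊆ s := by intro x; simp [hsdef]; tauto
  have hn' := hn
  rw [← List.cons_append, List.nodup_append'] at hn'
  obtain ⟨hn1, hn2, hn3⟩ := hn'
  have hd : Disjoint (r :: w).toFinset (b :: v).toFinset := by
    rw [Finset.disjoint_left]
    intro x h1 h2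
    exact hn3 (List.mem_toFinset.1 h1) (List.mem_toFinset.1 h2)
  rw [isPath_append_cons] at hp
  have h1 := hp.1.swap_mul (b := b) (r := r) (fun h => hn3 (List.mem_cons_of_mem _ h) (by simp))
    (List.nodup_cons.1 hn1).1
  have h2 := hp.2.swap_mul (b := b) (r := r) (List.nodup_cons.1 hn2).1
    (fun h => hn3 (List.mem_cons_self) (List.mem_cons_of_mem _ h))
  rw [swap_apply_left] at h1
  rw [swap_apply_right] at h2
  have aux : ∀ u ∈ K.erase s, Disjoint u s := fun u hu =>
    h.disjoint u (Finset.mem_of_mem_erase hu) s hs (Finset.ne_of_mem_erase hu)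
  refine ⟨fun u hu => ?_, fun u hu u' hu' huu' => ?_, fun x hx => ?_⟩
  · rw [Finset.mem_insert, Finset.mem_insert] at hu
    rcases hu with rfl | rfl | hu
    · exact ⟨r, w, hn1, h1, rfl⟩
    · exact ⟨b, v, hn2, h2, rfl⟩
    · refine (h.isCycleSet u (Finset.mem_of_mem_erase hu)).congr fun x hx => ?_
      have hσx := ((h.isCycleSet u (Finset.mem_of_mem_erase hu)).isStable x).2 hx
      rw [Perm.mul_apply, swap_apply_of_ne_of_ne]
      · rintro rfl
        exact Finset.disjoint_left.1 (aux u hu) hσx hb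
      · rintro rfl
        exact Finset.disjoint_left.1 (aux u hu) hσx hr
  · rw [Finset.mem_insert, Finset.mem_insert] at hu hu'
    rcases hu with rfl | rfl | hu <;> rcases hu' with rfl | rfl | hu'
    · exact absurd rfl huu'
    · exact hd
    · exact ((aux _ hu').mono_right hs1).symm
    · exact hd.symm
    · exact absurd rfl huu'
    · exact ((aux _ hu').mono_right hs2).symm
    · exact (aux _ hu).mono_right hs1
    · exact (aux _ hu).mono_right hs2
    · exact h.disjoint _ (Finset.mem_of_mem_erase hu) _ (Finset.mem_of_mem_erase hu') huu'
  · have hx' : x ∉ K.biUnion id := by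
      intro hxK
      obtain ⟨u, hu, hxu⟩ := Finset.mem_biUnion.1 hxK
      refine hx (Finset.mem_biUnion.2 ?_)
      by_cases hus : u = s
      · subst hus
        rw [id, hsdef, ← List.cons_append, List.toFinset_append, Finset.mem_union] at hxu
        rcases hxu with hxu | hxu
        · exact ⟨_, Finset.mem_insert_self _ _, hxu⟩
        · exact ⟨_, Finset.mem_insert_of_mem (Finset.mem_insert_self _ _), hxu⟩
      · exact ⟨u, Finset.mem_insert_of_mem (Finset.mem_insert_of_mem
          (Finset.mem_erase.2 ⟨hus, hu⟩)), hxu⟩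
    rw [Perm.mul_apply, h.fix x hx', swap_apply_of_ne_of_ne]
    · rintro rfl
      exact hx' (Finset.mem_biUnion.2 ⟨s, hs, hb⟩)
    · rintro rfl
      exact hx' (Finset.mem_biUnion.2 ⟨s, hs, hr⟩)

end IsCycleDecomp
end

section
variable {X : Type*} [DecidableEq X] [Fintype X]

namespace IsCycleSet
variable {σ : Perm X} {s : Finset X}

theorem support_restrictTo (h : IsCycleSet σ s) (hs : 2 ≤ s.card) :
    (restrictTo s σ).support = s := by
  ext x
  rw [mem_support]
  constructor
  · intro hx
    by_contra hxs
    exact hx (restrictTo_apply_of_notMem hxs)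
  · intro hx hx'
    rw [restrictTo_apply_of_mem h.isStable hx] at hx'
    have := Finset.card_le_card (h.subset_of_mem (B := {x})
      (IsStable.of_forall_mem (by simpa using hx')) hx (by simp))
    rw [Finset.card_singleton] at this
    omega

theorem isCycle_restrictTo (h : IsCycleSet σ s) (hs : 2 ≤ s.card) :
    (restrictTo s σ).IsCycle := by
  classical
  obtain ⟨a, ha⟩ := h.nonempty
  have hsupp := h.support_restrictTo hs
  refine ⟨a, by rwa [← mem_support, hsupp], fun y hy => ?_⟩
  rw [← mem_support, hsupp] at hy
  have hst : IsStable (s.filter ((restrictTo s σ).SameCycle a)) σ := by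
    refine IsStable.of_forall_mem fun x hx => ?_
    rw [Finset.mem_filter] at hx ⊢
    refine ⟨(h.isStable x).2 hx.1, ?_⟩
    rw [← restrictTo_apply_of_mem h.isStable hx.1, sameCycle_apply_right]
    exact hx.2
  exact (Finset.mem_filter.1 (h.subset_of_mem hst ha (Finset.mem_filter.2 ⟨ha, .refl _ _⟩) hy)).2

theorem cycleType_restrictTo (h : IsCycleSet σ s) :
    (restrictTo s σ).cycleType = Multiset.filter (2 ≤ ·) {s.card} := by
  by_cases hs : 2 ≤ s.card
  · rw [(h.isCycle_restrictTo hs).cycleType, h.support_restrictTo hs, Multiset.filter_singleton,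
      if_pos hs]
  · have h1 : s.card = 1 := by have := h.nonempty.card_pos; omega
    obtain ⟨a, rfl⟩ := Finset.card_eq_one.1 h1
    rw [restrictTo_eq_one (by simpa using (h.isStable a).2), Multiset.filter_singleton, if_neg hs]
    simp

end IsCycleSet

namespace IsCycleDecomp
variable {σ : Perm X} {K : Finset (Finset X)} {A : Finset X}

theorem cycleType (h : IsCycleDecomp σ K) :
    σ.cycleType = (K.val.map Finset.card).filter (2 ≤ ·) := by
  induction K using Finset.induction_on generalizing σ with
  | empty =>
    have : σ = 1 := by ext x; simpa using h.fix x (by simp)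
    subst this
    simp
  | insert s K hs ih =>
    have hsub : K ⊆ insert s K := Finset.subset_insert _ _
    have hd : Disjoint s (K.biUnion id) := by
      rw [Finset.disjoint_biUnion_right]
      intro t ht
      exact h.disjoint s (Finset.mem_insert_self _ _) t (hsub ht) (by rintro rfl; exact hs ht)
    have hsc := h.isCycleSet s (Finset.mem_insert_self _ _)
    rw [← restrictTo_mul_restrictTo hsc.isStable (h.isStable_biUnion hsub) hd
      (fun x h1 h2 => h.fix x (by rw [Finset.biUnion_insert, Finset.mem_union]; tauto)),
      (disjoint_restrictTo hd).cycleType_mul, hsc.cycleType_restrictTo,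
      ih (h.restrict hsub), Finset.insert_val_of_notMem hs, Multiset.map_cons,
      ← Multiset.singleton_add, Multiset.filter_add]

theorem partition_parts (h : IsCycleDecomp σ K) (hK : K.biUnion id = Finset.univ) :
    σ.partition.parts = K.val.map Finset.card := by
  have hadd := Multiset.filter_add_not (2 ≤ ·) (K.val.map Finset.card)
  have hones : (K.val.map Finset.card).filter (¬ 2 ≤ ·) =
      Multiset.replicate ((K.val.map Finset.card).filter (¬ 2 ≤ ·)).card 1 := by
    refine Multiset.eq_replicate_card.2 fun a ha => ?_
    rw [Multiset.mem_filter] at ha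
    have := h.card_pos ha.1
    omega
  have hsum := congrArg Multiset.sum hadd
  have hcard := h.card_biUnion
  rw [hK, Finset.card_univ] at hcard
  change _ = (K.val.map Finset.card).sum at hcard
  rw [Multiset.sum_add, ← h.cycleType, sum_cycleType, hones, Multiset.sum_replicate,
    smul_eq_mul, mul_one, ← hcard] at hsum
  rw [parts_partition, ← hadd, ← h.cycleType, hones, ← hsum, Nat.add_sub_cancel_left]

end IsCycleDecomp

theorem exists_isCycleDecomp_univ (σ : Perm X) :
    ∃ K, IsCycleDecomp σ K ∧ K.biUnion id = Finset.univ := by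
  induction σ using Equiv.Perm.swap_induction_on with
  | one =>
    refine ⟨Finset.univ.image fun x => {x}, ⟨?_, ?_, fun _ _ => rfl⟩, ?_⟩
    · simp only [Finset.mem_image, Finset.mem_univ, true_and, forall_exists_index,
        forall_apply_eq_imp_iff]
      exact fun x => ⟨x, [], by simp, rfl, by simp⟩
    · simp only [Finset.mem_image, Finset.mem_univ, true_and, forall_exists_index,
        forall_apply_eq_imp_iff]
      intro x y hxy
      simpa using fun h => hxy (by rw [h])
    · ext x
      simp
  | swap_mul σ b r hbr ih =>
    obtain ⟨K, h, hK⟩ := ih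
    have hmem : ∀ x, ∃ s ∈ K, x ∈ s := fun x => by
      simpa using (hK ▸ Finset.mem_univ x : x ∈ K.biUnion id)
    obtain ⟨s, hs, hr⟩ := hmem r
    obtain ⟨t, ht, hb⟩ := hmem b
    by_cases hst : s = t
    · subst hst
      obtain ⟨l, hl, hp, rfl⟩ := (h.isCycleSet s hs).exists_of_mem hr
      have hbl : b ∈ l := by simpa [hbr] using hb
      obtain ⟨w, v, rfl⟩ := List.append_of_mem hbl
      refine ⟨_, h.cut hl hp hs, ?_⟩
      rw [Finset.biUnion_insert, Finset.biUnion_insert, ← Finset.union_assoc, id, id,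
        ← List.toFinset_append, List.cons_append]
      rw [← hK]
      conv_rhs => rw [← Finset.insert_erase hs, Finset.biUnion_insert]
      rfl
    · refine ⟨_, h.join hs ht hst hr hb, ?_⟩
      rw [← hK]
      conv_rhs => rw [← Finset.insert_erase hs, Finset.biUnion_insert,
        ← Finset.insert_erase (Finset.mem_erase.2 ⟨Ne.symm hst, ht⟩), Finset.biUnion_insert]
      rw [Finset.biUnion_insert, id, id, id, Finset.union_assoc]

/-- The least number of transpositions with product `g`. -/
def reflectionLength (g : Perm X) : ℕ := (g.cycleType.map (· - 1)).sum

theorem reflectionLength_one : reflectionLength (1 : Perm X) = 0 := by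
  simp [reflectionLength]

theorem Equiv.Perm.Disjoint.reflectionLength_mul {g h : Perm X} (hgh : g.Disjoint h) :
    reflectionLength (g * h) = reflectionLength g + reflectionLength h := by
  rw [reflectionLength, hgh.cycleType_mul, Multiset.map_add, Multiset.sum_add]
  rfl

theorem IsCycleDecomp.reflectionLength_add_card {σ : Perm X} {K : Finset (Finset X)}
    (h : IsCycleDecomp σ K) : reflectionLength σ + K.card = (K.biUnion id).card := by
  have aux : ∀ M : Multiset ℕ, (∀ a ∈ M, 1 ≤ a) →
      ((M.filter (2 ≤ ·)).map (· - 1)).sum + M.card = M.sum := by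
    intro M
    induction M using Multiset.induction_on with
    | empty => simp
    | cons a M ih =>
      intro hM
      have ha := hM a (Multiset.mem_cons_self _ _)
      have := ih fun b hb => hM b (Multiset.mem_cons_of_mem hb)
      rw [Multiset.sum_cons, Multiset.card_cons, ← this]
      by_cases h2 : 2 ≤ a
      · rw [Multiset.filter_cons_of_pos (p := (2 ≤ ·)) _ h2, Multiset.map_cons, Multiset.sum_cons]
        omega
      · rw [Multiset.filter_cons_of_neg (p := (2 ≤ ·)) _ h2]
        omega
  rw [h.card_biUnion, reflectionLength, h.cycleType]
  have := aux _ fun a => h.card_pos (a := a)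
  rwa [Multiset.card_map] at this

theorem reflectionLength_eq_sub (σ : Perm X) :
    reflectionLength σ = Fintype.card X - σ.partition.parts.card := by
  obtain ⟨K, h, hK⟩ := exists_isCycleDecomp_univ σ
  rw [h.partition_parts hK, Multiset.card_map, ← Finset.card_univ, ← hK,
    ← h.reflectionLength_add_card, Finset.card_val, Nat.add_sub_cancel]

theorem reflectionLength_swap_mul {π : Perm X} {a r : X} (hr : π r = r) (ha : a ≠ r) :
    reflectionLength (swap a r * π) = reflectionLength π + 1 := by
  obtain ⟨K, h, hK⟩ := exists_isCycleDecomp_univ π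
  have hmem : ∀ x, ∃ s ∈ K, x ∈ s := fun x => by
    simpa using (hK ▸ Finset.mem_univ x : x ∈ K.biUnion id)
  obtain ⟨s, hs, hrs⟩ := hmem r
  obtain ⟨t, ht, hat⟩ := hmem a
  have hst : s ≠ t := by
    rintro rfl
    have := (h.isCycleSet s hs).subset_of_mem (B := {r})
      (IsStable.of_forall_mem (by simpa using hr)) hrs (by simp) hat
    exact ha (by simpa using this)
  have hj := h.join hs ht hst hrs hat
  have hts : t ∈ K.erase s := Finset.mem_erase.2 ⟨hst.symm, ht⟩
  have hnot : s ∪ t ∉ (K.erase s).erase t := by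
    intro hmem
    rw [Finset.mem_erase, Finset.mem_erase] at hmem
    exact hmem.2.1 (h.eq_of_mem hmem.2.2 hs (Finset.mem_union_left _ hrs) hrs)
  have hun : (insert (s ∪ t) ((K.erase s).erase t)).biUnion id = K.biUnion id := by
    conv_rhs => rw [← Finset.insert_erase hs, Finset.biUnion_insert,
      ← Finset.insert_erase hts, Finset.biUnion_insert]
    rw [Finset.biUnion_insert, id, id, id, Finset.union_assoc]
  have h1 := h.reflectionLength_add_card
  have h2 := hj.reflectionLength_add_card
  rw [hun, Finset.card_insert_of_notMem hnot] at h2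
  have h3 := Finset.card_erase_add_one hts
  have h4 := Finset.card_erase_add_one hs
  omega

end

section
variable {X : Type*} [DecidableEq X]

/-- Move all the factors to permutations fixing `r`, recording in a second list the points
`b` of the star transpositions `(b r)` that this produces, collected at the left. -/
def collectRoot (r : X) : List (Perm X) → List (Perm X) × List X
  | [] => ([], [])
  | π :: F =>
    ((swap (π r) r * π) :: (collectRoot r F).1,
      π r :: (collectRoot r F).2.map (swap (π r) r * π))

/-- The inverse of `collectRoot`. -/
def distributeRoot (r : X) : List (Perm X) → List X → List (Perm X)
  | [], _ => []
  | _ :: _, [] => []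
  | π :: F, a :: bs => (swap a r * π) :: distributeRoot r F (bs.map ⇑π⁻¹)

variable {r : X}

theorem swap_mul_apply_root (π : Perm X) : (swap (π r) r * π) r = r := by
  rw [Perm.mul_apply, swap_apply_left]

theorem map_swap_prod_comm {π : Perm X} (hπ : π r = r) (bs : List X) :
    ((bs.map π).map (swap · r)).prod * π = π * (bs.map (swap · r)).prod := by
  induction bs with
  | nil => simp
  | cons b bs ih =>
    rw [List.map_cons, List.map_cons, List.map_cons, List.prod_cons, List.prod_cons, mul_assoc, ih,
      ← mul_assoc, ← mul_assoc, mul_swap_eq_swap_mul, hπ]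

theorem distributeRoot_collectRoot (F : List (Perm X)) :
    distributeRoot r (collectRoot r F).1 (collectRoot r F).2 = F := by
  induction F with
  | nil => rfl
  | cons π F ih =>
    rw [collectRoot, distributeRoot, List.map_map]
    rw [← mul_assoc, swap_mul_self, one_mul]
    have : ⇑(swap (π r) r * π)⁻¹ ∘ ⇑(swap (π r) r * π) = id := by
      ext x; simp
    rw [this, List.map_id, ih]

theorem collectRoot_distributeRoot {F : List (Perm X)} {bs : List X}
    (hlen : bs.length = F.length) (hF : ∀ g ∈ F, g r = r) :
    collectRoot r (distributeRoot r F bs) = (F, bs) := by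
  induction F generalizing bs with
  | nil =>
    rw [List.length_nil, List.length_eq_zero_iff] at hlen
    rw [hlen]
    rfl
  | cons π F ih =>
    rw [List.forall_mem_cons] at hF
    obtain _ | ⟨a, bs⟩ := bs
    · simp at hlen
    have ih' := ih (bs := bs.map ⇑π⁻¹) (by simpa using hlen) hF.2
    have hr : (swap a r * π) r = a := by rw [Perm.mul_apply, hF.1, swap_apply_right]
    rw [distributeRoot, collectRoot, ih', hr, ← mul_assoc, swap_mul_self, one_mul, List.map_map]
    have : ⇑π ∘ ⇑π⁻¹ = id := by
      ext x; simp
    rw [this, List.map_id]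

theorem collectRoot_fst_length (F : List (Perm X)) : (collectRoot r F).1.length = F.length := by
  induction F with
  | nil => rfl
  | cons π F ih => simp [collectRoot, ih]

theorem collectRoot_snd_length (F : List (Perm X)) : (collectRoot r F).2.length = F.length := by
  induction F with
  | nil => rfl
  | cons π F ih => simp [collectRoot, ih]

theorem collectRoot_apply_root (F : List (Perm X)) : ∀ g ∈ (collectRoot r F).1, g r = r := by
  induction F with
  | nil => simp [collectRoot]
  | cons π F ih =>
    rw [collectRoot, List.forall_mem_cons]
    exact ⟨swap_mul_apply_root π, ih⟩

theorem collectRoot_prod (F : List (Perm X)) :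
    ((collectRoot r F).2.map (swap · r)).prod * (collectRoot r F).1.prod = F.prod := by
  induction F with
  | nil => simp [collectRoot]
  | cons π F ih =>
    rw [collectRoot, List.map_cons, List.prod_cons, List.prod_cons, mul_assoc,
      ← mul_assoc _ (swap (π r) r * π), map_swap_prod_comm (swap_mul_apply_root π), mul_assoc, ih,
      ← mul_assoc, ← mul_assoc, swap_mul_self, one_mul, List.prod_cons]

theorem collectRoot_isStable {B : Finset X} (hr : r ∈ B) (F : List (Perm X)) :
    ((∀ b ∈ (collectRoot r F).2, b ∈ B) ∧ ∀ g ∈ (collectRoot r F).1, IsStable B g) ↔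
      ∀ g ∈ F, IsStable B g := by
  induction F with
  | nil => simp [collectRoot]
  | cons π F ih =>
    rw [collectRoot, List.forall_mem_cons, List.forall_mem_cons, List.forall_mem_cons, ← ih]
    have hkey : IsStable B π ↔ π r ∈ B ∧ IsStable B (swap (π r) r * π) := by
      constructor
      · intro h
        have h' := (h r).2 hr
        exact ⟨h', (IsStable.swap h' hr).mul h⟩
      · rintro ⟨h1, h2⟩
        have := (IsStable.swap h1 hr).mul h2
        rwa [← mul_assoc, swap_mul_self, one_mul] at this
    rw [hkey, List.forall_mem_map]
    constructor
    · rintro ⟨⟨h1, h2⟩, h3, h4⟩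
      exact ⟨⟨h1, h3⟩, fun b hb => (h3 b).1 (h2 b hb), h4⟩
    · rintro ⟨⟨h1, h3⟩, h2, h4⟩
      exact ⟨⟨h1, fun b hb => (h3 b).2 (h2 b hb)⟩, h3, h4⟩

theorem collectRoot_fix {A : Finset X} (hr : r ∈ A) (F : List (Perm X)) :
    ((∀ b ∈ (collectRoot r F).2, b ∈ A) ∧ ∀ g ∈ (collectRoot r F).1, ∀ x ∉ A, g x = x) ↔
      ∀ g ∈ F, ∀ x ∉ A, g x = x := by
  have hfix : ∀ {a : X} {π : Perm X}, a ∈ A → (∀ x ∉ A, π x = x) →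
      ∀ x ∉ A, (swap a r * π) x = x := by
    intro a π ha hπ x hx
    rw [Perm.mul_apply, hπ x hx, swap_apply_of_ne_of_ne] <;> rintro rfl <;> exact hx ‹_›
  induction F with
  | nil => simp [collectRoot]
  | cons π F ih =>
    rw [collectRoot, List.forall_mem_cons, List.forall_mem_cons, List.forall_mem_cons]
    refine Iff.trans ?_ (and_congr_right fun _ => ih)
    have hkey : (∀ x ∉ A, π x = x) ↔ π r ∈ A ∧ ∀ x ∉ A, (swap (π r) r * π) x = x := by
      constructor
      · intro h
        have h' := (IsStable.of_fix h r).2 hr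
        exact ⟨h', hfix h' h⟩
      · rintro ⟨h1, h2⟩
        have := hfix h1 h2
        rwa [← mul_assoc, swap_mul_self, one_mul] at this
    rw [hkey, List.forall_mem_map]
    constructor
    · rintro ⟨⟨h1, h2⟩, h3, h4⟩
      exact ⟨⟨h1, h3⟩, fun b hb => (IsStable.of_fix h3 b).1 (h2 b hb), h4⟩
    · rintro ⟨⟨h1, h3⟩, h2, h4⟩
      exact ⟨⟨h1, fun b hb => (IsStable.of_fix h3 b).2 (h2 b hb)⟩, h3, h4⟩

variable [Fintype X]

theorem collectRoot_reflectionLength (F : List (Perm X)) :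
    ((collectRoot r F).1.map reflectionLength).sum +
      ((collectRoot r F).2.filter (· ≠ r)).length = (F.map reflectionLength).sum := by
  induction F with
  | nil => simp [collectRoot]
  | cons π F ih =>
    have hπ := swap_mul_apply_root (r := r) π
    have hmap : (((collectRoot r F).2.map ⇑(swap (π r) r * π)).filter (· ≠ r)).length =
        ((collectRoot r F).2.filter (· ≠ r)).length := by
      rw [List.filter_map, List.length_map]
      congr 2
      ext x
      have : (swap (π r) r * π) x = r ↔ x = r :=
        (swap (π r) r * π).injective.eq_iff' hπ
      simp only [Function.comp_apply, ne_eq, this]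
    rw [collectRoot, List.map_cons, List.sum_cons, List.map_cons, List.sum_cons, ← ih]
    by_cases ha : π r = r
    · have hone : swap (π r) r * π = π := by rw [ha, swap_self]; rfl
      rw [List.filter_cons_of_neg (by simpa using ha), hmap, hone]
      omega
    · rw [List.filter_cons_of_pos (by simpa using ha), List.length_cons, hmap]
      have := reflectionLength_swap_mul hπ ha
      rw [← mul_assoc, swap_mul_self, one_mul] at this
      rw [this]
      omega

/-- `σ` is the product of the star transpositions `(b r)`, for `b` in `bs`, and of the `m`
permutations in `F`; all of them act on `A`, transitively, and have total length `S`. -/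
structure IsFactorization (A : Finset X) (r : X) (m : ℕ) (σ : Perm X) (S : ℕ)
    (F : List (Perm X)) (bs : List X) : Prop where
  length : F.length = m
  fix : ∀ g ∈ F, ∀ x ∉ A, g x = x
  mem : ∀ b ∈ bs, b ∈ A
  prod : (bs.map (swap · r)).prod * F.prod = σ
  sum : (F.map reflectionLength).sum + (bs.filter (· ≠ r)).length = S
  subset : ∀ B : Finset X, r ∈ B → (∀ b ∈ bs, b ∈ B) → (∀ g ∈ F, IsStable B g) → A ⊆ B

/-- The factorizations with `i` star transpositions whose other factors all fix `r`. -/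
def rootedFactorizations (A : Finset X) (r : X) (m : ℕ) (σ : Perm X) (S i : ℕ) :
    Set (List (Perm X) × List X) :=
  {p | IsFactorization A r m σ S p.1 p.2 ∧ p.2.length = i ∧ ∀ g ∈ p.1, g r = r}

/-- The factorizations into permutations, without star transpositions. -/
def plainFactorizations (A : Finset X) (r : X) (m : ℕ) (σ : Perm X) (S : ℕ) :
    Set (List (Perm X)) :=
  {F | IsFactorization A r m σ S F []}

theorem isFactorization_collectRoot {A : Finset X} {m S : ℕ} {σ : Perm X} (hr : r ∈ A)
    (F : List (Perm X)) :
    IsFactorization A r m σ S (collectRoot r F).1 (collectRoot r F).2 ↔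
      IsFactorization A r m σ S F [] := by
  have hsub (B : Finset X) (hB : r ∈ B) := collectRoot_isStable hB F
  have hfix := collectRoot_fix hr F
  constructor
  · intro h
    refine ⟨?_, hfix.1 ⟨h.mem, h.fix⟩, by simp, ?_, ?_, fun B hB _ hF => ?_⟩
    · rw [← h.length, collectRoot_fst_length]
    · rw [← h.prod, collectRoot_prod, List.map_nil, List.prod_nil, one_mul]
    · rw [← h.sum, collectRoot_reflectionLength]
      rfl
    · obtain ⟨h1, h2⟩ := (hsub B hB).2 hF
      exact h.subset B hB h1 h2
  · intro h
    obtain ⟨h1, h2⟩ := hfix.2 h.fix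
    refine ⟨?_, h2, h1, ?_, ?_, fun B hB hb hF => h.subset B hB (by simp) ((hsub B hB).1 ⟨hb, hF⟩)⟩
    · rw [← h.length, collectRoot_fst_length]
    · rw [← h.prod, collectRoot_prod, List.map_nil, List.prod_nil, one_mul]
    · rw [← h.sum, collectRoot_reflectionLength]
      rfl

theorem card_plainFactorizations {A : Finset X} {m S : ℕ} {σ : Perm X} (hr : r ∈ A) :
    Nat.card (plainFactorizations A r m σ S) = Nat.card (rootedFactorizations A r m σ S m) := by
  refine Nat.card_congr ⟨fun F => ⟨collectRoot r F.1, ?_, ?_, ?_⟩, fun p =>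
    ⟨distributeRoot r p.1.1 p.1.2, ?_⟩,
    fun F => ?_, fun p => ?_⟩
  · exact (isFactorization_collectRoot hr F.1).2 F.2
  · rw [collectRoot_snd_length, F.2.length]
  · exact collectRoot_apply_root F.1
  · obtain ⟨p, h1, h2, h3⟩ := p
    have := collectRoot_distributeRoot (h2.trans h1.length.symm) h3
    refine (isFactorization_collectRoot hr _).1 ?_
    rw [this]
    exact h1
  · exact Subtype.ext (distributeRoot_collectRoot F.1)
  · exact Subtype.ext (collectRoot_distributeRoot (p.2.2.1.trans p.2.1.length.symm) p.2.2.2)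

end

section
variable {X : Type*}

/-- The points of `A` that can be reached from `r` and `bs` by the permutations in `F`. -/
noncomputable def reachable (A : Finset X) (r : X) (F : List (Perm X)) (bs : List X) : Finset X :=
  open Classical in
  A.filter fun x => ∀ B : Finset X, r ∈ B → (∀ b ∈ bs, b ∈ B) → (∀ g ∈ F, IsStable B g) → x ∈ B

section reachable
variable {A B : Finset X} {r x : X} {F : List (Perm X)} {bs : List X}

theorem mem_reachable : x ∈ reachable A r F bs ↔ x ∈ A ∧
    ∀ B : Finset X, r ∈ B → (∀ b ∈ bs, b ∈ B) → (∀ g ∈ F, IsStable B g) → x ∈ B := by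
  classical
  rw [reachable, Finset.mem_filter]

theorem reachable_subset : reachable A r F bs ⊆ A := fun _ hx => (mem_reachable.1 hx).1

theorem reachable_subset_of_isStable (hr : r ∈ B) (hb : ∀ b ∈ bs, b ∈ B)
    (hF : ∀ g ∈ F, IsStable B g) : reachable A r F bs ⊆ B :=
  fun _ hx => (mem_reachable.1 hx).2 B hr hb hF

theorem root_mem_reachable (hr : r ∈ A) : r ∈ reachable A r F bs :=
  mem_reachable.2 ⟨hr, fun _ hr _ _ => hr⟩

theorem mem_reachable_of_mem (hb : ∀ b ∈ bs, b ∈ A) : ∀ b ∈ bs, b ∈ reachable A r F bs :=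
  fun b hbs => mem_reachable.2 ⟨hb b hbs, fun _ _ h _ => h b hbs⟩

theorem isStable_reachable (hF : ∀ g ∈ F, ∀ x ∉ A, g x = x) :
    ∀ g ∈ F, IsStable (reachable A r F bs) g := fun g hg => by
  refine IsStable.of_forall_mem fun x hx => ?_
  rw [mem_reachable] at hx ⊢
  exact ⟨(IsStable.of_fix (hF g hg) x).2 hx.1,
    fun B h1 h2 h3 => (h3 g hg x).2 (hx.2 B h1 h2 h3)⟩

end reachable

variable [DecidableEq X]

theorem isStable_star_prod {B : Finset X} {r : X} {bs : List X} (hr : r ∈ B)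
    (hb : ∀ b ∈ bs, b ∈ B) : IsStable B (bs.map (swap · r)).prod := by
  refine IsStable.list_prod fun g hg => ?_
  obtain ⟨b, hbs, rfl⟩ := List.mem_map.1 hg
  exact IsStable.swap (hb b hbs) hr

theorem restrictTo_star_prod {B : Finset X} {r : X} {bs : List X} (hr : r ∈ B)
    (hb : ∀ b ∈ bs, b ∈ B) :
    restrictTo B (bs.map (swap · r)).prod = (bs.map (swap · r)).prod := by
  refine restrictTo_eq_self fun x hx => ?_
  induction bs with
  | nil => rfl
  | cons b bs ih =>
    rw [List.forall_mem_cons] at hb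
    rw [List.map_cons, List.prod_cons, Perm.mul_apply, ih hb.2, swap_apply_of_ne_of_ne] <;>
      rintro rfl
    · exact hx hb.1
    · exact hx hr

theorem star_prod_cons_iff {r b : X} {bs : List X} {F : List (Perm X)} {σ : Perm X} :
    ((b :: bs).map (swap · r)).prod * F.prod = σ ↔
      (bs.map (swap · r)).prod * F.prod = swap b r * σ := by
  rw [List.map_cons, List.prod_cons, mul_assoc]
  constructor
  · rintro rfl
    rw [← mul_assoc, swap_mul_self, one_mul]
  · intro h
    rw [h, ← mul_assoc, swap_mul_self, one_mul]

namespace IsFactorization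
variable [Fintype X] {A C D : Finset X} {r b : X} {m S S' S'' : ℕ} {σ σ' σ'' : Perm X}
  {F F1 F2 : List (Perm X)} {bs : List X}

theorem cons_self_iff (hr : r ∈ A) :
    IsFactorization A r m σ S F (r :: bs) ↔ IsFactorization A r m σ S F bs := by
  have hprod : ((r :: bs).map (swap · r)).prod = (bs.map (swap · r)).prod := by
    rw [List.map_cons, List.prod_cons, swap_self]
    exact one_mul _
  have hfilter : (r :: bs).filter (· ≠ r) = bs.filter (· ≠ r) :=
    List.filter_cons_of_neg (by simp)
  constructor
  · intro h
    exact ⟨h.length, h.fix, (List.forall_mem_cons.1 h.mem).2, hprod ▸ h.prod, hfilter ▸ h.sum,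
      fun B hB hb => h.subset B hB (List.forall_mem_cons.2 ⟨hB, hb⟩)⟩
  · intro h
    exact ⟨h.length, h.fix, List.forall_mem_cons.2 ⟨hr, h.mem⟩, hprod ▸ h.prod, hfilter ▸ h.sum,
      fun B hB hb => h.subset B hB (List.forall_mem_cons.1 hb).2⟩

theorem cons (hbA : b ∈ A) (hbr : b ≠ r)
    (h : IsFactorization A r m (swap b r * σ) S F bs) :
    IsFactorization A r m σ (S + 1) F (b :: bs) := by
  refine ⟨h.length, h.fix, List.forall_mem_cons.2 ⟨hbA, h.mem⟩, star_prod_cons_iff.2 h.prod, ?_,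
    fun B hB hb => h.subset B hB (List.forall_mem_cons.1 hb).2⟩
  rw [List.filter_cons_of_pos (by simpa using hbr), List.length_cons, ← h.sum, add_assoc]

theorem of_cons (hbr : b ≠ r) (h : IsFactorization A r m σ S F (b :: bs))
    (hb : b ∈ reachable A r F bs) :
    ∃ S', S' + 1 = S ∧ IsFactorization A r m (swap b r * σ) S' F bs := by
  have hs := h.sum
  rw [List.filter_cons_of_pos (by simpa using hbr), List.length_cons, ← add_assoc] at hs
  exact ⟨_, hs, h.length, h.fix, (List.forall_mem_cons.1 h.mem).2, star_prod_cons_iff.1 h.prod, rfl,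
    fun B hB hbs hF => h.subset B hB
      (List.forall_mem_cons.2 ⟨(mem_reachable.1 hb).2 B hB hbs hF, hbs⟩) hF⟩

theorem sum_reflectionLength_restrictTo (hCD : Disjoint C D) (hC : ∀ g ∈ F, IsStable C g)
    (hD : ∀ g ∈ F, IsStable D g) (hF : ∀ g ∈ F, ∀ x, x ∉ C → x ∉ D → g x = x) :
    ((F.map (restrictTo C)).map reflectionLength).sum +
      ((F.map (restrictTo D)).map reflectionLength).sum = (F.map reflectionLength).sum := by
  induction F with
  | nil => rfl
  | cons g F ih =>
    rw [List.forall_mem_cons] at hC hD hF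
    simp only [List.map_cons, List.sum_cons]
    rw [← ih hC.2 hD.2 hF.2]
    conv_rhs => rw [← restrictTo_mul_restrictTo hC.1 hD.1 hCD hF.1,
      (disjoint_restrictTo hCD).reflectionLength_mul]
    omega

theorem split (hr : r ∈ A) (hbr : b ≠ r) (h : IsFactorization A r m σ S F (b :: bs))
    (hb : b ∉ reachable A r F bs) (hC : C = reachable A r F bs) :
    ∃ S' S'', S' + S'' + 1 = S ∧
      IsFactorization C r m (restrictTo C (swap b r * σ)) S' (F.map (restrictTo C)) bs ∧
      IsFactorization (A \ C) b m (restrictTo (A \ C) (swap b r * σ)) S''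
        (F.map (restrictTo (A \ C))) [] := by
  have hbs := (List.forall_mem_cons.1 h.mem).2
  have hCA : C ⊆ A := hC ▸ reachable_subset
  have hrC : r ∈ C := hC ▸ root_mem_reachable hr
  have hbC : ∀ b ∈ bs, b ∈ C := hC ▸ mem_reachable_of_mem hbs
  have hFC : ∀ g ∈ F, IsStable C g := hC ▸ isStable_reachable h.fix
  have hFA : ∀ g ∈ F, IsStable A g := fun g hg => IsStable.of_fix (h.fix g hg)
  have hFD : ∀ g ∈ F, IsStable (A \ C) g := fun g hg => (hFA g hg).sdiff (hFC g hg)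
  have hd : Disjoint C (A \ C) := Finset.disjoint_sdiff
  have hprod := star_prod_cons_iff.1 h.prod
  have hs := h.sum
  rw [List.filter_cons_of_pos (by simpa using hbr), List.length_cons,
    ← sum_reflectionLength_restrictTo hd hFC hFD (fun g hg x h1 h2 => h.fix g hg x fun h3 =>
      h2 (Finset.mem_sdiff.2 ⟨h3, h1⟩))] at hs
  have hstar := isStable_star_prod hrC hbC
  have hstar' : ∀ x ∈ A \ C, (bs.map (swap · r)).prod x = x := fun x hx => by
    rw [← restrictTo_star_prod hrC hbC]
    exact restrictTo_apply_of_notMem (Finset.mem_sdiff.1 hx).2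
  refine ⟨_, ((F.map (restrictTo (A \ C))).map reflectionLength).sum, ?_,
    ⟨by rw [List.length_map, h.length], ?_, hbC, ?_, rfl, ?_⟩,
    ⟨by rw [List.length_map, h.length], ?_, by simp, ?_, rfl, ?_⟩⟩
  · omega
  · rw [List.forall_mem_map]
    exact fun g _ x hx => restrictTo_apply_of_notMem hx
  · rw [← hprod, restrictTo_mul hstar (IsStable.list_prod hFC), restrictTo_list_prod hFC,
      restrictTo_star_prod hrC hbC]
  · intro B hB hbB hFB
    rw [List.forall_mem_map] at hFB
    rw [hC]
    refine (reachable_subset_of_isStable (B := B ∩ C) (Finset.mem_inter.2 ⟨hB, hrC⟩)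
      (fun b hb => Finset.mem_inter.2 ⟨hbB b hb, hbC b hb⟩) fun g hg => ?_).trans
        Finset.inter_subset_left
    refine IsStable.of_forall_mem fun x hx => ?_
    rw [Finset.mem_inter] at hx ⊢
    rw [← restrictTo_apply_of_mem (hFC g hg) hx.2]
    exact ⟨(hFB g hg x).2 hx.1,
      by rw [restrictTo_apply_of_mem (hFC g hg) hx.2]; exact (hFC g hg x).2 hx.2⟩
  · rw [List.forall_mem_map]
    exact fun g _ x hx => restrictTo_apply_of_notMem hx
  · rw [← hprod, restrictTo_mul (IsStable.of_forall_mem fun x hx => by rwa [hstar' x hx])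
      (IsStable.list_prod hFD), restrictTo_list_prod hFD, restrictTo_eq_one hstar']
    rfl
  · intro B hB _ hFB
    rw [List.forall_mem_map] at hFB
    have hsub := h.subset (C ∪ (B ∩ (A \ C))) (Finset.mem_union_left _ hrC) ?_ fun g hg => ?_
    · intro x hx
      have := hsub (Finset.mem_sdiff.1 hx).1
      rw [Finset.mem_union, Finset.mem_inter] at this
      exact (this.resolve_left (Finset.mem_sdiff.1 hx).2).1
    · rw [List.forall_mem_cons]
      refine ⟨Finset.mem_union_right _ (Finset.mem_inter.2 ⟨hB, Finset.mem_sdiff.2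
        ⟨(List.forall_mem_cons.1 h.mem).1, hC ▸ hb⟩⟩), fun x hx =>
          Finset.mem_union_left _ (hbC x hx)⟩
    · refine (hFC g hg).union (IsStable.of_forall_mem fun x hx => ?_)
      rw [Finset.mem_inter] at hx ⊢
      rw [← restrictTo_apply_of_mem (hFD g hg) hx.2]
      exact ⟨(hFB g hg x).2 hx.1,
        by rw [restrictTo_apply_of_mem (hFD g hg) hx.2]; exact (hFD g hg x).2 hx.2⟩

end IsFactorization

section glue
variable {C D : Finset X}

theorem commute_of_fix {g h : Perm X} (hCD : Disjoint C D) (hg : ∀ x ∉ C, g x = x)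
    (hh : ∀ x ∉ D, h x = x) : Commute g h := by
  refine Perm.Disjoint.commute fun x => ?_
  by_cases hx : x ∈ C
  · exact Or.inr (hh x (Finset.disjoint_left.1 hCD hx))
  · exact Or.inl (hg x hx)

theorem zipWith_induction {F1 F2 : List (Perm X)} (hlen : F1.length = F2.length)
    (h1 : ∀ g ∈ F1, ∀ x ∉ C, g x = x) (h2 : ∀ g ∈ F2, ∀ x ∉ D, g x = x) (hCD : Disjoint C D) :
    (List.zipWith (· * ·) F1 F2).prod = F1.prod * F2.prod ∧
      (List.zipWith (· * ·) F1 F2).map (restrictTo C) = F1 ∧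
      (List.zipWith (· * ·) F1 F2).map (restrictTo D) = F2 ∧
      ∀ f ∈ List.zipWith (· * ·) F1 F2, ∃ g h, f = g * h ∧ g ∈ F1 ∧ h ∈ F2 := by
  induction F1 generalizing F2 with
  | nil =>
    obtain rfl : F2 = [] := List.length_eq_zero_iff.1 hlen.symm
    simp
  | cons g F1 ih =>
    obtain _ | ⟨h, F2⟩ := F2
    · simp at hlen
    rw [List.forall_mem_cons] at h1 h2
    obtain ⟨i1, i2, i3, i4⟩ := ih (by simpa using hlen) h1.2 h2.2
    rw [List.zipWith_cons_cons]
    refine ⟨?_, ?_, ?_, ?_⟩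
    · rw [List.prod_cons, List.prod_cons, List.prod_cons, i1, mul_assoc, mul_assoc,
        ← mul_assoc h, ← mul_assoc F1.prod, (commute_of_fix hCD (fix_list_prod h1.2) h2.1).eq]
    · rw [List.map_cons, i2, restrictTo_mul_eq_left hCD h1.1 h2.1]
    · rw [List.map_cons, i3, (commute_of_fix hCD h1.1 h2.1).eq,
        restrictTo_mul_eq_left hCD.symm h2.1 h1.1]
    · rw [List.forall_mem_cons]
      refine ⟨⟨g, h, rfl, by simp, by simp⟩, fun f hf => ?_⟩
      obtain ⟨g', h', rfl, hg, hh⟩ := i4 f hf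
      exact ⟨g', h', rfl, List.mem_cons_of_mem _ hg, List.mem_cons_of_mem _ hh⟩

theorem isStable_zipWith {F1 F2 : List (Perm X)} (h1 : ∀ g ∈ F1, ∀ x ∉ C, g x = x)
    (h2 : ∀ g ∈ F2, ∀ x ∉ D, g x = x)
    (hlen : F1.length = F2.length) (hCD : Disjoint C D) :
    ∀ f ∈ List.zipWith (· * ·) F1 F2, IsStable C f := fun f hf => by
  obtain ⟨g, h, rfl, hg, hh⟩ := (zipWith_induction hlen h1 h2 hCD).2.2.2 f hf
  refine (IsStable.of_fix (h1 g hg)).mul (IsStable.of_forall_mem fun x hx => ?_)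
  rwa [h2 h hh x (Finset.disjoint_left.1 hCD hx)]

end glue

namespace IsFactorization
variable [Fintype X] {A C D : Finset X} {r b : X} {m S S' S'' : ℕ} {σ' σ'' : Perm X}
  {F1 F2 : List (Perm X)} {bs : List X}

theorem glue (hCD : Disjoint C D) (hr : r ∈ C) (hb : b ∈ D)
    (h1 : IsFactorization C r m σ' S' F1 bs) (h2 : IsFactorization D b m σ'' S'' F2 []) :
    IsFactorization (C ∪ D) r m (swap b r * (σ' * σ'')) (S' + S'' + 1)
      (List.zipWith (· * ·) F1 F2) (b :: bs) := by
  have hlen := h1.length.trans h2.length.symm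
  obtain ⟨hprod, hC, hD, hmem⟩ := zipWith_induction hlen h1.fix h2.fix hCD
  have hstC := isStable_zipWith h1.fix h2.fix hlen hCD
  have hstD : ∀ f ∈ List.zipWith (· * ·) F1 F2, IsStable D f := fun f hf => by
    obtain ⟨g, h, rfl, hg, hh⟩ := hmem f hf
    refine IsStable.mul (IsStable.of_forall_mem fun x hx => ?_) (IsStable.of_fix (h2.fix h hh))
    rwa [h1.fix g hg x (Finset.disjoint_right.1 hCD hx)]
  have hfix : ∀ f ∈ List.zipWith (· * ·) F1 F2, ∀ x, x ∉ C → x ∉ D → f x = x := by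
    intro f hf x hxC hxD
    obtain ⟨g, h, rfl, hg, hh⟩ := hmem f hf
    rw [Perm.mul_apply, h2.fix h hh x hxD, h1.fix g hg x hxC]
  have hbr : b ≠ r := by rintro rfl; exact Finset.disjoint_left.1 hCD hr hb
  refine ⟨?_, ?_, ?_, ?_, ?_, ?_⟩
  · rw [List.length_zipWith, h1.length, h2.length, min_self]
  · intro f hf x hx
    rw [Finset.mem_union, not_or] at hx
    exact hfix f hf x hx.1 hx.2
  · rw [List.forall_mem_cons]
    exact ⟨Finset.mem_union_right _ hb, fun x hx => Finset.mem_union_left _ (h1.mem x hx)⟩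
  · rw [star_prod_cons_iff, hprod, ← mul_assoc, ← mul_assoc, swap_mul_self, one_mul, h1.prod,
      ← h2.prod,
      List.map_nil, List.prod_nil, one_mul]
  · rw [List.filter_cons_of_pos (by simpa using hbr), List.length_cons, ← h1.sum, ← h2.sum,
      ← sum_reflectionLength_restrictTo hCD hstC hstD hfix, hC, hD, List.filter_nil,
        List.length_nil]
    omega
  · intro B hB hbB hFB
    rw [List.forall_mem_cons] at hbB
    refine Finset.union_subset (h1.subset B hB hbB.2 fun g hg => ?_)
      (h2.subset B hbB.1 (by simp) fun g hg => ?_)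
    · rw [← hC] at hg
      obtain ⟨f, hf, rfl⟩ := List.mem_map.1 hg
      exact isStable_restrictTo (hstC f hf) (hFB f hf)
    · rw [← hD] at hg
      obtain ⟨f, hf, rfl⟩ := List.mem_map.1 hg
      exact isStable_restrictTo (hstD f hf) (hFB f hf)

/-- The first of two factorizations glued together is determined by the result. -/
theorem reachable_zipWith (hCD : Disjoint C D) (hA : A = C ∪ D) (hr : r ∈ C)
    (h1 : IsFactorization C r m σ' S' F1 bs) (hlen : F2.length = m)
    (h2 : ∀ g ∈ F2, ∀ x ∉ D, g x = x) :
    reachable A r (List.zipWith (· * ·) F1 F2) bs = C := by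
  have hlen := h1.length.trans hlen.symm
  have hst := isStable_zipWith h1.fix h2 hlen hCD
  refine Finset.Subset.antisymm (reachable_subset_of_isStable hr h1.mem hst) fun x hx => ?_
  refine mem_reachable.2 ⟨hA ▸ Finset.mem_union_left _ hx, fun B hB hbB hFB => ?_⟩
  refine h1.subset B hB hbB (fun g hg => ?_) hx
  rw [← (zipWith_induction hlen h1.fix h2 hCD).2.1] at hg
  obtain ⟨f, hf, rfl⟩ := List.mem_map.1 hg
  exact isStable_restrictTo (hst f hf) (hFB f hf)

end IsFactorization

end

section
variable {X : Type*} [DecidableEq X]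

namespace IsCycleDecomp
variable {σ τ : Perm X} {K J : Finset (Finset X)} {s t s₁ s₂ C : Finset X} {r b : X}

theorem biUnion_sdiff (h : IsCycleDecomp σ K) {T : Finset (Finset X)} (hT : T ⊆ K) :
    K.biUnion id \ T.biUnion id = (K \ T).biUnion id := by
  ext x
  simp only [Finset.mem_sdiff, Finset.mem_biUnion, id]
  constructor
  · rintro ⟨⟨s, hs, hx⟩, hxT⟩
    exact ⟨s, ⟨hs, fun hsT => hxT ⟨s, hsT, hx⟩⟩, hx⟩
  · rintro ⟨s, ⟨hs, hsT⟩, hx⟩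
    refine ⟨⟨s, hs, hx⟩, ?_⟩
    rintro ⟨t, ht, hxt⟩
    rw [h.eq_of_mem hs (hT ht) hx hxt] at hsT
    exact hsT ht

theorem biUnion_join (hs : s ∈ K) (ht : t ∈ K.erase s) :
    (insert (s ∪ t) ((K.erase s).erase t)).biUnion id = K.biUnion id := by
  conv_rhs => rw [← Finset.insert_erase hs, Finset.biUnion_insert,
    ← Finset.insert_erase ht, Finset.biUnion_insert]
  rw [Finset.biUnion_insert, id, id, id, Finset.union_assoc]

theorem union_notMem (h : IsCycleDecomp σ K) (hs : s ∈ K) :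
    s ∪ t ∉ (K.erase s).erase t := by
  intro hmem
  rw [Finset.mem_erase, Finset.mem_erase] at hmem
  obtain ⟨x, hx⟩ := (h.isCycleSet s hs).nonempty
  exact hmem.2.1 (h.eq_of_mem hmem.2.2 hs (Finset.mem_union_left _ hx) hx)

/-- The situation obtained by cutting the cycle `s` of a permutation into two cycles. -/
structure IsCut (K : Finset (Finset X)) (s s₁ s₂ : Finset X) (r b : X) : Prop where
  left_mem : r ∈ s₁
  right_mem : b ∈ s₂
  union : s₁ ∪ s₂ = s
  disjoint : Disjoint s₁ s₂
  left_notMem : s₁ ∉ insert s₂ (K.erase s)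
  right_notMem : s₂ ∉ K.erase s

theorem isCut (h : IsCycleDecomp σ K) {w v : List X} (hn : (r :: (w ++ b :: v)).Nodup)
    (hs : (r :: (w ++ b :: v)).toFinset ∈ K) :
    IsCut K (r :: (w ++ b :: v)).toFinset (r :: w).toFinset (b :: v).toFinset r b := by
  have hu : (r :: w).toFinset ∪ (b :: v).toFinset = (r :: (w ++ b :: v)).toFinset := by
    rw [← List.toFinset_append, List.cons_append]
  rw [← List.cons_append, List.nodup_append'] at hn
  have hd : Disjoint (r :: w).toFinset (b :: v).toFinset := by
    rw [Finset.disjoint_left]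
    intro x h1 h2
    exact hn.2.2 (List.mem_toFinset.1 h1) (List.mem_toFinset.1 h2)
  refine ⟨by simp, by simp, hu, hd, ?_, ?_⟩
  · rw [Finset.mem_insert, not_or]
    refine ⟨fun heq => ?_, h.notMem_insert_of_mem hs (hu ▸ Finset.subset_union_left) ⟨r, by simp⟩⟩
    rw [heq, disjoint_self, Finset.bot_eq_empty] at hd
    simp at hd
  · exact h.notMem_insert_of_mem hs (hu ▸ Finset.subset_union_right) ⟨b, by simp⟩

namespace IsCut

theorem biUnion (hc : IsCut K s s₁ s₂ r b) (hs : s ∈ K) :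
    (insert s₁ (insert s₂ (K.erase s))).biUnion id = K.biUnion id := by
  conv_rhs => rw [← Finset.insert_erase hs, Finset.biUnion_insert]
  rw [Finset.biUnion_insert, Finset.biUnion_insert, id, id, id, ← Finset.union_assoc, hc.union]

theorem card (hc : IsCut K s s₁ s₂ r b) (hs : s ∈ K) :
    (insert s₁ (insert s₂ (K.erase s))).card = K.card + 1 := by
  rw [Finset.card_insert_of_notMem hc.left_notMem, Finset.card_insert_of_notMem hc.right_notMem,
    Finset.card_erase_add_one hs]

theorem filter_subset (hc : IsCut K s s₁ s₂ r b)
    (h : IsCycleDecomp τ (insert s₁ (insert s₂ (K.erase s)))) (hC : IsStable C τ)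
    (hr : r ∈ C) (hb : b ∉ C) :
    (insert s₁ (insert s₂ (K.erase s))).filter (· ⊆ C) =
      insert s₁ ((K.erase s).filter (· ⊆ C)) := by
  have h1 : s₁ ⊆ C := (h.isCycleSet s₁ (by simp)).subset_of_mem hC hc.left_mem hr
  have h2 : ¬ s₂ ⊆ C := fun h => hb (h hc.right_mem)
  rw [Finset.filter_insert, if_pos h1, Finset.filter_insert, if_neg h2]

theorem sdiff_insert (hc : IsCut K s s₁ s₂ r b) {T : Finset (Finset X)} (hT : T ⊆ K.erase s) :
    insert s₁ (insert s₂ (K.erase s)) \ insert s₁ T = insert s₂ (K.erase s \ T) := by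
  rw [Finset.insert_sdiff_insert, Finset.sdiff_insert_of_notMem hc.left_notMem,
    Finset.insert_sdiff_of_notMem _ fun h => hc.right_notMem (hT h)]

variable {T : Finset (Finset X)}

theorem insert_left_subset (hT : T ⊆ K.erase s) :
    insert s₁ T ⊆ insert s₁ (insert s₂ (K.erase s)) :=
  Finset.insert_subset_insert _ (hT.trans (Finset.subset_insert _ _))

theorem insert_right_subset :
    insert s₂ (K.erase s \ T) ⊆ insert s₁ (insert s₂ (K.erase s)) :=
  (Finset.insert_subset_insert _ Finset.sdiff_subset).trans (Finset.subset_insert _ _)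

theorem biUnion_insert_subset (hc : IsCut K s s₁ s₂ r b) (hs : s ∈ K) (hT : T ⊆ K.erase s) :
    (insert s₁ T).biUnion id ⊆ K.biUnion id := by
  rw [← hc.biUnion hs]
  exact Finset.biUnion_subset_biUnion_of_subset_left _ (insert_left_subset hT)

theorem biUnion_insert_sdiff (hc : IsCut K s s₁ s₂ r b) (hs : s ∈ K)
    (h : IsCycleDecomp τ (insert s₁ (insert s₂ (K.erase s)))) (hT : T ⊆ K.erase s) :
    (insert s₂ (K.erase s \ T)).biUnion id = K.biUnion id \ (insert s₁ T).biUnion id := by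
  rw [← hc.sdiff_insert hT, ← h.biUnion_sdiff (insert_left_subset hT), hc.biUnion hs]

end IsCut

end IsCycleDecomp

open IsCycleDecomp

variable [Fintype X]

namespace IsFactorization
variable {A : Finset X} {r b : X} {m S : ℕ} {σ : Perm X} {F : List (Perm X)} {bs : List X}
  {K : Finset (Finset X)} {s s₁ s₂ : Finset X}

/-- The form of a factorization whose first star transposition cuts the cycle of `r` in such a way
that the remaining factors do not act transitively. -/
theorem split_of_isCut (hc : IsCut K s s₁ s₂ r b) (hs : s ∈ K)
    (h : IsCycleDecomp (swap b r * σ) (insert s₁ (insert s₂ (K.erase s))))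
    (hF : IsFactorization (K.biUnion id) r m σ S F (b :: bs))
    (hb : b ∉ reachable (K.biUnion id) r F bs) :
    ∃ S' S'' T, S' + S'' + 1 = S ∧ T ⊆ K.erase s ∧
      Disjoint ((insert s₁ T).biUnion id) ((insert s₂ (K.erase s \ T)).biUnion id) ∧
      (insert s₁ T).biUnion id ∪ (insert s₂ (K.erase s \ T)).biUnion id = K.biUnion id ∧
      (∀ g ∈ F, IsStable ((insert s₁ T).biUnion id) g) ∧
      (∀ g ∈ F, IsStable ((insert s₂ (K.erase s \ T)).biUnion id) g) ∧
      IsFactorization ((insert s₁ T).biUnion id) r m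
        (restrictTo ((insert s₁ T).biUnion id) (swap b r * σ)) S'
        (F.map (restrictTo ((insert s₁ T).biUnion id))) bs ∧
      IsFactorization ((insert s₂ (K.erase s \ T)).biUnion id) b m
        (restrictTo ((insert s₂ (K.erase s \ T)).biUnion id) (swap b r * σ)) S''
        (F.map (restrictTo ((insert s₂ (K.erase s \ T)).biUnion id))) [] := by
  have hbr : b ≠ r := by
    rintro rfl
    exact Finset.disjoint_left.1 hc.disjoint hc.left_mem hc.right_mem
  have hrA : r ∈ K.biUnion id :=
    Finset.mem_biUnion.2 ⟨s, hs, hc.union ▸ Finset.mem_union_left _ hc.left_mem⟩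
  set C := reachable (K.biUnion id) r F bs with hCdef
  have hrC : r ∈ C := root_mem_reachable hrA
  have hbsC : ∀ b ∈ bs, b ∈ C := mem_reachable_of_mem (List.forall_mem_cons.1 hF.mem).2
  have hFC : ∀ g ∈ F, IsStable C g := isStable_reachable hF.fix
  have hCτ : IsStable C (swap b r * σ) := by
    rw [← star_prod_cons_iff.1 hF.prod]
    exact (isStable_star_prod hrC hbsC).mul (IsStable.list_prod hFC)
  have hCA : C ⊆ K.biUnion id := reachable_subset
  have hsub : (K.erase s).filter (· ⊆ C) ⊆ K.erase s := Finset.filter_subset _ _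
  have hC1 : (insert s₁ ((K.erase s).filter (· ⊆ C))).biUnion id = C := by
    rw [← hc.filter_subset h hCτ hrC hb]
    exact h.biUnion_filter_subset hCτ (by rwa [hc.biUnion hs])
  have hC2 : (insert s₂ (K.erase s \ (K.erase s).filter (· ⊆ C))).biUnion id =
      K.biUnion id \ C := by
    rw [← hc.sdiff_insert hsub, ← h.biUnion_sdiff, hC1, hc.biUnion hs]
    exact Finset.insert_subset_insert _ (hsub.trans (Finset.subset_insert _ _))
  obtain ⟨S', S'', hS, h1, h2⟩ := hF.split hrA hbr hb hCdef
  refine ⟨S', S'', _, hS, hsub, ?_⟩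
  rw [hC1, hC2]
  exact ⟨Finset.disjoint_sdiff, Finset.union_sdiff_of_subset hCA, hFC,
    fun g hg => (IsStable.of_fix (hF.fix g hg)).sdiff (hFC g hg), h1, h2⟩

theorem card_add_card_le (h : IsCycleDecomp σ K) (hr : r ∈ K.biUnion id)
    (hF : IsFactorization (K.biUnion id) r m σ S F bs) (hFr : ∀ g ∈ F, g r = r) :
    (K.biUnion id).card + K.card ≤ S + 2 := by
  obtain ⟨A, hA⟩ : ∃ A, K.biUnion id = A := ⟨_, rfl⟩
  rw [hA] at hr hF ⊢
  induction hN : A.card using Nat.strong_induction_on generalizing A r σ F bs K S with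
  | _ N ihN =>
  subst hN
  induction bs generalizing σ K S with
  | nil =>
    have hsub := hF.subset {r} (by simp) (by simp) fun g hg =>
      IsStable.of_forall_mem (by simpa using hFr g hg)
    have hA1 : A = {r} := Finset.Subset.antisymm hsub (by simpa using hr)
    have := h.reflectionLength_add_card
    rw [hA] at this
    rw [hA1, Finset.card_singleton] at this ⊢
    omega
  | cons b bs ihb =>
    obtain ⟨s, hs, hrs⟩ := Finset.mem_biUnion.1 (hA ▸ hr)
    obtain ⟨t, ht, hbt⟩ := Finset.mem_biUnion.1 (hA ▸ (List.forall_mem_cons.1 hF.mem).1)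
    by_cases hbr : b = r
    · subst hbr
      exact ihb h ((cons_self_iff hr).1 hF) hA
    by_cases hst : s = t
    · subst hst
      obtain ⟨l, hl, hp, rfl⟩ := (h.isCycleSet s hs).exists_of_mem hrs
      have hbl : b ∈ l := by simpa [hbr] using hbt
      obtain ⟨w, v, rfl⟩ := List.append_of_mem hbl
      have hc := h.isCut hl hs
      have hcut := h.cut hl hp hs
      have hcard := hc.card hs
      by_cases hb : b ∈ reachable A r F bs
      · obtain ⟨S', hS, hF'⟩ := hF.of_cons hbr hb
        have := ihb hcut hF' ((hc.biUnion hs).trans hA)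
        omega
      · rw [← hA] at hb hF
        obtain ⟨S', S'', T, hS, hT, hd, hu, hst1, hst2, h1, h2⟩ :=
          split_of_isCut hc hs hcut hF hb
        have hr1 : r ∈ (insert (r :: w).toFinset T).biUnion id := by simp
        have hb2 : b ∈ (insert (b :: v).toFinset (K.erase (r :: (w ++ b :: v)).toFinset \ T)).biUnion id := by
          simp
        have hcu := Finset.card_union_of_disjoint hd
        rw [hu, hA] at hcu
        have hp1 := Finset.card_pos.2 ⟨r, hr1⟩
        have hp2 := Finset.card_pos.2 ⟨b, hb2⟩
        have hsub1 : insert (r :: w).toFinset T ⊆ insert (r :: w).toFinset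
            (insert (b :: v).toFinset (K.erase (r :: (w ++ b :: v)).toFinset)) :=
          Finset.insert_subset_insert _ (hT.trans (Finset.subset_insert _ _))
        have hsub2 : insert (b :: v).toFinset (K.erase (r :: (w ++ b :: v)).toFinset \ T) ⊆
            insert (r :: w).toFinset (insert (b :: v).toFinset
              (K.erase (r :: (w ++ b :: v)).toFinset)) :=
          (Finset.insert_subset_insert _ Finset.sdiff_subset).trans (Finset.subset_insert _ _)
        have hle1 := ihN _ (by omega) (hcut.restrict hsub1) ?_ _ h1 hr1 rfl rfl
        · have hle2 := ihN _ (by omega) (hcut.restrict hsub2) (collectRoot_apply_root _) _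
            ((isFactorization_collectRoot hb2 _).2 h2) hb2 rfl rfl
          have hk := Finset.card_sdiff_add_card_eq_card hsub1
          rw [hc.sdiff_insert hT] at hk
          omega
        · rw [List.forall_mem_map]
          intro g hg
          rw [restrictTo_apply_of_mem (hst1 g hg) hr1, hFr g hg]
    · have hts : t ∈ K.erase s := Finset.mem_erase.2 ⟨Ne.symm hst, ht⟩
      have hj := h.join hs ht hst hrs hbt
      have hb : b ∈ reachable A r F bs := by
        refine mem_reachable.2 ⟨(List.forall_mem_cons.1 hF.mem).1, fun B hB hbB hFB => ?_⟩
        have hstab : IsStable B (swap b r * σ) := by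
          rw [← star_prod_cons_iff.1 hF.prod]
          exact (isStable_star_prod hB hbB).mul (IsStable.list_prod hFB)
        exact (hj.isCycleSet _ (Finset.mem_insert_self _ _)).subset_of_mem hstab
          (Finset.mem_union_left _ hrs) hB (Finset.mem_union_right _ hbt)
      obtain ⟨S', hS, hF'⟩ := hF.of_cons hbr hb
      have := ihb hj hF' ((biUnion_join hs hts).trans hA)
      rw [Finset.card_insert_of_notMem (h.union_notMem hs)] at this
      have h3 := Finset.card_erase_add_one hts
      have h4 := Finset.card_erase_add_one hs
      omega

theorem card_add_card_le_of_nil (h : IsCycleDecomp σ K) (hr : r ∈ K.biUnion id)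
    (hF : IsFactorization (K.biUnion id) r m σ S F []) :
    (K.biUnion id).card + K.card ≤ S + 2 :=
  ((isFactorization_collectRoot hr _).2 hF).card_add_card_le h hr (collectRoot_apply_root _)

end IsFactorization

end

section
variable {X : Type*}

theorem sum_map_split_eq_sum_antidiagonal (f : ℕ → ℕ → ℚ) (h1 : ∀ y, f 0 y = 0)
    (h2 : ∀ x, f x 0 = 0) (l : List X) (g : X → ℚ)
    (hg : ∀ w b v, l = w ++ b :: v → g b = f (w.length + 1) (v.length + 1)) :
    (l.map g).sum =
      ∑ q ∈ Finset.HasAntidiagonal.antidiagonal (l.length + 1), f q.1 q.2 := by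
  have key : ∀ (l : List X) (f : ℕ → ℕ → ℚ),
      (∀ w b v, l = w ++ b :: v → g b = f (w.length + 1) (v.length + 1)) →
      (l.map g).sum = ∑ k ∈ Finset.range l.length, f (k + 1) (l.length - k) := by
    intro l
    induction l with
    | nil => simp
    | cons a l ih =>
      intro f hf
      rw [List.map_cons, List.sum_cons, ih (fun x y => f (x + 1) y), List.length_cons,
        Finset.sum_range_succ', hf [] a l rfl, add_comm]
      · simp
      · rintro w b v rfl
        exact hf (a :: w) b v rfl
  rw [key l f hg, Finset.Nat.sum_antidiagonal_eq_sum_range_succ f, Finset.sum_range_succ,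
    Finset.sum_range_succ', h1, Nat.sub_self, h2, add_zero, add_zero]
  exact Finset.sum_congr rfl fun k _ => by rw [Nat.add_sub_add_right]

open IsCycleDecomp IsCut

variable [DecidableEq X] [Fintype X]

instance {A : Finset X} {r : X} {m S i : ℕ} {σ : Perm X} :
    Finite (rootedFactorizations A r m σ S i) := by
  refine Set.Finite.subset ((List.finite_length_eq (Perm X) m).prod (List.finite_length_eq X i)) ?_
  exact fun p hp => ⟨hp.1.length, hp.2.1⟩

instance {A : Finset X} {r : X} {m S : ℕ} {σ : Perm X} :
    Finite (plainFactorizations A r m σ S) :=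
  Set.Finite.subset (List.finite_length_eq (Perm X) m) fun _ hp => IsFactorization.length hp

/-- The rooted factorizations whose first star transposition is `(b r)`, with it left out. -/
def rootedFactorizationsFrom (A : Finset X) (r : X) (m : ℕ) (σ : Perm X) (S i : ℕ) (b : X) :
    Set (List (Perm X) × List X) :=
  {p | IsFactorization A r m σ S p.1 (b :: p.2) ∧ p.2.length = i ∧ ∀ g ∈ p.1, g r = r}

instance {A : Finset X} {r b : X} {m S i : ℕ} {σ : Perm X} :
    Finite (rootedFactorizationsFrom A r m σ S i b) := by
  refine Set.Finite.subset ((List.finite_length_eq (Perm X) m).prod (List.finite_length_eq X i)) ?_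
  exact fun p hp => ⟨hp.1.length, hp.2.1⟩

variable {A : Finset X} {r b : X} {m S i : ℕ} {σ : Perm X}
  {K : Finset (Finset X)} {s s₁ s₂ : Finset X}

theorem card_rootedFactorizations_succ :
    Nat.card (rootedFactorizations A r m σ S (i + 1)) =
      ∑ b ∈ A, Nat.card (rootedFactorizationsFrom A r m σ S i b) := by
  rw [← Finset.sum_coe_sort A, ← Nat.card_sigma]
  refine (Nat.card_congr (Equiv.ofBijective
    (fun p => ⟨(p.2.1.1, p.1.1 :: p.2.1.2), p.2.2.1, by simpa using p.2.2.2.1, p.2.2.2.2⟩)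
    ⟨?_, ?_⟩)).symm
  · rintro ⟨⟨b, hb⟩, ⟨F, bs⟩, h⟩ ⟨⟨b', hb'⟩, ⟨F', bs'⟩, h'⟩ heq
    cases heq
    rfl
  · rintro ⟨⟨F, bs⟩, h1, h2, h3⟩
    obtain _ | ⟨b, bs⟩ := bs
    · simp at h2
    · exact ⟨⟨⟨b, h1.mem b (by simp)⟩, (F, bs), h1, by simpa using h2, h3⟩, rfl⟩

theorem rootedFactorizationsFrom_root (hr : r ∈ A) :
    rootedFactorizationsFrom A r m σ S i r = rootedFactorizations A r m σ S i := by
  ext p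
  exact and_congr_left fun _ => IsFactorization.cons_self_iff hr

theorem rootedFactorizationsFrom_join {t : Finset X} (h : IsCycleDecomp σ K) (hs : s ∈ K)
    (ht : t ∈ K) (hst : s ≠ t) (hr : r ∈ s) (hb : b ∈ t) :
    rootedFactorizationsFrom (K.biUnion id) r m σ (S + 1) i b =
      rootedFactorizations (K.biUnion id) r m (swap b r * σ) S i := by
  have hbA : b ∈ K.biUnion id := Finset.mem_biUnion.2 ⟨t, ht, hb⟩
  have hbr : b ≠ r := by
    rintro rfl
    exact hst (h.eq_of_mem hs ht hr hb)
  ext p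
  refine and_congr_left fun _ => ⟨fun hF => ?_, fun hF => hF.cons hbA hbr⟩
  have hb : b ∈ reachable (K.biUnion id) r p.1 p.2 := by
    refine mem_reachable.2 ⟨hbA, fun B hB hbB hFB => ?_⟩
    have hstab : IsStable B (swap b r * σ) := by
      rw [← star_prod_cons_iff.1 hF.prod]
      exact (isStable_star_prod hB hbB).mul (IsStable.list_prod hFB)
    exact ((h.join hs ht hst hr hb).isCycleSet _ (Finset.mem_insert_self _ _)).subset_of_mem hstab
      (Finset.mem_union_left _ hr) hB (Finset.mem_union_right _ hb)
  obtain ⟨S', hS, hF'⟩ := hF.of_cons hbr hb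
  rwa [Nat.add_right_cancel hS] at hF'

theorem card_rootedFactorizationsFrom_cut (hc : IsCut K s s₁ s₂ r b) (hs : s ∈ K)
    (h : IsCycleDecomp (swap b r * σ) (insert s₁ (insert s₂ (K.erase s))))
    (hS : S + 2 = (K.biUnion id).card + K.card) :
    Nat.card (rootedFactorizationsFrom (K.biUnion id) r m σ S i b) =
      ∑ T ∈ (K.erase s).powerset,
        Nat.card (rootedFactorizations ((insert s₁ T).biUnion id) r m
          (restrictTo ((insert s₁ T).biUnion id) (swap b r * σ))
          (((insert s₁ T).biUnion id).card + (insert s₁ T).card - 2) i) *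
        Nat.card (plainFactorizations ((insert s₂ (K.erase s \ T)).biUnion id) b m
          (restrictTo ((insert s₂ (K.erase s \ T)).biUnion id) (swap b r * σ))
          (((insert s₂ (K.erase s \ T)).biUnion id).card +
            (insert s₂ (K.erase s \ T)).card - 2)) := by
  have hsub1 : ∀ T ⊆ K.erase s, insert s₁ T ⊆ insert s₁ (insert s₂ (K.erase s)) :=
    fun T hT => insert_left_subset hT
  have hsub2 : ∀ T : Finset (Finset X),
      insert s₂ (K.erase s \ T) ⊆ insert s₁ (insert s₂ (K.erase s)) :=
    fun T => insert_right_subset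
  have hr1 : ∀ T : Finset (Finset X), r ∈ (insert s₁ T).biUnion id := fun T => by simp [hc.left_mem]
  have hb2 : ∀ T : Finset (Finset X), b ∈ (insert s₂ (K.erase s \ T)).biUnion id :=
    fun T => by simp [hc.right_mem]
  have hcompl := fun T hT => hc.biUnion_insert_sdiff (T := T) hs h hT
  have hle := fun T hT => hc.biUnion_insert_subset (T := T) hs hT
  have hd : ∀ T ⊆ K.erase s, Disjoint ((insert s₁ T).biUnion id)
      ((insert s₂ (K.erase s \ T)).biUnion id) := fun T hT =>
    hcompl T hT ▸ Finset.disjoint_sdiff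
  have hun : ∀ T ⊆ K.erase s, (insert s₁ T).biUnion id ∪
      (insert s₂ (K.erase s \ T)).biUnion id = K.biUnion id := fun T hT =>
    hcompl T hT ▸ Finset.union_sdiff_of_subset (hle T hT)
  have hcard : ∀ T ⊆ K.erase s, ((insert s₁ T).biUnion id).card + (insert s₁ T).card +
      (((insert s₂ (K.erase s \ T)).biUnion id).card + (insert s₂ (K.erase s \ T)).card) =
        S + 3 := fun T hT => by
    have h1 := Finset.card_union_of_disjoint (hd T hT)
    have h2 := Finset.card_sdiff_add_card_eq_card (hsub1 T hT)
    rw [hc.sdiff_insert hT, hc.card hs] at h2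
    rw [hun T hT] at h1
    omega
  have hpos : ∀ T : Finset (Finset X), 2 ≤ ((insert s₁ T).biUnion id).card + (insert s₁ T).card := fun T => by
    have h1 := Finset.card_pos.2 ⟨r, hr1 T⟩
    have h2 := Finset.card_pos.2 (Finset.insert_nonempty s₁ T)
    omega
  have hpos' : ∀ T : Finset (Finset X), 2 ≤ ((insert s₂ (K.erase s \ T)).biUnion id).card +
      (insert s₂ (K.erase s \ T)).card := fun T => by
    have h1 := Finset.card_pos.2 ⟨b, hb2 T⟩
    have h2 := Finset.card_pos.2 (Finset.insert_nonempty s₂ (K.erase s \ T))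
    omega
  have hprod : ∀ T ⊆ K.erase s, restrictTo ((insert s₁ T).biUnion id) (swap b r * σ) *
      restrictTo ((insert s₂ (K.erase s \ T)).biUnion id) (swap b r * σ) = swap b r * σ :=
    fun T hT => restrictTo_mul_restrictTo (h.isStable_biUnion (hsub1 T hT))
      (h.isStable_biUnion (hsub2 T)) (hd T hT) fun x h1 h2 => h.fix x (by
        rw [hc.biUnion hs, ← hun T hT, Finset.mem_union]
        tauto)
  have hmem : ∀ T ⊆ K.erase s, ∀ p ∈ rootedFactorizations ((insert s₁ T).biUnion id) r m
      (restrictTo ((insert s₁ T).biUnion id) (swap b r * σ))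
      (((insert s₁ T).biUnion id).card + (insert s₁ T).card - 2) i,
      ∀ F ∈ plainFactorizations ((insert s₂ (K.erase s \ T)).biUnion id) b m
      (restrictTo ((insert s₂ (K.erase s \ T)).biUnion id) (swap b r * σ))
      (((insert s₂ (K.erase s \ T)).biUnion id).card + (insert s₂ (K.erase s \ T)).card - 2),
      (List.zipWith (· * ·) p.1 F, p.2) ∈
        rootedFactorizationsFrom (K.biUnion id) r m σ S i b := by
    intro T hT p h1 F h2
    refine ⟨?_, h1.2.1, fun f hf => ?_⟩
    · have hF := h1.1.glue (hd T hT) (hr1 T) (hb2 T) h2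
      rw [hprod T hT, ← mul_assoc, swap_mul_self, one_mul, hun T hT] at hF
      convert hF using 1
      have := hcard T hT
      have := hpos T
      have := hpos' T
      omega
    · obtain ⟨g, g', rfl, hg, hg'⟩ := (zipWith_induction
        (h1.1.length.trans h2.length.symm) h1.1.fix h2.fix (hd T hT)).2.2.2 f hf
      rw [Perm.mul_apply, h2.fix g' hg' r (Finset.disjoint_left.1 (hd T hT) (hr1 T)), h1.2.2 g hg]
  simp_rw [← Nat.card_prod]
  rw [← Finset.sum_coe_sort, ← Nat.card_sigma]
  refine (Nat.card_congr (Equiv.ofBijective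
    (fun p => ⟨(List.zipWith (· * ·) p.2.1.1.1 p.2.2.1, p.2.1.1.2),
      hmem p.1.1 (Finset.mem_powerset.1 p.1.2) _ p.2.1.2 _ p.2.2.2⟩) ⟨?_, ?_⟩)).symm
  · rintro ⟨⟨T, hT⟩, ⟨⟨F1, bs⟩, h1⟩, ⟨F2, h2⟩⟩ ⟨⟨T', hT'⟩, ⟨⟨F1', bs'⟩, h1'⟩, ⟨F2', h2'⟩⟩ heq
    simp only [Subtype.mk.injEq, Prod.mk.injEq] at heq
    obtain ⟨heq, rfl⟩ := heq
    have hTs := Finset.mem_powerset.1 hT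
    have hTs' := Finset.mem_powerset.1 hT'
    have hr := IsFactorization.reachable_zipWith (hd T hTs) (hun T hTs).symm (hr1 T) h1.1 h2.length h2.fix
    have hr' := IsFactorization.reachable_zipWith (hd T' hTs') (hun T' hTs').symm (hr1 T') h1'.1
      h2'.length h2'.fix
    have hTT : T = T' := by
      have haux : ∀ T T', T ⊆ K.erase s → T' ⊆ K.erase s →
          (insert s₁ T).biUnion id = (insert s₁ T').biUnion id → T ⊆ T' := by
        intro T T' hT hT' heq t ht
        have htK : t ∈ insert s₁ (insert s₂ (K.erase s)) := by simp [hT ht]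
        obtain ⟨x, hx⟩ := (h.isCycleSet t htK).nonempty
        have hx' : x ∈ (insert s₁ T').biUnion id :=
          heq ▸ Finset.mem_biUnion.2 ⟨t, Finset.mem_insert_of_mem ht, hx⟩
        obtain ⟨u, hu, hxu⟩ := Finset.mem_biUnion.1 hx'
        obtain rfl := h.eq_of_mem htK (hsub1 T' hT' hu) hx hxu
        refine (Finset.mem_insert.1 hu).resolve_left ?_
        rintro rfl
        exact hc.left_notMem (Finset.mem_insert_of_mem (hT ht))
      have hC := hr.symm.trans ((congrArg (reachable (K.biUnion id) r · bs) heq).trans hr')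
      exact Finset.Subset.antisymm (haux T T' hTs hTs' hC) (haux T' T hTs' hTs hC.symm)
    subst hTT
    obtain ⟨-, e1, e2, -⟩ := zipWith_induction (h1.1.length.trans h2.length.symm) h1.1.fix h2.fix
      (hd T hTs)
    obtain ⟨-, e1', e2', -⟩ := zipWith_induction (h1'.1.length.trans h2'.length.symm) h1'.1.fix
      h2'.fix (hd T hTs)
    rw [heq] at e1 e2
    obtain rfl := e1.symm.trans e1'
    obtain rfl := e2.symm.trans e2'
    rfl
  · rintro ⟨⟨F, bs⟩, hF, hi, hFr⟩
    have hbr : b ≠ r := by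
      rintro rfl
      exact Finset.disjoint_left.1 hc.disjoint hc.left_mem hc.right_mem
    have hrA : r ∈ K.biUnion id :=
      Finset.mem_biUnion.2 ⟨s, hs, hc.union ▸ Finset.mem_union_left _ hc.left_mem⟩
    have hb : b ∉ reachable (K.biUnion id) r F bs := by
      intro hb
      obtain ⟨S', hS', hF'⟩ := hF.of_cons hbr hb
      rw [← hc.biUnion hs] at hF' hrA
      have := hF'.card_add_card_le h hrA hFr
      rw [hc.biUnion hs, hc.card hs] at this
      omega
    obtain ⟨S', S'', T, hS', hT, -, -, hst1, hst2, h1, h2⟩ :=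
      IsFactorization.split_of_isCut hc hs h hF hb
    have hFr1 : ∀ g ∈ F.map (restrictTo ((insert s₁ T).biUnion id)), g r = r := by
      rw [List.forall_mem_map]
      intro g hg
      rw [restrictTo_apply_of_mem (hst1 g hg) (hr1 T), hFr g hg]
    have hle1 := h1.card_add_card_le (h.restrict (hsub1 T hT)) (hr1 T) hFr1
    have hle2 := h2.card_add_card_le_of_nil (h.restrict (hsub2 T)) (hb2 T)
    have hc3 := hcard T hT
    have e1 : ((insert s₁ T).biUnion id).card + (insert s₁ T).card - 2 = S' := by omega
    have e2 : ((insert s₂ (K.erase s \ T)).biUnion id).card +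
      (insert s₂ (K.erase s \ T)).card - 2 = S'' := by omega
    refine ⟨⟨⟨T, Finset.mem_powerset.2 hT⟩, ⟨(F.map (restrictTo ((insert s₁ T).biUnion id)), bs),
      ?_, hi, hFr1⟩,
      ⟨F.map (restrictTo ((insert s₂ (K.erase s \ T)).biUnion id)), ?_⟩⟩, ?_⟩
    · dsimp only
      rwa [e1]
    · dsimp only [plainFactorizations, Set.mem_ofPred_eq]
      rwa [e2]
    · refine Subtype.ext (Prod.ext ?_ rfl)
      dsimp only
      rw [List.zipWith_map, List.zipWith_self]
      conv_rhs => rw [← List.map_id F]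
      refine List.map_congr_left fun g hg => ?_
      refine restrictTo_mul_restrictTo (hst1 g hg) (hst2 g hg) (hd T hT) fun x h1 h2 =>
        hF.fix g hg x ?_
      rw [← hun T hT, Finset.mem_union]
      tauto

end

section
variable {X : Type*} [DecidableEq X] [Fintype X]

open IsCycleDecomp IsCut

variable {r b : X} {m S i : ℕ} {σ : Perm X} {K : Finset (Finset X)} {s s₁ s₂ : Finset X}

theorem card_rootedFactorizations_zero (h : IsCycleDecomp σ K) (hs : s ∈ K) (hr : r ∈ s)
    (hS : S + 2 = (K.biUnion id).card + K.card) :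
    Nat.card (rootedFactorizations (K.biUnion id) r m σ S 0) =
      if s.card = 1 ∧ K.erase s = ∅ then 1 else 0 := by
  have hsub : s ⊆ K.biUnion id := Finset.subset_biUnion_of_mem id hs
  split_ifs with hcase
  · obtain ⟨a, rfl⟩ := Finset.card_eq_one.1 hcase.1
    obtain rfl := Finset.mem_singleton.1 hr
    have hK : K = {{r}} := by rw [← Finset.insert_erase hs, hcase.2, insert_empty_eq]
    subst hK
    rw [Finset.singleton_biUnion, id, Finset.card_singleton, Finset.card_singleton] at hS
    have hfix : ∀ g : Perm X, (∀ x ∉ ({r} : Finset X), g x = x) → g = 1 := fun g hg => by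
      ext x
      by_cases hx : x ∈ ({r} : Finset X)
      · have := (IsStable.of_fix hg x).2 hx
        rw [Finset.mem_singleton] at hx this
        rw [this, hx, one_apply]
      · exact hg x hx
    have hσ := hfix σ (by simpa using h.fix)
    rw [hσ, Finset.singleton_biUnion, id, Nat.card_eq_one_iff_exists]
    refine ⟨⟨(List.replicate m 1, []), ⟨by simp, ?_, by simp, by simp, ?_,
      fun B hB _ _ => by simpa⟩,
      rfl, ?_⟩, ?_⟩
    · intro g hg
      simp [List.eq_of_mem_replicate hg]
    · simp [reflectionLength_one]
      omega
    · intro g hg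
      simp [List.eq_of_mem_replicate hg]
    · rintro ⟨⟨F, bs⟩, hF, hi, -⟩
      obtain rfl := List.length_eq_zero_iff.1 hi
      have hFm : F = List.replicate m 1 :=
        List.eq_replicate_iff.2 ⟨hF.length, fun g hg => hfix g (hF.fix g hg)⟩
      simp only [hFm]
  · rw [Nat.card_eq_zero]
    refine Or.inl ⟨?_⟩
    rintro ⟨⟨F, bs⟩, hF, hi, hFr⟩
    obtain rfl := List.length_eq_zero_iff.1 hi
    have hA : K.biUnion id ⊆ {r} := hF.subset {r} (by simp) (by simp) fun g hg =>
      IsStable.of_forall_mem (by simpa using hFr g hg)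
    refine hcase ⟨Finset.card_eq_one.2 ⟨r, Finset.Subset.antisymm (hsub.trans hA) (by simpa)⟩, ?_⟩
    rw [Finset.eq_empty_iff_forall_notMem]
    intro t ht
    rw [Finset.mem_erase] at ht
    obtain ⟨x, hx⟩ := (h.isCycleSet t ht.2).nonempty
    have hxr := Finset.mem_singleton.1 (hA (Finset.mem_biUnion.2 ⟨t, ht.2, hx⟩))
    exact ht.1 (h.eq_of_mem ht.2 hs hx (hxr ▸ hr))

theorem card_rootedFactorizations (hm : 2 ≤ m) (h : IsCycleDecomp σ K) (hs : s ∈ K) (hr : r ∈ s)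
    (hS : S + 2 = (K.biUnion id).card + K.card) (i : ℕ) :
    (Nat.card (rootedFactorizations (K.biUnion id) r m σ S i) : ℚ) =
      cutJoinNumber m Finset.card i s.card (K.erase s) := by
  obtain ⟨A, hA⟩ : ∃ A, K.biUnion id = A := ⟨_, rfl⟩
  rw [hA] at hS ⊢
  induction hN : A.card using Nat.strong_induction_on generalizing A r σ K s S i with
  | _ N ih =>
  subst hN
  induction i generalizing σ K s S with
  | zero =>
    subst hA
    rw [card_rootedFactorizations_zero h hs hr hS, cutJoinNumber]
    push_cast
    rfl
  | succ i ihi =>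
    obtain ⟨l, hl, hp, rfl⟩ := (h.isCycleSet s hs).exists_of_mem hr
    set s := (r :: l).toFinset with hsdef
    have hscard : s.card = l.length + 1 := by
      rw [hsdef, List.toFinset_card_of_nodup hl, List.length_cons]
    have hrA : r ∈ A := hA ▸ Finset.mem_biUnion.2 ⟨s, hs, hr⟩
    rw [card_rootedFactorizations_succ, hscard, cutJoinNumber, ← hscard]
    have hsum : ∀ g : X → ℚ, ∑ b ∈ A, g b =
        g r + (∑ t ∈ K.erase s, ∑ b ∈ t, g b) + (l.map g).sum := fun g => by
      rw [← hA, Finset.sum_biUnion (t := id) fun s hs t ht hst => h.disjoint s hs t ht hst,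
        ← Finset.add_sum_erase _ _ hs, id, hsdef, List.sum_toFinset _ hl, List.map_cons,
        List.sum_cons, add_right_comm]
      rfl
    push_cast
    rw [hsum]
    congr 1
    · congr 1
      · rw [rootedFactorizationsFrom_root hrA, ihi h hs hr hS hA]
      · refine Finset.sum_congr rfl fun t ht => ?_
        rw [← nsmul_eq_mul, ← Finset.sum_const]
        refine Finset.sum_congr rfl fun b hb => ?_
        have ht' := Finset.mem_erase.1 ht
        have hdisj := h.disjoint s hs t ht'.2 ht'.1.symm
        have hj := h.join hs ht'.2 ht'.1.symm hr hb
        have hAj := (biUnion_join hs ht).trans hA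
        have hn := h.union_notMem (t := t) hs
        have hcard := Finset.card_insert_of_notMem hn
        have hc1 := Finset.card_erase_add_one hs
        have hc2 := Finset.card_erase_add_one ht
        have hp1 := Finset.card_pos.2 ⟨r, hrA⟩
        obtain _ | S := S
        · omega
        have := ihi hj (Finset.mem_insert_self _ _) (Finset.mem_union_left _ hr) (S := S)
          (by omega) hAj
        rw [← hA] at this ⊢
        rw [rootedFactorizationsFrom_join h hs ht'.2 ht'.1.symm hr hb, this,
          Finset.erase_insert hn, Finset.card_union_of_disjoint hdisj]
    · have h0 : ∀ T : Finset (Finset X), cutJoinNumber m Finset.card i 0 T = 0 := fun T => by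
        obtain _ | i := i <;> simp [cutJoinNumber]
      rw [hscard]
      refine sum_map_split_eq_sum_antidiagonal (fun x y => ∑ T ∈ (K.erase s).powerset,
        cutJoinNumber m Finset.card i x T * hypermapNumber m Finset.card y (K.erase s \ T))
        (fun y => ?_) (fun x => ?_) l _ ?_
      · simp [h0]
      · simp [hypermapNumber]
      · rintro w b v rfl
        have hc := h.isCut hl hs
        have hcut := h.cut hl hp hs
        rw [← hA] at hS ⊢
        rw [card_rootedFactorizationsFrom_cut hc hs hcut hS]
        push_cast
        refine Finset.sum_congr rfl fun T hT => ?_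
        rw [Finset.mem_powerset] at hT
        rw [← hsdef] at hc
        have hcompl := hc.biUnion_insert_sdiff hs hcut hT
        have hle := hc.biUnion_insert_subset hs hT
        have hr1 : r ∈ (insert (r :: w).toFinset T).biUnion id := by simp
        have hb2 : b ∈ (insert (b :: v).toFinset (K.erase s \ T)).biUnion id := by simp
        have hlt1 := Finset.card_lt_card (Finset.sdiff_ssubset
          (hcompl.trans_subset Finset.sdiff_subset) ⟨b, hb2⟩)
        rw [hcompl, Finset.sdiff_sdiff_eq_self hle] at hlt1
        have hlt2 := Finset.card_lt_card (Finset.sdiff_ssubset hle ⟨r, hr1⟩)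
        rw [← hcompl] at hlt2
        rw [hA] at hlt1 hlt2
        have h1 : 2 ≤ ((insert (r :: w).toFinset T).biUnion id).card +
            (insert (r :: w).toFinset T).card :=
          Nat.add_le_add (a := 1) (c := 1) (Finset.card_pos.2 ⟨r, hr1⟩)
            (Finset.card_pos.2 (Finset.insert_nonempty _ _))
        have h2 : 2 ≤ ((insert (b :: v).toFinset (K.erase s \ T)).biUnion id).card +
            (insert (b :: v).toFinset (K.erase s \ T)).card :=
          Nat.add_le_add (a := 1) (c := 1) (Finset.card_pos.2 ⟨b, hb2⟩)
            (Finset.card_pos.2 (Finset.insert_nonempty _ _))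
        have hcount1 := ih _ hlt1 (r := r)
          (S := ((insert (r :: w).toFinset T).biUnion id).card +
            (insert (r :: w).toFinset T).card - 2) (hcut.restrict (insert_left_subset hT))
          (Finset.mem_insert_self _ _) (by simp) i _ (Nat.sub_add_cancel h1) rfl rfl
        have hcount2 := ih _ hlt2 (r := b)
          (S := ((insert (b :: v).toFinset (K.erase s \ T)).biUnion id).card +
            (insert (b :: v).toFinset (K.erase s \ T)).card - 2) (hcut.restrict insert_right_subset)
          (Finset.mem_insert_self _ _) (by simp) m _ (Nat.sub_add_cancel h2) rfl rfl
        have hn1 : (r :: w).toFinset ∉ T := fun h =>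
          hc.left_notMem (Finset.mem_insert_of_mem (hT h))
        have hn2 : (b :: v).toFinset ∉ K.erase s \ T := fun h =>
          hc.right_notMem (Finset.mem_sdiff.1 h).1
        rw [← List.cons_append, List.nodup_append'] at hl
        rw [Finset.erase_insert hn1, List.toFinset_card_of_nodup hl.1] at hcount1
        rw [Finset.erase_insert hn2, List.toFinset_card_of_nodup hl.2.1,
          cutJoinNumber_eq_hypermapNumber hm _ (by simp)] at hcount2
        · rw [card_plainFactorizations hb2, hcount1, hcount2, List.length_cons, List.length_cons]
        · intro t ht
          exact (h.isCycleSet t (Finset.mem_of_mem_erase (Finset.mem_sdiff.1 ht).1)).nonempty.card_pos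

end

section
variable {X : Type*} [DecidableEq X] [Fintype X]

theorem subset_iff_isPretransitive {F : List (Perm X)} {r : X} :
    (∀ B : Finset X, r ∈ B → (∀ g ∈ F, IsStable B g) → Finset.univ ⊆ B) ↔
      ∀ a b : X, ∃ g ∈ Subgroup.closure {g | g ∈ F}, g a = b := by
  constructor
  · intro h
    have key : ∀ b, ∃ g ∈ Subgroup.closure {g | g ∈ F}, g r = b := by
      classical
      intro b
      have := h (Finset.univ.filter fun b => ∃ g ∈ Subgroup.closure {g | g ∈ F}, g r = b)
        (by simpa using ⟨1, one_mem _, rfl⟩) (fun f hf => IsStable.of_forall_mem fun x hx => ?_)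
        (Finset.mem_univ b)
      · simpa using this
      · simp only [Finset.mem_filter, Finset.mem_univ, true_and] at hx ⊢
        obtain ⟨g, hg, rfl⟩ := hx
        exact ⟨f * g, mul_mem (Subgroup.subset_closure hf) hg, rfl⟩
    intro a b
    obtain ⟨g, hg, rfl⟩ := key a
    obtain ⟨g', hg', rfl⟩ := key b
    exact ⟨g' * g⁻¹, mul_mem hg' (inv_mem hg), by simp⟩
  · intro h B hr hB x _
    obtain ⟨g, hg, rfl⟩ := h r x
    have hst : ∀ g ∈ Subgroup.closure {g | g ∈ F}, IsStable B g := fun g hg => by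
      induction hg using Subgroup.closure_induction with
      | mem g hg => exact hB g hg
      | one => exact fun x => Iff.rfl
      | mul g g' _ _ h h' => exact h.mul h'
      | inv g _ h =>
        intro x
        have := h (g⁻¹ x)
        rw [← Perm.mul_apply, mul_inv_cancel, one_apply] at this
        exact this.symm
    exact (hst g hg r).2 hr

theorem ofFn_mem_plainFactorizations {m S : ℕ} {r : X} {σ : Perm X} {f : Fin m → Perm X} :
    List.ofFn f ∈ plainFactorizations Finset.univ r m σ S ↔
      (List.ofFn f).prod = σ ∧ ∑ i, (Fintype.card X - (f i).partition.parts.card) = S ∧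
        ∀ a b : X, ∃ g ∈ Subgroup.closure (Set.range f), g a = b := by
  have hsum : ((List.ofFn f).map reflectionLength).sum =
      ∑ i, (Fintype.card X - (f i).partition.parts.card) := by
    rw [List.map_ofFn, List.sum_ofFn]
    exact Finset.sum_congr rfl fun i _ => reflectionLength_eq_sub _
  have hrange : {g | g ∈ List.ofFn f} = Set.range f := by
    ext g
    exact List.mem_ofFn' f g
  rw [← hrange, ← subset_iff_isPretransitive (r := r), ← hsum]
  constructor
  · intro h
    exact ⟨by simpa using h.prod, by simpa using h.sum, fun B hB hF => h.subset B hB (by simp) hF⟩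
  · rintro ⟨h1, h2, h3⟩
    exact ⟨List.length_ofFn, by simp, by simp, by simpa using h1, by simpa using h2,
      fun B hB _ hF => h3 B hB hF⟩

theorem card_transitive_factorizations {n m S : ℕ} (hX : Fintype.card X = n) (hm : 2 ≤ m) (r : X)
    (σ : Perm X)
    (hS : S + 2 = n + σ.partition.parts.card) :
    (Nat.card {f : Fin m → Perm X //
        (List.ofFn f).prod = σ ∧
        ∑ i, (n - (f i).partition.parts.card) = S ∧
        ∀ a b : X, ∃ g ∈ Subgroup.closure (Set.range f), g a = b} : ℚ) =
      m * ((m - 1) * n - 1).factorial /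
          ((m - 1) * n - σ.partition.parts.card + 2).factorial *
        (σ.partition.parts.map fun a => (cycleWeight m a : ℚ)).prod := by
  subst hX
  obtain ⟨K, h, hK⟩ := exists_isCycleDecomp_univ σ
  obtain ⟨s, hs, hr⟩ := Finset.mem_biUnion.1 (hK ▸ Finset.mem_univ r)
  have hparts := h.partition_parts hK
  have hcardK : σ.partition.parts.card = K.card := by
    rw [hparts, Multiset.card_map, Finset.card_val]
  have hcardX : s.card + ∑ t ∈ K.erase s, t.card = Fintype.card X := by
    rw [Finset.add_sum_erase K Finset.card hs, ← h.card_biUnion, hK, Finset.card_univ]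
  have hcount : Nat.card {f : Fin m → Perm X //
        (List.ofFn f).prod = σ ∧
        ∑ i, (Fintype.card X - (f i).partition.parts.card) = S ∧
        ∀ a b : X, ∃ g ∈ Subgroup.closure (Set.range f), g a = b} =
      Nat.card (plainFactorizations Finset.univ r m σ S) := by
    refine Nat.card_congr (Equiv.ofBijective
      (fun f => ⟨List.ofFn f.1, ofFn_mem_plainFactorizations.2 f.2⟩) ⟨?_, ?_⟩)
    · intro f g hfg
      exact Subtype.ext (List.ofFn_injective (Subtype.ext_iff.1 hfg))
    · rintro ⟨F, hF⟩
      obtain rfl := hF.length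
      have hF' := List.ofFn_get F
      refine ⟨⟨F.get, (ofFn_mem_plainFactorizations (r := r)).1 ?_⟩, Subtype.ext hF'⟩
      rwa [hF']
  have hS' : S + 2 = (K.biUnion id).card + K.card := by
    rw [hS, hK, Finset.card_univ, hcardK]
  have hpos : ∀ t ∈ K, 1 ≤ t.card := fun t ht => (h.isCycleSet t ht).nonempty.card_pos
  rw [hcount, ← hK, card_plainFactorizations (Finset.mem_biUnion.2 ⟨s, hs, hr⟩),
    card_rootedFactorizations hm h hs hr hS',
    cutJoinNumber_eq_hypermapNumber hm _ (hpos s hs) _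
      fun t ht => hpos t (Finset.mem_of_mem_erase ht), hypermapNumber,
        if_neg (Nat.ne_of_gt (hpos s hs)), hcardX]
  have hle : K.card ≤ (m - 1) * Fintype.card X := by
    have h1 : K.card ≤ Fintype.card X := by
      rw [← Finset.card_univ, ← hK, h.card_biUnion, Finset.card_eq_sum_ones]
      exact Finset.sum_le_sum hpos
    have h2 : 1 ≤ m - 1 := by omega
    nlinarith
  have hK1 := Finset.card_erase_add_one hs
  have hexp : (m - 1) * Fintype.card X - (K.erase s).card + 1 =
      (m - 1) * Fintype.card X - σ.partition.parts.card + 2 := by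
    omega
  rw [hexp]
  congr 1
  rw [hparts, Multiset.map_map]
  exact Finset.mul_prod_erase K (fun t => (cycleWeight m t.card : ℚ)) hs

end

end

/-- Genus-0 m-hypermap (Bousquet-Mélou–Schaeffer) formula: for `n ≥ 1`, `m ≥ 2`, and
`σ ∈ S_n` with full cycle type `α` (fixed points included) having `ℓ` parts, the number
of transitive factorizations `(π₁, …, π_m)` of `σ` with `∑ᵢ (n - ℓ(πᵢ)) = n + ℓ - 2`
(where `ℓ(π)` is the number of cycles of `π` including fixed points) equals
`m · ((m-1)n - 1)! / ((m-1)n - ℓ + 2)! · ∏_j α_j · C(m·α_j - 1, α_j)`. -/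
theorem stmt5 (n m : ℕ) (hn : 1 ≤ n) (hm : 2 ≤ m) (σ : Equiv.Perm (Fin n))
    (ℓ : ℕ) (hℓ : ℓ = σ.partition.parts.card) :
    (Nat.card {f : Fin m → Equiv.Perm (Fin n) //
        (List.ofFn f).prod = σ ∧
        (∑ i : Fin m, (n - (f i).partition.parts.card)) = n + ℓ - 2 ∧
        ∀ a b : Fin n, ∃ g ∈ Subgroup.closure (Set.range f), g a = b} : ℚ) =
      (m : ℚ) * (((m - 1) * n - 1).factorial : ℚ) / (((m - 1) * n - ℓ + 2).factorial : ℚ) *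
        (σ.partition.parts.map
          (fun a : ℕ => (a : ℚ) * ((m * a - 1).choose a : ℚ))).prod := by
  subst hℓ
  have hparts : 1 ≤ σ.partition.parts.card := by
    rw [Nat.one_le_iff_ne_zero, Ne, Multiset.card_eq_zero]
    intro h
    have := σ.partition.parts_sum
    rw [h, Multiset.sum_zero, Fintype.card_fin] at this
    omega
  have := card_transitive_factorizations (S := n + σ.partition.parts.card - 2)
    (Fintype.card_fin n) hm ⟨0, hn⟩ σ (by omega)
  simpa only [cycleWeight, Nat.cast_mul] using this
end

section
/- Riemann–Hurwitz constraint for transitive factorizations: Let n ≥ 1, let σ be a permutation of {1, …, n}, and let (π_1, …, π_m) be a transitive factorization of σ. Then the integer (n − ℓ(σ)) + ∑_{i=1}^{m} (n − ℓ(π_i)) is even and is at least 2n − 2; equivalently, it equals 2n − 2 + 2g for some integer g ≥ 0. -/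
/-- The rational functions that are constant on the cycles of the permutation `p`. -/
def fixedFunctions {α : Type*} (p : Equiv.Perm α) : Submodule ℚ (α → ℚ) where
  carrier := {v | ∀ i, v (p i) = v i}
  add_mem' hv hw i := by simp only [Pi.add_apply, hv i, hw i]
  zero_mem' _ := rfl
  smul_mem' c v hv i := by simp only [Pi.smul_apply, hv i]

theorem fixedFunctions_one {α : Type*} : fixedFunctions (1 : Equiv.Perm α) = ⊤ :=
  eq_top_iff.2 fun _ _ _ => rfl

theorem mem_fixedFunctions_swap {α : Type*} [DecidableEq α] {a b : α} {v : α → ℚ} :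
    v ∈ fixedFunctions (Equiv.swap a b) ↔ v a = v b := by
  refine ⟨fun h => by simpa using (h b), fun h i => ?_⟩
  rw [Equiv.swap_apply_def]
  split_ifs <;> simp_all

/-- The rational functions fixed by every permutation in the list `L`. -/
def commonFixedFunctions {α : Type*} (L : List (Equiv.Perm α)) : Submodule ℚ (α → ℚ) :=
  ⨅ p ∈ L, fixedFunctions p

theorem mem_commonFixedFunctions {α : Type*} {L : List (Equiv.Perm α)} {v : α → ℚ} :
    v ∈ commonFixedFunctions L ↔ ∀ p ∈ L, v ∈ fixedFunctions p := by
  simp [commonFixedFunctions]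

theorem commonFixedFunctions_cons {α : Type*} (p : Equiv.Perm α) (L : List (Equiv.Perm α)) :
    commonFixedFunctions (p :: L) = fixedFunctions p ⊓ commonFixedFunctions L := by
  ext v
  simp [mem_commonFixedFunctions]

theorem mem_fixedFunctions_mul {α : Type*} {p q : Equiv.Perm α} {v : α → ℚ}
    (hp : v ∈ fixedFunctions p) (hq : v ∈ fixedFunctions q) : v ∈ fixedFunctions (p * q) :=
  fun i => (hp (q i)).trans (hq i)

theorem commonFixedFunctions_le_prod {α : Type*} (L : List (Equiv.Perm α)) :
    commonFixedFunctions L ≤ fixedFunctions L.prod := by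
  induction L with
  | nil => exact fun v _ i => rfl
  | cons p L ih =>
    rw [commonFixedFunctions_cons, List.prod_cons]
    exact fun v hv => mem_fixedFunctions_mul hv.1 (ih hv.2)

/-- Intersecting with the functions fixed by a transposition lowers the dimension by at most
one. -/
theorem finrank_le_finrank_swap_inf_add_one {α : Type*} [Fintype α] [DecidableEq α] (a b : α)
    (K : Submodule ℚ (α → ℚ)) :
    Module.finrank ℚ K ≤
      Module.finrank ℚ ↥(fixedFunctions (Equiv.swap a b) ⊓ K) + 1 := by
  let φ : (α → ℚ) →ₗ[ℚ] ℚ :=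
    LinearMap.proj (R := ℚ) (φ := fun _ => ℚ) a - LinearMap.proj (R := ℚ) (φ := fun _ => ℚ) b
  have hker : fixedFunctions (Equiv.swap a b) = LinearMap.ker φ := by
    ext v
    simp [mem_fixedFunctions_swap, φ, sub_eq_zero]
  have h1 := LinearMap.finrank_range_add_finrank_ker (φ.domRestrict K)
  have h2 : Module.finrank ℚ (LinearMap.range (φ.domRestrict K)) ≤ 1 :=
    (Submodule.finrank_le _).trans (by simp)
  have h3 : Module.finrank ℚ (LinearMap.ker (φ.domRestrict K)) =
      Module.finrank ℚ ↥(LinearMap.ker φ ⊓ K) := by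
    rw [LinearMap.ker_domRestrict, inf_comm, ← Submodule.map_comap_subtype,
      LinearEquiv.finrank_eq (Submodule.equivMapOfInjective K.subtype K.injective_subtype _)]
  rw [hker]
  omega

theorem finrank_fixedFunctions_le_swap_mul {α : Type*} [Fintype α] [DecidableEq α] (a b : α)
    (p : Equiv.Perm α) :
    Module.finrank ℚ (fixedFunctions p) ≤
      Module.finrank ℚ (fixedFunctions (Equiv.swap a b * p)) + 1 := by
  have h := Submodule.finrank_mono (R := ℚ)
    (fun v (hv : v ∈ fixedFunctions (Equiv.swap a b) ⊓ fixedFunctions p) =>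
      mem_fixedFunctions_mul hv.1 hv.2)
  have := finrank_le_finrank_swap_inf_add_one a b (fixedFunctions p)
  omega

/-- If some function fixed by `p` separates `a` and `b`, then every function fixed by
`swap a b * p` is fixed by both factors. -/
theorem fixedFunctions_swap_mul_le {α : Type*} [Fintype α] [DecidableEq α] {a b : α}
    {p : Equiv.Perm α} {k : α → ℚ} (hk : k ∈ fixedFunctions p) (hab : k a ≠ k b) :
    fixedFunctions (Equiv.swap a b * p) ≤
      fixedFunctions (Equiv.swap a b) ⊓ fixedFunctions p := by
  intro v hv
  have hne : a ≠ b := fun h => hab (h ▸ rfl)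
  have hsum : ∑ i, (v (Equiv.swap a b i) - v i) * k i = 0 := by
    have h : ∑ i, v (Equiv.swap a b i) * k i = ∑ i, v i * k i := by
      rw [← Equiv.sum_comp p]
      exact Finset.sum_congr rfl fun i _ => by rw [hk i]; congr 1; exact hv i
    simp only [sub_mul, Finset.sum_sub_distrib, h, sub_self]
  rw [Fintype.sum_eq_add a b hne fun i hi => by
    rw [Equiv.swap_apply_of_ne_of_ne hi.1 hi.2, sub_self, zero_mul],
    Equiv.swap_apply_left, Equiv.swap_apply_right] at hsum
  have hvab : v a = v b := by
    have : (v a - v b) * (k a - k b) = 0 := by linarith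
    exact sub_eq_zero.1 ((mul_eq_zero.1 this).resolve_right (sub_ne_zero.2 hab))
  have hs : v ∈ fixedFunctions (Equiv.swap a b) := mem_fixedFunctions_swap.2 hvab
  exact ⟨hs, fun i => (hs (p i)).symm.trans (hv i)⟩

theorem card_le_finrank_fixedFunctions_prod_add_length {α : Type*} [Fintype α] [DecidableEq α]
    (L : List (Equiv.Perm α)) (hL : ∀ p ∈ L, ∃ a b, p = Equiv.swap a b) :
    Fintype.card α ≤ Module.finrank ℚ (fixedFunctions L.prod) + L.length := by
  induction L with
  | nil =>
    rw [List.prod_nil, fixedFunctions_one, finrank_top]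
    simp
  | cons p L ih =>
    obtain ⟨a, b, rfl⟩ := hL p (by simp)
    have h1 := ih fun q hq => hL q (by simp [hq])
    have h2 := finrank_fixedFunctions_le_swap_mul a b L.prod
    rw [List.prod_cons, List.length_cons]
    omega

/-- The Riemann–Hurwitz inequality for products of transpositions. -/
theorem card_add_finrank_fixedFunctions_prod_le {α : Type*} [Fintype α] [DecidableEq α]
    (L : List (Equiv.Perm α)) (hL : ∀ p ∈ L, ∃ a b, p = Equiv.swap a b) :
    Fintype.card α + Module.finrank ℚ (fixedFunctions L.prod) ≤
      L.length + 2 * Module.finrank ℚ (commonFixedFunctions L) := by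
  induction L with
  | nil =>
    have h : commonFixedFunctions ([] : List (Equiv.Perm α)) = ⊤ := by
      simp [commonFixedFunctions]
    rw [List.prod_nil, fixedFunctions_one, h, finrank_top]
    simp [two_mul]
  | cons p L ih =>
    obtain ⟨a, b, rfl⟩ := hL p (by simp)
    have h1 := ih fun q hq => hL q (by simp [hq])
    rw [List.prod_cons, List.length_cons, commonFixedFunctions_cons]
    by_cases hK : commonFixedFunctions L ≤ fixedFunctions (Equiv.swap a b)
    · rw [inf_eq_right.2 hK]
      have h2 := finrank_fixedFunctions_le_swap_mul a b (Equiv.swap a b * L.prod)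
      rw [Equiv.swap_mul_self_mul] at h2
      omega
    · obtain ⟨k, hkL, hk⟩ := SetLike.not_le_iff_exists.1 hK
      rw [mem_fixedFunctions_swap] at hk
      have hkp := commonFixedFunctions_le_prod L hkL
      have h2 : fixedFunctions (Equiv.swap a b * L.prod) < fixedFunctions L.prod :=
        lt_of_le_of_ne ((fixedFunctions_swap_mul_le hkp hk).trans inf_le_right) fun h =>
          hk (mem_fixedFunctions_swap.1 (fixedFunctions_swap_mul_le hkp hk (h ▸ hkp)).1)
      have h3 := Submodule.finrank_lt_finrank_of_lt h2
      have h4 := finrank_le_finrank_swap_inf_add_one a b (commonFixedFunctions L)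
      omega

/-- A permutation of `n` points with `ℓ` cycles is a product of `n - ℓ` transpositions. -/
theorem exists_swap_list_prod_eq {α : Type*} [Fintype α] [DecidableEq α] (p : Equiv.Perm α) :
    ∃ L : List (Equiv.Perm α), (∀ q ∈ L, ∃ a b, q = Equiv.swap a b) ∧ L.prod = p ∧
      L.length + p.cycleType.card = p.cycleType.sum := by
  induction p using Equiv.Perm.cycle_induction_on with
  | base_one => exact ⟨[], by simp⟩
  | base_cycles p hp =>
    obtain ⟨x, hx, -⟩ := id hp
    refine ⟨List.zipWith Equiv.swap (p.toList x) (p.toList x).tail, fun q hq => ?_, ?_, ?_⟩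
    · obtain ⟨i, _, rfl⟩ := List.mem_iff_getElem.1 hq
      exact ⟨_, _, List.getElem_zipWith⟩
    · rw [← hp.cycleOf_eq hx]
      simpa [hp.cycleOf_eq hx, List.formPerm] using Equiv.Perm.formPerm_toList p x
    · have := hp.two_le_card_support
      simp [hp.cycleType, hp.cycleOf_eq hx]
      omega
  | induction_disjoint p q hd _ ihp ihq =>
    obtain ⟨L, hL, hLp, hLl⟩ := ihp
    obtain ⟨M, hM, hMq, hMl⟩ := ihq
    refine ⟨L ++ M, fun r hr => (List.mem_append.1 hr).elim (hL r) (hM r), by simp [hLp, hMq], ?_⟩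
    simp only [hd.cycleType_mul, List.length_append, Multiset.card_add, Multiset.sum_add]
    omega

theorem card_parts_partition_add_sum_cycleType {α : Type*} [Fintype α] [DecidableEq α]
    (p : Equiv.Perm α) :
    p.partition.parts.card + p.cycleType.sum = Fintype.card α + p.cycleType.card := by
  have := p.support.card_le_univ
  rw [Equiv.Perm.parts_partition, Multiset.card_add, Multiset.card_replicate,
    Equiv.Perm.sum_cycleType]
  omega

theorem sign_eq_neg_one_pow_length {α : Type*} [Fintype α] [DecidableEq α] {p : Equiv.Perm α}
    {k : ℕ} (hk : k + p.cycleType.card = p.cycleType.sum) :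
    Equiv.Perm.sign p = (-1) ^ k := by
  rw [Equiv.Perm.sign_of_cycleType, ← hk, add_assoc, pow_add, ← two_mul, pow_mul]
  simp

theorem finrank_commonFixedFunctions_le_one {α : Type*} [Fintype α] [Nonempty α]
    (L : List (Equiv.Perm α))
    (h : ∀ v ∈ commonFixedFunctions L, ∀ a b, v a = v b) :
    Module.finrank ℚ (commonFixedFunctions L) ≤ 1 := by
  have hle : commonFixedFunctions L ≤ Submodule.span ℚ {fun _ => 1} := fun v hv =>
    Submodule.mem_span_singleton.2
      ⟨v (Classical.arbitrary α), funext fun i => by simpa using h v hv _ i⟩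
  exact (Submodule.finrank_mono hle).trans
    (by simpa using finrank_span_le_card (R := ℚ) {fun _ : α => (1 : ℚ)})

/-- Riemann–Hurwitz constraint: if `(π₁, …, π_m)` is a transitive factorization of
`σ ∈ S_n` (`n ≥ 1`), then `(n - ℓ(σ)) + ∑ᵢ (n - ℓ(πᵢ)) = 2n - 2 + 2g` for some
integer `g ≥ 0`, where `ℓ(π)` counts all cycles of `π` including fixed points. -/
theorem stmt6 (n m : ℕ) (hn : 1 ≤ n) (σ : Equiv.Perm (Fin n))
    (f : Fin m → Equiv.Perm (Fin n))
    (hprod : (List.ofFn f).prod = σ)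
    (htrans : ∀ a b : Fin n, ∃ g ∈ Subgroup.closure (Set.range f), g a = b) :
    ∃ g : ℕ,
      ((n : ℤ) - σ.partition.parts.card) +
          ∑ i : Fin m, ((n : ℤ) - (f i).partition.parts.card) =
        2 * (n : ℤ) - 2 + 2 * (g : ℤ) := by
  have : Nonempty (Fin n) := ⟨⟨0, hn⟩⟩
  have hrank (p : Equiv.Perm (Fin n)) (k : ℕ) (hk : k + p.cycleType.card = p.cycleType.sum) :
      (n : ℤ) - p.partition.parts.card = k := by
    have := card_parts_partition_add_sum_cycleType p
    have := Fintype.card_fin n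
    omega
  obtain ⟨S, hS, hSp, hSl⟩ := exists_swap_list_prod_eq σ
  choose L hL hLp hLl using fun i => exists_swap_list_prod_eq (f i)
  set T := (List.ofFn L).flatten with hT
  have hTp : T.prod = σ := by
    rw [hT, List.prod_flatten, List.map_ofFn, ← hprod]
    exact congrArg (fun h => (List.ofFn h).prod) (funext hLp)
  have hTl : T.length = ∑ i, (L i).length := by
    simp [hT, List.length_flatten, List.map_ofFn, List.sum_ofFn]
  have hTs : ∀ q ∈ T, ∃ a b, q = Equiv.swap a b := by
    intro q hq
    obtain ⟨l, hl, hql⟩ := List.mem_flatten.1 hq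
    obtain ⟨i, rfl⟩ := (List.mem_ofFn' _ _).1 hl
    exact hL i q hql
  have hK : Module.finrank ℚ (commonFixedFunctions T) ≤ 1 := by
    refine finrank_commonFixedFunctions_le_one T fun v hv a b => ?_
    obtain ⟨g, hg, rfl⟩ := htrans a b
    have hvg : v ∈ fixedFunctions g := by
      induction hg using Subgroup.closure_induction with
      | mem x hx =>
        obtain ⟨i, rfl⟩ := hx
        rw [← hLp i]
        refine commonFixedFunctions_le_prod _ (mem_commonFixedFunctions.2 fun p hp => ?_)
        exact mem_commonFixedFunctions.1 hv p
          (List.mem_flatten.2 ⟨L i, (List.mem_ofFn' _ _).2 ⟨i, rfl⟩, hp⟩)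
      | one => exact fun _ => rfl
      | mul x y _ _ hx hy => exact mem_fixedFunctions_mul hx hy
      | inv x _ hx => exact fun i => by simpa using (hx (x⁻¹ i)).symm
    exact (hvg a).symm
  have h1 := card_add_finrank_fixedFunctions_prod_le T hTs
  have h2 := card_le_finrank_fixedFunctions_prod_add_length S hS
  rw [Fintype.card_fin] at h1 h2
  rw [hTp] at h1
  rw [hSp] at h2
  have hpar : Even (S.length + T.length) := by
    have hs : Equiv.Perm.sign σ = (-1) ^ T.length := by
      rw [← hprod, map_list_prod, List.map_ofFn, List.prod_ofFn, hTl,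
        ← Finset.prod_pow_eq_pow_sum]
      exact Finset.prod_congr rfl fun i _ => sign_eq_neg_one_pow_length (hLl i)
    rw [sign_eq_neg_one_pow_length hSl] at hs
    rcases Nat.even_or_odd S.length with h | h <;> rcases Nat.even_or_odd T.length with h' | h'
    · exact h.add h'
    · rw [h.neg_one_pow, h'.neg_one_pow] at hs
      exact absurd hs (by decide)
    · rw [h.neg_one_pow, h'.neg_one_pow] at hs
      exact absurd hs (by decide)
    · exact h.add_odd h'
  obtain ⟨c, hc⟩ := hpar
  refine ⟨c + 1 - n, ?_⟩
  rw [hrank σ _ hSl, Finset.sum_congr rfl fun i _ => hrank (f i) _ (hLl i), ← Nat.cast_sum, ← hTl]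
  omega
end

section
/- Let n ≥ 1, let F be a field, and let t_1, …, t_n be pairwise distinct elements of F. Then ∑_{A} ∑_{i ∈ A} (1 − t_i) ∏_{j ∈ A∖{i}} (t_i − t_j)^{−1} = −(n(n−1)/2)·1_F, where the outer sum is over all subsets A of {1, …, n} with |A| ≥ 2. -/
/-- The divided difference of `1 - X` at `#A ≥ 2` distinct nodes: it is `-1` for two nodes and
`0` for more. -/
theorem sum_one_sub_mul_prod_inv_sub {ι F : Type*} [DecidableEq ι] [Field F] {t : ι → F}
    {A : Finset ι} (ht : Set.InjOn t A) (hA : 2 ≤ A.card) :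
    ∑ i ∈ A, (1 - t i) * ∏ j ∈ A.erase i, (t i - t j)⁻¹ = if A.card = 2 then -1 else 0 := by
  have hdeg : (1 - Polynomial.X : Polynomial F).degree < A.card := by
    refine lt_of_le_of_lt (b := ((1 : ℕ) : WithBot ℕ)) ?_ (by exact_mod_cast hA)
    exact (Polynomial.degree_sub_le _ _).trans (by simp)
  have h := Lagrange.coeff_eq_sum ht hdeg
  simp only [Polynomial.eval_sub, Polynomial.eval_one, Polynomial.eval_X, div_eq_mul_inv,
    ← Finset.prod_inv_distrib] at h
  rw [← h, Polynomial.coeff_sub, Polynomial.coeff_one, Polynomial.coeff_X,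
    if_neg (by omega), zero_sub]
  split_ifs <;> first | omega | simp

/-- For `n ≥ 1` and pairwise distinct `t₁, …, tₙ` in a field `F`,
`∑_{A ⊆ [n], |A| ≥ 2} ∑_{i ∈ A} (1 - tᵢ) ∏_{j ∈ A∖{i}} (tᵢ - tⱼ)⁻¹ = -C(n,2)` in `F`. -/
theorem stmt8 (n : ℕ) (hn : 1 ≤ n) (F : Type*) [Field F] (t : Fin n → F)
    (ht : Function.Injective t) :
    ∑ A ∈ (Finset.univ : Finset (Fin n)).powerset.filter (fun A => 2 ≤ A.card),
      ∑ i ∈ A, (1 - t i) * ∏ j ∈ A.erase i, (t i - t j)⁻¹ =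
      -(n.choose 2 : F) := by
  rw [Finset.sum_congr rfl fun A hA =>
      sum_one_sub_mul_prod_inv_sub ht.injOn (Finset.mem_filter.mp hA).2,
    ← Finset.sum_filter, Finset.filter_filter,
    Finset.filter_congr (q := fun A => A.card = 2) (by intros; omega),
    ← Finset.powersetCard_eq_filter]
  simp
end
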